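/- Let f be a Brouwer homeomorphism of the plane. Then the polynomial entropy of f equals 1 if and only if f is conjugate to a translation, i.e., if and only if there exists a homeomorphism h of ℝ² such that h ∘ f ∘ h⁻¹ is the translation T(x,y) = (x+1, y). -/

import Mathlib

open Filter Topology Set
open scoped ENNReal

/-- `E` is `(n, ε)`-separated for `f`: any two distinct points of `E` are `ε`-apart at some
time `k ∈ {0, …, n-1}`. -/
def IsDynSeparated {X : Type*} [MetricSpace X] (f : X → X) (n : ℕ) (ε : ℝ) (E : Set X) : Prop :=
  ∀ x ∈ E, ∀ y ∈ E, x ≠ y → ∃ k < n, ε < dist (f^[k] x) (f^[k] y)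

/-- `S(n, ε)`: the maximal cardinality of an `(n, ε)`-separated set. -/
noncomputable def maxSep {X : Type*} [MetricSpace X] (f : X → X) (n : ℕ) (ε : ℝ) : ℕ :=
  sSup {m | ∃ E : Finset X, IsDynSeparated f n ε ↑E ∧ E.card = m}

/-- Polynomial entropy `h_pol(f) = lim_{ε → 0} limsup_n (log S(n,ε) / log n)`, a value in
`[0, ∞]`.  Since `ε ↦ limsup_n (log S(n,ε) / log n)` is nonincreasing in `ε`, the limit as
`ε → 0⁺` is the supremum over `ε > 0`. -/
noncomputable def polEntropy {X : Type*} [MetricSpace X] (f : X → X) : ℝ≥0∞ :=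
  ⨆ (ε : ℝ) (_ : 0 < ε),
    Filter.atTop.limsup fun n : ℕ =>
      ENNReal.ofReal (Real.log (maxSep f n ε) / Real.log n)

/-- An injective map `S² = ℝ² ∪ {∞} → ℝ² × ℝ` realizing the one-point compactification of
the plane as a compact subset of `ℝ³` (it is a homeomorphism onto its image, being a
continuous injection from a compact space to a Hausdorff space): `∞ ↦ ((0,0), 0)` and
`w ↦ ((1+‖w‖²)⁻¹ • w, (1+‖w‖²)⁻¹)`. -/
noncomputable def spherePoint : OnePoint (ℝ × ℝ) → (ℝ × ℝ) × ℝ :=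
  fun z => Option.elim z (((0 : ℝ), (0 : ℝ)), (0 : ℝ))
    (fun w => ((1 + ‖w‖ ^ 2)⁻¹ • w, (1 + ‖w‖ ^ 2)⁻¹))

lemma spherePoint_injective : Function.Injective spherePoint := by
  have key_pos : ∀ w : ℝ × ℝ, (0:ℝ) < (1 + ‖w‖ ^ 2)⁻¹ := fun w => by positivity
  intro a b hab
  cases a with
  | infty =>
    cases b with
    | infty => rfl
    | coe w =>
      exfalso
      have h2 := congrArg Prod.snd hab
      simp only [spherePoint, Option.elim] at h2
      exact (ne_of_gt (key_pos w)) h2.symm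
  | coe v =>
    cases b with
    | infty =>
      exfalso
      have h2 := congrArg Prod.snd hab
      simp only [spherePoint, Option.elim] at h2
      exact (ne_of_gt (key_pos v)) h2
    | coe w =>
      have h2 := congrArg Prod.snd hab
      have h1 := congrArg Prod.fst hab
      simp only [spherePoint, Option.elim] at h1 h2
      rw [h2] at h1
      exact congrArg _ (smul_right_injective (ℝ × ℝ) (ne_of_gt (key_pos w)) h1)

/-- A (compatible) metric on the one-point compactification `S² = ℝ² ∪ {∞}`, induced by the
embedding `spherePoint` of `S²` onto a compact subset of `ℝ³`; with it `S²` is a compact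
metric space, and its metric topology is the one-point-compactification topology. -/
noncomputable instance : MetricSpace (OnePoint (ℝ × ℝ)) :=
  MetricSpace.induced spherePoint spherePoint_injective inferInstance

/-- The extension of a plane map to the one-point compactification `S² = ℝ² ∪ {∞}`,
fixing `∞`. -/
def onePointExtend (g : ℝ × ℝ → ℝ × ℝ) : OnePoint (ℝ × ℝ) → OnePoint (ℝ × ℝ) :=
  Option.map g

/-- The translation `T(x,y) = (x+1, y)` of the plane. -/
def planeTranslation : ℝ × ℝ → ℝ × ℝ := fun z => (z.1 + 1, z.2)

/-- A Brouwer homeomorphism: a fixed-point-free homeomorphism of the plane which preserves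
orientation, equivalently is isotopic to the identity: there is a continuous family
`(H t)_{t ∈ [0,1]}` of homeomorphisms of the plane with `H 0 = id` and `H 1 = f`. -/
def IsBrouwer (f : (ℝ × ℝ) ≃ₜ (ℝ × ℝ)) : Prop :=
  (∀ z, f z ≠ z) ∧
  ∃ H : ℝ → (ℝ × ℝ) → (ℝ × ℝ),
    Continuous (fun q : ℝ × (ℝ × ℝ) => H q.1 q.2) ∧
    (∀ t ∈ Set.Icc (0 : ℝ) 1, ∃ g : (ℝ × ℝ) ≃ₜ (ℝ × ℝ), ⇑g = H t) ∧
    H 0 = id ∧ H 1 = ⇑f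

lemma exists_log_homotopy {A : Type*} [TopologicalSpace A] (G : unitInterval × A → ℂ)
    (hG : Continuous G) (hne : ∀ x, G x ≠ 0) (l : A → ℂ) (hl : Continuous l)
    (h0 : ∀ a, G (0, a) = Complex.exp (l a)) :
    ∃ L : unitInterval × A → ℂ, Continuous L ∧ (∀ x, Complex.exp (L x) = G x) ∧
      ∀ a, L (0, a) = l a := by
  let H : C(unitInterval × A, {z : ℂ // z ≠ 0}) := ⟨fun x => ⟨G x, hne x⟩, by fun_prop⟩
  have hH : ∀ a, H (0, a) = (fun z : ℂ ↦ (⟨_, z.exp_ne_zero⟩ : {z : ℂ // z ≠ 0}))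
      ((⟨l, hl⟩ : C(A, ℂ)) a) := fun a => Subtype.ext (h0 a)
  refine ⟨Complex.isCoveringMap_exp.liftHomotopy H ⟨l, hl⟩ hH, map_continuous _, fun x => ?_,
    fun a => Complex.isCoveringMap_exp.liftHomotopy_zero H ⟨l, hl⟩ hH a⟩
  have := congrFun (Complex.isCoveringMap_exp.liftHomotopy_lifts H ⟨l, hl⟩ hH) x
  exact congrArg Subtype.val this

lemma exists_log_of_convex {V : Type*} [NormedAddCommGroup V] [NormedSpace ℝ V] {S : Set V}
    (hS : Convex ℝ S) {g : V → ℂ} (hg : ContinuousOn g S) (hne : ∀ x ∈ S, g x ≠ 0) :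
    ∃ L : V → ℂ, ContinuousOn L S ∧ ∀ x ∈ S, Complex.exp (L x) = g x := by
  classical
  rcases S.eq_empty_or_nonempty with rfl | ⟨x₀, hx₀⟩
  · exact ⟨0, by simp, by simp⟩
  have key : ∀ p : unitInterval × S, x₀ + (p.1 : ℝ) • ((p.2 : V) - x₀) ∈ S := fun p =>
    hS.add_smul_sub_mem hx₀ p.2.2 p.1.2
  obtain ⟨L, hL, hexp, -⟩ := exists_log_homotopy (A := S)
    (fun p => g (x₀ + (p.1 : ℝ) • ((p.2 : V) - x₀)))
    (hg.comp_continuous (by fun_prop) key) (fun p => hne _ (key p))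
    (fun _ => Complex.log (g x₀)) continuous_const
    (fun a => by simp [Complex.exp_log (hne x₀ hx₀)])
  refine ⟨fun x => if h : x ∈ S then L (1, ⟨x, h⟩) else 0, ?_, fun x hx => ?_⟩
  · rw [continuousOn_iff_continuous_domRestrict]
    have : S.domRestrict (fun x => if h : x ∈ S then L (1, ⟨x, h⟩) else 0) = fun x => L (1, x) := by
      ext x; simp [Set.domRestrict]
    rw [this]; fun_prop
  · simp [hx, hexp]

lemma log_sub_const {X : Type*} [TopologicalSpace X] {s : Set X} (hs : IsPreconnected s)
    {L₁ L₂ : X → ℂ} (h₁ : ContinuousOn L₁ s) (h₂ : ContinuousOn L₂ s)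
    (he : ∀ x ∈ s, Complex.exp (L₁ x) = Complex.exp (L₂ x)) {x y : X} (hx : x ∈ s) (hy : y ∈ s) :
    L₁ x - L₂ x = L₁ y - L₂ y := by
  have := Complex.isCoveringMap_exp.eqOn_of_comp_eqOn (s := s) (g₁ := L₁)
    (g₂ := fun z => L₂ z + (L₁ x - L₂ x)) hs h₁ (h₂.add continuousOn_const)
    (fun z hz => Subtype.ext (by
      have e : Complex.exp (L₁ x - L₂ x) = 1 := by
        rw [Complex.exp_sub, he x hx, div_self (Complex.exp_ne_zero _)]
      simp [Complex.exp_add, e, he z hz])) hx (by ring) hy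
  simp only at this
  rw [this]; ring

/-- A continuous logarithm of a function with values in a slit plane rotated by `c` moves like the
principal logarithm. -/
lemma log_sub_eq_of_slit {X : Type*} [TopologicalSpace X] {s : Set X} (hs : IsPreconnected s)
    {L g : X → ℂ} (hL : ContinuousOn L s) (c : ℂ) (hexp : ∀ x ∈ s, Complex.exp (L x) = g x)
    (hg : ∀ x ∈ s, c * g x ∈ Complex.slitPlane) {x y : X} (hx : x ∈ s) (hy : y ∈ s) :
    L x - L y = Complex.log (c * g x) - Complex.log (c * g y) := by
  have hc : c ≠ 0 := by
    rintro rfl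
    have := hg x hx
    simp at this
  have hgc : ContinuousOn g s := (Complex.continuous_exp.comp_continuousOn hL).congr
    fun z hz => (hexp z hz).symm
  have := log_sub_const hs (L₁ := L) (L₂ := fun z => Complex.log (c * g z) - Complex.log c) hL
    (((continuousOn_const.mul hgc).clog hg).sub continuousOn_const)
    (fun z hz => by
      rw [hexp z hz, Complex.exp_sub, Complex.exp_log hc,
        Complex.exp_log (Complex.slitPlane_ne_zero (hg z hz)), mul_div_cancel_left₀ _ hc])
    hx hy
  linear_combination this

lemma log_sub_eq_of_slitPlane {X : Type*} [TopologicalSpace X] {s : Set X}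
    (hs : IsPreconnected s) {L g : X → ℂ} (hL : ContinuousOn L s)
    (hexp : ∀ x ∈ s, Complex.exp (L x) = g x)
    (hg : ∀ x ∈ s, g x ∈ Complex.slitPlane) {x y : X} (hx : x ∈ s) (hy : y ∈ s) :
    L x - L y = Complex.log (g x) - Complex.log (g y) := by
  simpa using log_sub_eq_of_slit hs hL 1 hexp (by simpa using hg) hx hy

lemma exists_path_crossing {a b : ℝ → ℝ × ℝ} (ha : ContinuousOn a (Icc 0 1))
    (hb : ContinuousOn b (Icc 0 1)) (h₀ : ∀ t ∈ Icc (0 : ℝ) 1, (a 0).1 ≤ (b t).1)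
    (h₁ : ∀ t ∈ Icc (0 : ℝ) 1, (b t).1 ≤ (a 1).1)
    (h₂ : ∀ s ∈ Icc (0 : ℝ) 1, (b 0).2 < (a s).2)
    (h₃ : ∀ s ∈ Icc (0 : ℝ) 1, (a s).2 < (b 1).2) :
    ∃ s ∈ Icc (0 : ℝ) 1, ∃ t ∈ Icc (0 : ℝ) 1, a s = b t := by
  by_contra! hne
  let Z : ℝ × ℝ → ℂ := fun p => ⟨(b p.2).1 - (a p.1).1, (b p.2).2 - (a p.1).2⟩
  have hZc : ContinuousOn Z (Icc 0 1 ×ˢ Icc 0 1) := by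
    have hb' : ContinuousOn (fun p : ℝ × ℝ => b p.2) (Icc 0 1 ×ˢ Icc 0 1) :=
      hb.comp continuousOn_snd fun p hp => hp.2
    have ha' : ContinuousOn (fun p : ℝ × ℝ => a p.1) (Icc 0 1 ×ˢ Icc 0 1) :=
      ha.comp continuousOn_fst fun p hp => hp.1
    exact Complex.equivRealProdCLM.symm.continuous.comp_continuousOn
      ((hb'.fst.sub ha'.fst).prodMk (hb'.snd.sub ha'.snd))
  have hZ0 : ∀ p ∈ (Icc 0 1 ×ˢ Icc 0 1 : Set (ℝ × ℝ)), Z p ≠ 0 := fun p hp h0 => by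
    have h1 := congrArg Complex.re h0
    have h2 := congrArg Complex.im h0
    simp only [Z, Complex.zero_re, Complex.zero_im] at h1 h2
    exact hne p.1 hp.1 p.2 hp.2 (Prod.ext (by linarith) (by linarith))
  obtain ⟨L, hL, he⟩ := exists_log_of_convex ((convex_Icc (0 : ℝ) 1).prod (convex_Icc (0 : ℝ) 1))
    hZc hZ0
  have z0 : (0 : ℝ) ∈ Icc (0 : ℝ) 1 := by simp
  have z1 : (1 : ℝ) ∈ Icc (0 : ℝ) 1 := by simp
  have e1 := log_sub_eq_of_slitPlane (s := {(0 : ℝ)} ×ˢ Icc (0 : ℝ) 1)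
    (isPreconnected_singleton.prod isPreconnected_Icc)
    (hL.mono (by gcongr; simp)) (fun x hx => he x ⟨by rw [hx.1]; exact z0, hx.2⟩) (fun x hx => by
      have hx1 : x.1 = 0 := hx.1
      have hn := hZ0 x ⟨by rw [hx1]; exact z0, hx.2⟩
      rw [Complex.mem_slitPlane_iff]
      by_contra! hcon
      refine hn (Complex.ext ?_ hcon.2)
      refine le_antisymm hcon.1 ?_
      simpa [Z, hx1] using h₀ x.2 hx.2) (x := (0, 1)) (y := (0, 0))
    ⟨rfl, z1⟩ ⟨rfl, z0⟩
  have e2 := log_sub_eq_of_slitPlane (s := Icc (0 : ℝ) 1 ×ˢ {(1 : ℝ)})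
    (isPreconnected_Icc.prod isPreconnected_singleton)
    (hL.mono (by gcongr; simp)) (fun x hx => he x ⟨hx.1, by rw [hx.2]; exact z1⟩) (fun x hx => by
      have hx1 : x.2 = 1 := hx.2
      refine Or.inr (ne_of_gt ?_)
      simpa [Z, hx1] using h₃ x.1 hx.1) (x := (1, 1)) (y := (0, 1))
    ⟨z1, rfl⟩ ⟨z0, rfl⟩
  have e3 := log_sub_eq_of_slit (s := {(1 : ℝ)} ×ˢ Icc (0 : ℝ) 1)
    (isPreconnected_singleton.prod isPreconnected_Icc)
    (hL.mono (by gcongr; simp)) (-1) (fun x hx => he x ⟨by rw [hx.1]; exact z1, hx.2⟩)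
    (fun x hx => by
      have hx1 : x.1 = 1 := hx.1
      have hn := hZ0 x ⟨by rw [hx1]; exact z1, hx.2⟩
      rw [Complex.mem_slitPlane_iff]
      by_contra! hcon
      refine hn (Complex.ext ?_ (by simpa using hcon.2))
      refine le_antisymm ?_ (by simpa using hcon.1)
      simpa [Z, hx1] using h₁ x.2 hx.2) (x := (1, 0)) (y := (1, 1))
    ⟨rfl, z0⟩ ⟨rfl, z1⟩
  have e4 := log_sub_eq_of_slitPlane (s := Icc (0 : ℝ) 1 ×ˢ {(0 : ℝ)})
    (isPreconnected_Icc.prod isPreconnected_singleton)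
    (hL.mono (by gcongr; simp)) (fun x hx => he x ⟨hx.1, by rw [hx.2]; exact z0⟩) (fun x hx => by
      have hx1 : x.2 = 0 := hx.2
      refine Or.inr (ne_of_lt ?_)
      simpa [Z, hx1] using h₂ x.1 hx.1) (x := (0, 0)) (y := (1, 0))
    ⟨z0, rfl⟩ ⟨z1, rfl⟩
  have p11 : 0 < (Z (1, 1)).im := by simpa [Z] using h₃ 1 z1
  have p10 : (Z (1, 0)).im < 0 := by simpa [Z] using h₂ 1 z1
  have key : Complex.log (Z (1, 1)) - Complex.log (-Z (1, 1)) =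
      Complex.log (Z (1, 0)) - Complex.log (-Z (1, 0)) := by
    simp only [neg_one_mul] at e3
    linear_combination -e1 - e2 - e3 - e4
  have := congrArg Complex.im key
  simp only [Complex.sub_im, Complex.log_im, Complex.arg_neg_eq_arg_sub_pi_of_im_pos p11,
    Complex.arg_neg_eq_arg_add_pi_of_im_neg p10] at this
  linarith [Real.pi_pos]

/-- Unicoherence of real normed spaces. -/
lemma isPreconnected_inter_of_union_eq_univ {V : Type*} [NormedAddCommGroup V] [NormedSpace ℝ V]
    {A B : Set V} (hA : IsClosed A) (hB : IsClosed B) (hAc : IsPreconnected A)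
    (hBc : IsPreconnected B) (hAB : A ∪ B = univ) : IsPreconnected (A ∩ B) := by
  classical
  rw [isPreconnected_closed_iff]
  rintro t t' ht ht' hsub ⟨x, hxAB, hxt⟩ ⟨y, hyAB, hyt⟩
  by_contra hemp
  rw [not_nonempty_iff_eq_empty] at hemp
  have hdisj : Disjoint (A ∩ B ∩ t) (A ∩ B ∩ t') := by
    rw [Set.disjoint_iff_inter_eq_empty, ← hemp]
    ext z; simp only [mem_inter_iff]; tauto
  obtain ⟨u, hu0, hu1, -⟩ := exists_continuous_zero_one_of_isClosed
    ((hA.inter hB).inter ht) ((hA.inter hB).inter ht') hdisj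
  let π' : ℂ := Real.pi
  let g : V → ℂ := fun z => if z ∈ A then Complex.exp (u z * (π' * Complex.I)) else
    Complex.exp (-(u z * (π' * Complex.I)))
  have hgA : ∀ z ∈ A, g z = Complex.exp (u z * (π' * Complex.I)) := fun z hz => by simp [g, hz]
  have hgB : ∀ z ∈ B, g z = Complex.exp (-(u z * (π' * Complex.I))) := fun z hz => by
    by_cases hzA : z ∈ A
    · rw [hgA z hzA]
      rcases hsub ⟨hzA, hz⟩ with h | h
      · simp [hu0 ⟨⟨hzA, hz⟩, h⟩]
      · simp [hu1 ⟨⟨hzA, hz⟩, h⟩, π', Complex.exp_neg, Complex.exp_pi_mul_I]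
    · simp [g, hzA]
  have hgc : ContinuousOn g univ := by
    rw [← hAB]
    refine ContinuousOn.union_of_isClosed ?_ ?_ hA hB
    · exact ContinuousOn.congr (by fun_prop) hgA
    · exact ContinuousOn.congr (by fun_prop) hgB
  obtain ⟨L, hL, he⟩ := exists_log_of_convex convex_univ hgc
    (fun z _ => by
      simp only [g]; split_ifs <;> exact Complex.exp_ne_zero _)
  have eA := log_sub_const hAc (hL.mono (subset_univ _))
    (L₂ := fun z => u z * (π' * Complex.I)) (by fun_prop)
    (fun z hz => by rw [he z trivial, hgA z hz]) hxAB.1 hyAB.1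
  have eB := log_sub_const hBc (hL.mono (subset_univ _))
    (L₂ := fun z => -(u z * (π' * Complex.I))) (by fun_prop)
    (fun z hz => by rw [he z trivial, hgB z hz]) hxAB.2 hyAB.2
  have ux : u x = 0 := hu0 ⟨hxAB, hxt⟩
  have uy : u y = 1 := hu1 ⟨hyAB, hyt⟩
  simp only [ux, uy] at eA eB
  have h2 : π' * Complex.I = 0 := by
    push_cast at eA eB
    linear_combination (eA - eB) / 2
  simp [π', Real.pi_ne_zero] at h2

/-- The plane as the complex plane. -/
noncomputable def toCplx : (ℝ × ℝ) ≃L[ℝ] ℂ := Complex.equivRealProdCLM.symm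

lemma toCplx_sub_ne_zero {a b : ℝ × ℝ} (h : a ≠ b) : toCplx (a - b) ≠ 0 := by
  simpa [sub_eq_zero] using h

lemma toCplx_sub_comm (a b : ℝ × ℝ) : toCplx (a - b) = -toCplx (b - a) := by
  rw [← map_neg, neg_sub]

/-- Continuous determinations of the direction of the displacement of `f` and of the variation of
direction of pairs of points, which are compatible with each other. -/
def HasAngleLifts (f : ℝ × ℝ → ℝ × ℝ) : Prop :=
  ∃ (θ : ℝ × ℝ → ℂ) (W : (ℝ × ℝ) × (ℝ × ℝ) → ℂ), Continuous θ ∧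
    ContinuousOn W {p | p.1 ≠ p.2} ∧ (∀ z, Complex.exp (θ z) = toCplx (f z - z)) ∧
    (∀ p q, p ≠ q → Complex.exp (W (p, q)) = toCplx (f q - f p) / toCplx (q - p)) ∧
    (∀ p q, W (p, q) = W (q, p)) ∧ ∀ z, θ (f z) = θ z + W (z, f z)

/-- Pairs of distinct points of the plane. -/
abbrev OffDiag : Type := {p : (ℝ × ℝ) × (ℝ × ℝ) // p.1 ≠ p.2}

lemma HasAngleLifts.of_isotopy {f : ℝ × ℝ → ℝ × ℝ} (hfix : ∀ z, f z ≠ z)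
    {H : ℝ → ℝ × ℝ → ℝ × ℝ} (hH : Continuous (fun q : ℝ × (ℝ × ℝ) => H q.1 q.2))
    (hinj : ∀ t ∈ Icc (0 : ℝ) 1, Function.Injective (H t)) (h0 : H 0 = id) (h1 : H 1 = f) :
    HasAngleLifts f := by
  classical
  have hf : Continuous f := by rw [← h1]; exact hH.comp (by fun_prop : Continuous fun z => ((1 : ℝ), z))
  let G : unitInterval × OffDiag → ℂ := fun x =>
    toCplx (H x.1 x.2.1.2 - H x.1 x.2.1.1) / toCplx (x.2.1.2 - x.2.1.1)
  have hGc : Continuous G := by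
    have e1 : Continuous fun x : unitInterval × OffDiag => H x.1 x.2.1.2 :=
      hH.comp (by fun_prop : Continuous fun x : unitInterval × OffDiag => ((x.1 : ℝ), x.2.1.2))
    have e2 : Continuous fun x : unitInterval × OffDiag => H x.1 x.2.1.1 :=
      hH.comp (by fun_prop : Continuous fun x : unitInterval × OffDiag => ((x.1 : ℝ), x.2.1.1))
    exact (toCplx.continuous.comp (e1.sub e2)).div (by fun_prop)
      fun x => toCplx_sub_ne_zero (Ne.symm x.2.2)
  have hGne : ∀ x, G x ≠ 0 := fun x => div_ne_zero
    (toCplx_sub_ne_zero fun h => x.2.2 (hinj _ x.1.2 h).symm) (toCplx_sub_ne_zero (Ne.symm x.2.2))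
  have hG0 : ∀ a, G (0, a) = Complex.exp ((0 : OffDiag → ℂ) a) := fun a => by
    simp only [G, Pi.zero_apply, Complex.exp_zero, Set.Icc.coe_zero, h0, id]
    exact div_self (toCplx_sub_ne_zero (Ne.symm a.2))
  obtain ⟨L, hL, hLe, hL0⟩ := exists_log_homotopy G hGc hGne 0 continuous_zero hG0
  have hsym : ∀ p q (h : p ≠ q), L (1, ⟨(p, q), h⟩) = L (1, ⟨(q, p), h.symm⟩) := fun p q h => by
    have := log_sub_const (s := (univ : Set unitInterval)) isPreconnected_univ
      (L₁ := fun t => L (t, ⟨(p, q), h⟩)) (L₂ := fun t => L (t, ⟨(q, p), h.symm⟩))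
      (by fun_prop) (by fun_prop) (fun t _ => by
        rw [hLe, hLe]
        simp only [G]
        rw [toCplx_sub_comm (H t q), toCplx_sub_comm q, neg_div_neg_eq]) (x := 1) (y := 0)
        trivial trivial
    simpa [hL0, sub_eq_zero] using this
  obtain ⟨θ, hθ, hθe⟩ := exists_log_of_convex (V := ℝ × ℝ) convex_univ
    (g := fun z => toCplx (f z - z)) (by fun_prop) (fun z _ => toCplx_sub_ne_zero (hfix z))
  rw [continuousOn_univ] at hθ
  have hd : ∀ z, z ≠ f z := fun z => (hfix z).symm
  let V : ℝ × ℝ → ℂ := fun z => L (1, ⟨(z, f z), hd z⟩)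
  have hVc : Continuous V := hL.comp (by fun_prop)
  have hfc : ∀ z w, θ (f z) - (θ z + V z) = θ (f w) - (θ w + V w) := fun z w =>
    log_sub_const (s := (univ : Set (ℝ × ℝ))) isPreconnected_univ (L₁ := fun z => θ (f z))
      (L₂ := fun z => θ z + V z)
      (by fun_prop) (by fun_prop) (fun z _ => by
        simp only [Complex.exp_add, V]
        rw [hθe _ trivial, hθe _ trivial, hLe]
        simp only [G, Set.Icc.coe_one, h1]
        rw [mul_div_cancel₀ _ (toCplx_sub_ne_zero (hfix z))]) trivial trivial
  have hexpc : Complex.exp (θ (f 0) - (θ 0 + V 0)) = 1 := by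
    rw [Complex.exp_sub, Complex.exp_add]
    simp only [V]
    rw [hθe _ trivial, hθe _ trivial, hLe]
    simp only [G, Set.Icc.coe_one, h1]
    rw [mul_div_cancel₀ _ (toCplx_sub_ne_zero (hfix _)),
      div_self (toCplx_sub_ne_zero (hfix _))]
  refine ⟨θ, fun p => if h : p.1 ≠ p.2 then L (1, ⟨p, h⟩) + (θ (f 0) - (θ 0 + V 0)) else 0, hθ,
    ?_, fun z => hθe z trivial, fun p q h => ?_, fun p q => ?_, fun z => ?_⟩
  · rw [continuousOn_iff_continuous_domRestrict]
    have : ({p | p.1 ≠ p.2} : Set ((ℝ × ℝ) × (ℝ × ℝ))).domRestrict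
        (fun p => if h : p.1 ≠ p.2 then L (1, ⟨p, h⟩) + (θ (f 0) - (θ 0 + V 0)) else 0) =
        fun p => L (1, ⟨p.1, p.2⟩) + (θ (f 0) - (θ 0 + V 0)) := by
      ext ⟨p, hp⟩
      have hp' : p.1 ≠ p.2 := hp
      simp [Set.domRestrict, hp']
    rw [this]; fun_prop
  · simp only [ne_eq, h, not_false_eq_true, dif_pos, Complex.exp_add, hexpc, mul_one, hLe]
    simp [G, h1]
  · by_cases h : p = q
    · simp [h]
    · simp only [ne_eq, h, not_false_eq_true, dif_pos, Ne.symm h, hsym p q h]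
  · simp only [ne_eq, hd z, not_false_eq_true, dif_pos]
    have := hfc z 0
    simp only [V] at this ⊢
    linear_combination this

lemma HasAngleLifts.symm {f : (ℝ × ℝ) ≃ₜ (ℝ × ℝ)} (h : HasAngleLifts f) :
    HasAngleLifts f.symm := by
  obtain ⟨θ, W, hθ, hW, hθe, hWe, hs, hc⟩ := h
  refine ⟨fun z => θ (f.symm z) + Real.pi * Complex.I, fun p => -W (f.symm p.1, f.symm p.2),
    by fun_prop, ?_, fun z => ?_, fun p q hpq => ?_, fun p q => ?_, fun z => ?_⟩
  · refine (hW.comp (f := fun p : (ℝ × ℝ) × (ℝ × ℝ) => (f.symm p.1, f.symm p.2))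
      (by fun_prop) ?_).neg
    intro p hp
    simpa using hp
  · rw [Complex.exp_add, hθe, Complex.exp_pi_mul_I, toCplx_sub_comm]
    simp
  · have := hWe (f.symm p) (f.symm q) (by simpa using hpq)
    simp only [Homeomorph.apply_symm_apply] at this
    rw [Complex.exp_neg, this, inv_div]
  · simp only [hs (f.symm p)]
  · have := hc (f.symm (f.symm z))
    simp only [Homeomorph.apply_symm_apply] at this
    simp only
    rw [this, hs (f.symm z)]
    ring

lemma ne_zero_of_exp_eq_neg_one {c : ℂ} (h : Complex.exp c = -1) : c ≠ 0 := by
  rintro rfl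
  norm_num at h

/-- The cocycle `W` adds up correctly along the image of a logarithm. -/
lemma exp_add_cocycle {f : ℝ × ℝ → ℝ × ℝ} {W : (ℝ × ℝ) × (ℝ × ℝ) → ℂ}
    (hWe : ∀ p q, p ≠ q → Complex.exp (W (p, q)) = toCplx (f q - f p) / toCplx (q - p))
    {l : ℂ} {p q : ℝ × ℝ} (hpq : p ≠ q) (hl : Complex.exp l = toCplx (q - p)) :
    Complex.exp (l + W (p, q)) = toCplx (f q - f p) := by
  rw [Complex.exp_add, hl, hWe p q hpq, mul_div_cancel₀ _ (toCplx_sub_ne_zero hpq.symm)]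

lemma no_free_path_of_period_two {f : ℝ × ℝ → ℝ × ℝ} (hf : Continuous f)
    (hl : HasAngleLifts f) {γ : ℝ → ℝ × ℝ} {u v : ℝ} (huv : u ≤ v)
    (hγ : ContinuousOn γ (Icc u v))
    (hfree : ∀ s ∈ Icc u v, ∀ s' ∈ Icc u v, f (γ s') ≠ γ s) : f (f (γ u)) ≠ γ v := by
  intro hper
  obtain ⟨θ, W, hθ, hW, hθe, hWe, hs, hc⟩ := hl
  have zu : u ∈ Icc u v := by simp [huv]
  have zv : v ∈ Icc u v := by simp [huv]
  have hγ1 : ContinuousOn (fun p : ℝ × ℝ => γ p.1) (Icc u v ×ˢ Icc u v) :=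
    hγ.comp continuousOn_fst fun p hp => hp.1
  have hγ2 : ContinuousOn (fun p : ℝ × ℝ => γ p.2) (Icc u v ×ˢ Icc u v) :=
    hγ.comp continuousOn_snd fun p hp => hp.2
  have hg : ContinuousOn (fun p : ℝ × ℝ => toCplx (f (γ p.2) - γ p.1)) (Icc u v ×ˢ Icc u v) :=
    toCplx.continuous.comp_continuousOn ((hf.comp_continuousOn hγ2).sub hγ1)
  obtain ⟨L, hL, hLe⟩ := exists_log_of_convex ((convex_Icc u v).prod (convex_Icc u v)) hg
    (fun p hp => toCplx_sub_ne_zero (hfree _ hp.1 _ hp.2))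
  have hdiag : ∀ s ∈ Icc u v, L (s, s) - θ (γ s) = L (u, u) - θ (γ u) := fun s hs' =>
    log_sub_const (s := Icc u v) isPreconnected_Icc (L₁ := fun s => L (s, s))
      (L₂ := fun s => θ (γ s)) (hL.comp (by fun_prop) fun s hs => ⟨hs, hs⟩)
      (hθ.comp_continuousOn hγ) (fun s hs => by rw [hLe _ ⟨hs, hs⟩, hθe]) hs' zu
  have hside : ∀ s ∈ Icc u v, (L (s, u) + W (γ s, f (γ u))) - L (v, s) =
      (L (v, u) + W (γ v, f (γ u))) - L (v, v) := fun s hs' => by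
    have hlift : ∀ s ∈ Icc u v, Complex.exp (L (s, u) + W (γ s, f (γ u))) =
        toCplx (γ v - f (γ s)) := fun s hs => by
      rw [exp_add_cocycle hWe (hfree s hs u zu).symm (hLe _ ⟨hs, zu⟩), hper]
    have := log_sub_const (s := Icc u v) isPreconnected_Icc
      (L₁ := fun s => L (s, u) + W (γ s, f (γ u)))
      (L₂ := fun s => L (v, s) + Real.pi * Complex.I)
      ((hL.comp (by fun_prop) fun s hs => ⟨hs, zu⟩).add
        (hW.comp (hγ.prodMk continuousOn_const) fun s hs => (hfree s hs u zu).symm))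
      ((hL.comp (by fun_prop) fun s hs => ⟨zv, hs⟩).add continuousOn_const)
      (fun s hs => by
        rw [hlift s hs, Complex.exp_add, hLe _ ⟨zv, hs⟩, Complex.exp_pi_mul_I, toCplx_sub_comm]
        simp) hs' zv
    linear_combination this
  have hcexp : Complex.exp ((L (v, u) + W (γ v, f (γ u))) - L (v, v)) = -1 := by
    rw [Complex.exp_sub, exp_add_cocycle hWe (hfree v zv u zu).symm (hLe _ ⟨zv, zu⟩),
      hLe _ ⟨zv, zv⟩, hper, toCplx_sub_comm, neg_div,
      div_self (toCplx_sub_ne_zero (hfree v zv v zv))]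
  refine ne_zero_of_exp_eq_neg_one hcexp ?_
  have h1 := hside u zu
  have h2 := hdiag v zv
  have h3 := hc (γ u)
  have h4 := hc (f (γ u))
  rw [hper] at h4
  have h5 := hs (γ v) (f (γ u))
  linear_combination (1 / 2 : ℂ) * (-h1 - h2 - h3 - h4 + h5)

lemma no_gap_coincidence {f : ℝ × ℝ → ℝ × ℝ} (hl : HasAngleLifts f) {Γ : ℝ → ℝ × ℝ} {u T : ℝ}
    (hT : u + 2 ≤ T) (hΓ : ContinuousOn Γ (Icc u T))
    (hΓf : ∀ s ∈ Icc u T, Γ (s + 1) = f (Γ s))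
    (hne : ∀ s s', u ≤ s → s + 1 ≤ s' → s' ≤ T → s' - s < T - u → Γ s ≠ Γ s') : Γ u ≠ Γ T := by
  intro hTu
  obtain ⟨θ, W, hθ, hW, hθe, hWe, hs, hc⟩ := hl
  let Δ : Set (ℝ × ℝ) := {p | u ≤ p.1 ∧ p.1 + 1 ≤ p.2 ∧ p.2 ≤ T ∧ p.2 - p.1 < T - u}
  have hΔ : Convex ℝ Δ := by
    rintro ⟨a, a'⟩ ⟨h1, h2, h3, h4⟩ ⟨b, b'⟩ ⟨k1, k2, k3, k4⟩ x y hx hy hxy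
    simp only [Δ, mem_ofPred_eq, Prod.smul_mk, Prod.mk_add_mk, smul_eq_mul] at *
    obtain rfl : y = 1 - x := by linarith
    refine ⟨by nlinarith, by nlinarith, by nlinarith, ?_⟩
    rcases hx.eq_or_lt with rfl | hx
    · nlinarith
    · nlinarith [mul_lt_mul_of_pos_left h4 hx, mul_le_mul_of_nonneg_left k4.le hy]
  have hΓ1 : ContinuousOn (fun p : ℝ × ℝ => Γ p.1) Δ :=
    hΓ.comp continuousOn_fst fun p hp => ⟨hp.1, by linarith [hp.2.1, hp.2.2.1]⟩
  have hΓ2 : ContinuousOn (fun p : ℝ × ℝ => Γ p.2) Δ :=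
    hΓ.comp continuousOn_snd fun p hp => ⟨by linarith [hp.2.1, hp.1], hp.2.2.1⟩
  have hneΔ : ∀ p ∈ Δ, Γ p.1 ≠ Γ p.2 := fun p hp => hne _ _ hp.1 hp.2.1 hp.2.2.1 hp.2.2.2
  obtain ⟨L₀, hL₀, hL₀e⟩ := exists_log_of_convex hΔ
    (toCplx.continuous.comp_continuousOn (hΓ2.sub hΓ1))
    (fun p hp => toCplx_sub_ne_zero (hneΔ p hp).symm)
  have hd : ∀ s ∈ Icc u (T - 1), (s, s + 1) ∈ Δ := fun s hs =>
    ⟨hs.1, le_rfl, by simp only; linarith [hs.2], by simp only; linarith⟩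
  have iu : u ∈ Icc u (T - 1) := ⟨le_rfl, by linarith⟩
  obtain ⟨L, hL, hLe, hLd⟩ : ∃ L : ℝ × ℝ → ℂ, ContinuousOn L Δ ∧
      (∀ p ∈ Δ, Complex.exp (L p) = toCplx (Γ p.2 - Γ p.1)) ∧
      ∀ s ∈ Icc u (T - 1), L (s, s + 1) = θ (Γ s) := by
    have hee : ∀ s ∈ Icc u (T - 1), Complex.exp (L₀ (s, s + 1)) = Complex.exp (θ (Γ s)) :=
      fun s hs' => by
        rw [hL₀e _ (hd s hs'), hθe]
        change toCplx (Γ (s + 1) - Γ s) = _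
        rw [hΓf s ⟨hs'.1, by linarith [hs'.2]⟩]
    have hdiag : ∀ s ∈ Icc u (T - 1), L₀ (s, s + 1) - θ (Γ s) = L₀ (u, u + 1) - θ (Γ u) :=
      fun s hs' =>
      log_sub_const (s := Icc u (T - 1)) isPreconnected_Icc (L₁ := fun s => L₀ (s, s + 1))
        (L₂ := fun s => θ (Γ s)) (hL₀.comp (by fun_prop) hd)
        (hθ.comp_continuousOn (hΓ.mono (Icc_subset_Icc_right (by linarith)))) hee hs' iu
    have h1 : Complex.exp (L₀ (u, u + 1) - θ (Γ u)) = 1 := by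
      rw [Complex.exp_sub, hee u iu, div_self (Complex.exp_ne_zero _)]
    refine ⟨fun p => L₀ p - (L₀ (u, u + 1) - θ (Γ u)), hL₀.sub continuousOn_const,
      fun p hp => ?_, fun s hs' => ?_⟩
    · rw [Complex.exp_sub, h1, div_one, hL₀e p hp]
      rfl
    · simp only
      rw [← hdiag s hs']
      ring
  have hshift : ∀ s s', u ≤ s → s + 1 ≤ s' → s' ≤ T - 1 →
      L (s + 1, s' + 1) = L (s, s') + W (Γ s, Γ s') := by
    intro s s' h1 h2 h3
    let K : Set (ℝ × ℝ) := {p | u ≤ p.1 ∧ p.1 + 1 ≤ p.2 ∧ p.2 ≤ T - 1}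
    have hK : Convex ℝ K := by
      rintro ⟨a, a'⟩ ⟨h1, h2, h3⟩ ⟨b, b'⟩ ⟨k1, k2, k3⟩ x y hx hy hxy
      simp only [K, mem_ofPred_eq, Prod.smul_mk, Prod.mk_add_mk, smul_eq_mul] at *
      obtain rfl : y = 1 - x := by linarith
      refine ⟨by nlinarith, by nlinarith, by nlinarith⟩
    have hKΔ : K ⊆ Δ := fun p hp =>
      ⟨hp.1, hp.2.1, by linarith [hp.2.2], by linarith [hp.2.2, hp.1]⟩
    have hKΔ' : ∀ p ∈ K, (p.1 + 1, p.2 + 1) ∈ Δ := fun p hp =>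
      ⟨by simp only; linarith [hp.1], by simp only; linarith [hp.2.1],
        by simp only; linarith [hp.2.2], by simp only; linarith [hp.2.2, hp.1]⟩
    have := log_sub_const (s := K) hK.isPreconnected
      (L₁ := fun p => L (p.1 + 1, p.2 + 1)) (L₂ := fun p => L p + W (Γ p.1, Γ p.2))
      (hL.comp (by fun_prop) hKΔ')
      ((hL.mono hKΔ).add (hW.comp ((hΓ1.prodMk hΓ2).mono hKΔ) fun p hp => hneΔ p (hKΔ hp)))
      (fun p hp => by
        rw [hLe _ (hKΔ' p hp), exp_add_cocycle hWe (hneΔ p (hKΔ hp)) (hLe p (hKΔ hp)), ← hΓf,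
          ← hΓf]
        · exact ⟨hp.1, by linarith [hp.2.1, hp.2.2]⟩
        · exact ⟨by linarith [hp.2.1, hp.1], by linarith [hp.2.2]⟩)
      (x := (s, s')) (y := (u, u + 1)) ⟨h1, h2, h3⟩ ⟨le_rfl, le_rfl, by simp only; linarith⟩
    simp only at this
    rw [hLd u iu, hLd (u + 1) ⟨by linarith, by linarith⟩, hΓf u ⟨le_rfl, by linarith⟩, hc] at this
    linear_combination this
  have m1 : ∀ s ∈ Icc (u + 1) (T - 1), (s, T) ∈ Δ := fun s hs' =>
    ⟨by simp only; linarith [hs'.1], by simp only; linarith [hs'.2], le_rfl,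
      by simp only; linarith [hs'.1]⟩
  have m2 : ∀ s ∈ Icc (u + 1) (T - 1), (u, s) ∈ Δ := fun s hs' =>
    ⟨le_rfl, hs'.1, by simp only; linarith [hs'.2], by simp only; linarith [hs'.2]⟩
  have i1 : u + 1 ∈ Icc (u + 1) (T - 1) := ⟨le_rfl, by linarith⟩
  have i2 : T - 1 ∈ Icc (u + 1) (T - 1) := ⟨by linarith, le_rfl⟩
  have hside : ∀ s ∈ Icc (u + 1) (T - 1),
      L (s, T) - L (u, s) = L (u + 1, T) - L (u, u + 1) := fun s hs' => by
    have := log_sub_const (s := Icc (u + 1) (T - 1)) isPreconnected_Icc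
      (L₁ := fun s => L (s, T)) (L₂ := fun s => L (u, s) + Real.pi * Complex.I)
      (hL.comp (by fun_prop) m1) ((hL.comp (by fun_prop) m2).add continuousOn_const)
      (fun s hs => by
        rw [hLe _ (m1 s hs), Complex.exp_add, hLe _ (m2 s hs), Complex.exp_pi_mul_I, hTu,
          toCplx_sub_comm]
        simp) hs' i1
    linear_combination this
  have hcexp : Complex.exp (L (u + 1, T) - L (u, u + 1)) = -1 := by
    have h2 := hLe _ (m2 _ i1)
    rw [Complex.exp_sub, h2, hLe _ (m1 _ i1)]
    simp only
    rw [← hTu, toCplx_sub_comm, neg_div, div_self (toCplx_sub_ne_zero (hneΔ _ (m2 _ i1)).symm)]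
  refine ne_zero_of_exp_eq_neg_one hcexp ?_
  have h1 := hside (T - 1) i2
  have h2 := hshift u (T - 1) le_rfl (by linarith) le_rfl
  have h3 := hLd (T - 1) ⟨by linarith, le_rfl⟩
  have h4 := hc (Γ (T - 1))
  have h5 := hLd u iu
  have h6 := hs (Γ (T - 1)) (Γ T)
  have h7 := hΓf (T - 1) ⟨by linarith, by linarith⟩
  simp only [sub_add_cancel] at h2 h3 h7
  rw [← h7] at h4
  rw [hTu] at h2 h5
  rw [h6] at h4
  linear_combination (1 / 2 : ℂ) * (-h1 + h2 + h3 - h4 - h5)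

/-- Concatenation of the images of a path from a point to its image. -/
noncomputable def orbitPath (f : ℝ × ℝ → ℝ × ℝ) (α : ℝ → ℝ × ℝ) (x : ℝ) : ℝ × ℝ :=
  f^[⌊x⌋₊] (α (x - ⌊x⌋₊))

section orbitPath
variable {f : ℝ × ℝ → ℝ × ℝ} {α : ℝ → ℝ × ℝ}

lemma orbitPath_eq (h : f (α 0) = α 1) (n : ℕ) {x : ℝ} (hx : x ∈ Icc (n : ℝ) (n + 1)) :
    orbitPath f α x = f^[n] (α (x - n)) := by
  rcases hx.2.eq_or_lt with h1 | h1
  · subst h1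
    have : ⌊(n : ℝ) + 1⌋₊ = n + 1 := by
      rw [Nat.floor_add_one (by positivity), Nat.floor_natCast]
    simp [orbitPath, this, h]
  · have : ⌊x⌋₊ = n := (Nat.floor_eq_iff (le_trans (by positivity) hx.1)).2 ⟨hx.1, h1⟩
    simp [orbitPath, this]

lemma orbitPath_add_nat (n : ℕ) {x : ℝ} (hx : 0 ≤ x) :
    orbitPath f α (x + n) = f^[n] (orbitPath f α x) := by
  simp only [orbitPath, Nat.floor_add_natCast hx, ← Function.iterate_add_apply]
  rw [add_comm n]
  simp

lemma continuousOn_orbitPath (hf : Continuous f) (hα : ContinuousOn α (Icc 0 1))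
    (h : f (α 0) = α 1) : ContinuousOn (orbitPath f α) (Ici 0) := by
  have h1 : ∀ n : ℕ, ContinuousOn (orbitPath f α) (Icc (n : ℝ) (n + 1)) := fun n => by
    refine ContinuousOn.congr (f := fun x => f^[n] (α (x - n))) ?_ fun x hx => orbitPath_eq h n hx
    refine (hf.iterate n).comp_continuousOn (hα.comp (by fun_prop) fun x hx => ?_)
    exact ⟨by linarith [hx.1], by linarith [hx.2]⟩
  have h2 : ∀ n : ℕ, ContinuousOn (orbitPath f α) (Icc (0 : ℝ) n) := fun n => by
    induction n with
    | zero => simp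
    | succ n ih =>
      rw [← Icc_union_Icc_eq_Icc (b := (n : ℝ)) (by positivity) (by simp)]
      refine ih.union_of_isClosed ?_ isClosed_Icc isClosed_Icc
      simpa using h1 n
  intro x hx
  have hx' : x < (⌊x⌋₊ + 1 : ℕ) := by simpa using Nat.lt_floor_add_one x
  refine ((h2 (⌊x⌋₊ + 1)) x ⟨hx, hx'.le⟩).mono_of_mem_nhdsWithin ?_
  rw [← Ici_inter_Iic]
  exact inter_mem_nhdsWithin _ (Iic_mem_nhds hx')

end orbitPath

lemma iterate_ne_of_fundamental_path {f : ℝ × ℝ → ℝ × ℝ} (hf : Continuous f)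
    (hinj : Function.Injective f) (hl : HasAngleLifts f) {α : ℝ → ℝ × ℝ}
    (hα : ContinuousOn α (Icc 0 1)) (h : f (α 0) = α 1)
    (hfree : ∀ x ∈ Ico (0 : ℝ) 1, ∀ y ∈ Ico (0 : ℝ) 1, f (α x) ≠ α y) {n : ℕ} (hn : 1 ≤ n)
    {x y : ℝ} (hx : x ∈ Ico (0 : ℝ) 1) (hy : y ∈ Ico (0 : ℝ) 1) : f^[n] (α x) ≠ α y := by
  intro hxy
  set Γ := orbitPath f α with hΓdef
  have hΓc : ContinuousOn Γ (Ici 0) := continuousOn_orbitPath hf hα h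
  have hΓ0 : ∀ x ∈ Ico (0 : ℝ) 1, Γ x = α x := fun x hx => by
    simpa using orbitPath_eq h 0 (x := x) (by simpa using ⟨hx.1, hx.2.le⟩)
  have hn2 : (2 : ℝ) ≤ n := by
    rcases hn.eq_or_lt with rfl | hn
    · exact absurd hxy (hfree x hx y hy)
    · exact_mod_cast hn
  let C : Set (ℝ × ℝ) := {p | p ∈ Icc (0 : ℝ) 1 ×ˢ Icc (0 : ℝ) (n + 2) ∧
    (p.1 + 1 ≤ p.2 ∧ p.2 ≤ p.1 + n + 1) ∧ Γ p.1 = Γ p.2}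
  have hCc : IsCompact C := by
    have : IsClosed C := by
      have h1 : IsClosed {p : ℝ × ℝ | p.1 + 1 ≤ p.2 ∧ p.2 ≤ p.1 + n + 1} :=
        by
          rw [ofPred_and]
          exact (isClosed_le (by fun_prop) (by fun_prop)).inter
            (isClosed_le (by fun_prop) (by fun_prop))
      have h2 : ContinuousOn (fun p : ℝ × ℝ => (Γ p.1, Γ p.2))
          (Icc (0 : ℝ) 1 ×ˢ Icc (0 : ℝ) (n + 2)) :=
        (hΓc.comp continuousOn_fst fun p hp => hp.1.1).prodMk
          (hΓc.comp continuousOn_snd fun p hp => hp.2.1)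
      have h3 := h2.preimage_isClosed_of_isClosed (isClosed_Icc.prod isClosed_Icc)
        (isClosed_diagonal (X := ℝ × ℝ))
      convert h3.inter h1 using 1
      ext p
      simp only [C, mem_ofPred_eq, mem_inter_iff, mem_preimage, mem_diagonal_iff]
      tauto
    exact (isCompact_Icc.prod isCompact_Icc).of_isClosed_subset this fun p hp => hp.1
  have hCne : C.Nonempty := by
    refine ⟨(y, x + n), ⟨⟨hy.1, hy.2.le⟩, ?_, ?_⟩, ⟨?_, ?_⟩, ?_⟩ <;> simp only
    · linarith [hx.1]
    · linarith [hx.2]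
    · linarith [hx.1, hy.2]
    · linarith [hx.2, hy.1]
    · rw [hΓdef, orbitPath_add_nat n hx.1, ← hΓdef, hΓ0 x hx, hΓ0 y hy, hxy]
  obtain ⟨⟨u, T⟩, ⟨⟨hu, -⟩, ⟨hT1, hT2⟩, hTu⟩, hmin⟩ := hCc.exists_isMinOn hCne
    (f := fun p : ℝ × ℝ => p.2 - p.1) (by fun_prop)
  simp only at hu hT1 hT2 hTu
  have hshift : ∀ (k : ℕ) (s s' : ℝ), (k : ℝ) ≤ s → (k : ℝ) ≤ s' → Γ s = Γ s' →
      Γ (s - k) = Γ (s' - k) := fun k s s' h1 h2 h3 => by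
    have e1 := orbitPath_add_nat (f := f) (α := α) k (sub_nonneg.2 h1)
    have e2 := orbitPath_add_nat (f := f) (α := α) k (sub_nonneg.2 h2)
    rw [sub_add_cancel, ← hΓdef] at e1 e2
    exact hinj.iterate k (by rw [← e1, ← e2, h3])
  have hgap : ∀ s s', 0 ≤ s → s + 1 ≤ s' → s' - s < T - u → Γ s ≠ Γ s' := by
    intro s s' h0 h1 h2 h3
    have f1 := Nat.floor_le h0
    have f2 := Nat.lt_floor_add_one s
    have := hmin (show (s - ⌊s⌋₊, s' - ⌊s⌋₊) ∈ C from ⟨⟨⟨by simp only; linarith,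
      by simp only; linarith⟩, by simp only; linarith, by simp only; linarith [hu.2]⟩,
      ⟨by simp only; linarith, by simp only; linarith⟩,
      hshift _ _ _ f1 (by linarith) h3⟩)
    simp only [mem_ofPred_eq] at this
    linarith
  obtain ⟨u', T', hu', hT1', hTu', hgap'⟩ : ∃ u' T', u' ∈ Ico (0 : ℝ) 1 ∧ u' + 1 ≤ T' ∧
      Γ u' = Γ T' ∧ ∀ s s', 0 ≤ s → s + 1 ≤ s' → s' - s < T' - u' → Γ s ≠ Γ s' := by
    rcases hu.2.eq_or_lt with rfl | h1
    · refine ⟨0, T - 1, by simp, by linarith, ?_, fun s s' h1 h2 h3 =>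
        hgap s s' h1 h2 (by linarith)⟩
      simpa using hshift 1 1 T (by simp) (by simp; linarith) hTu
    · exact ⟨u, T, ⟨hu.1, h1⟩, hT1, hTu, hgap⟩
  rcases le_or_gt (u' + 2) T' with h2 | h2
  · refine no_gap_coincidence hl h2 (hΓc.mono fun s hs => hu'.1.trans hs.1) (fun s hs => ?_)
      (fun s s' h1 h2 h3 h4 => hgap' s s' (hu'.1.trans h1) h2 h4) hTu'
    simpa using orbitPath_add_nat (f := f) (α := α) 1 (hu'.1.trans hs.1)
  · rw [hΓ0 u' hu'] at hTu'
    rcases lt_or_ge T' 2 with h3 | h3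
    · have := orbitPath_eq h 1 (x := T') ⟨by push_cast; linarith [hu'.1], by push_cast; linarith⟩
      rw [← hΓdef, ← hTu'] at this
      exact hfree (T' - 1) ⟨by linarith [hu'.1], by linarith⟩ u' hu' (by simpa using this.symm)
    · have := orbitPath_eq h 2 (x := T') ⟨by push_cast; linarith [hu'.1],
        by push_cast; linarith [hu'.2]⟩
      rw [← hΓdef, ← hTu'] at this
      have hsub : Icc (T' - 2) u' ⊆ Ico 0 1 := fun z hz =>
        ⟨by linarith [hz.1], by linarith [hz.2, hu'.2]⟩
      exact no_free_path_of_period_two hf hl (u := T' - 2) (v := u') (by linarith)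
        (hα.mono (hsub.trans Ico_subset_Icc_self))
        (fun s hs s' hs' => hfree s' (hsub hs') s (hsub hs)) (by simpa using this.symm)

lemma iterate_ne_of_first_return {f : ℝ × ℝ → ℝ × ℝ} (hf : Continuous f)
    (hinj : Function.Injective f) (hl : HasAngleLifts f) {δ : ℝ → ℝ × ℝ} {m s : ℝ}
    (hδ : ContinuousOn δ (Icc 0 m)) (hs : 0 ≤ s) (hsm : s < m) (hret : f (δ s) = δ m)
    (hfree : ∀ x ∈ Ico (0 : ℝ) m, ∀ y ∈ Ico (0 : ℝ) m, f (δ x) ≠ δ y) {n : ℕ} (hn : 1 ≤ n)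
    {a b : ℝ} (ha : a ∈ Ico (0 : ℝ) m) (hb : b ∈ Ico (0 : ℝ) m) : f^[n] (δ a) ≠ δ b := by
  have hpos : 0 < s + m := by linarith
  have hρ : ∀ x ∈ Ico (0 : ℝ) 1, |s - (s + m) * x| ∈ Ico (0 : ℝ) m := fun x hx =>
    ⟨abs_nonneg _, abs_lt.2 ⟨by nlinarith [hx.2], by nlinarith [hx.1]⟩⟩
  have hρ' : ∀ x ∈ Icc (0 : ℝ) 1, |s - (s + m) * x| ∈ Icc (0 : ℝ) m := fun x hx =>
    ⟨abs_nonneg _, abs_le.2 ⟨by nlinarith [hx.2], by nlinarith [hx.1]⟩⟩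
  have hsurj : ∀ a ∈ Ico (0 : ℝ) m, ∃ x ∈ Ico (0 : ℝ) 1, |s - (s + m) * x| = a := fun a ha => by
    refine ⟨(s + a) / (s + m), ⟨div_nonneg (by linarith [ha.1]) hpos.le, ?_⟩, ?_⟩
    · rw [div_lt_one hpos]; linarith [ha.2]
    · rw [mul_div_cancel₀ _ hpos.ne', show s - (s + a) = -a by ring, abs_neg, abs_of_nonneg ha.1]
  obtain ⟨x, hx, hxa⟩ := hsurj a ha
  obtain ⟨y, hy, hyb⟩ := hsurj b hb
  have := iterate_ne_of_fundamental_path hf hinj hl (α := fun x => δ |s - (s + m) * x|)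
    (hδ.comp (by fun_prop) hρ') (by
      have : |s - (s + m) * 1| = m := by
        rw [show s - (s + m) * 1 = -m by ring, abs_neg, abs_of_nonneg (by linarith)]
      simp only [this, mul_zero, sub_zero, abs_of_nonneg hs, hret])
    (fun x hx y hy => hfree _ (hρ x hx) _ (hρ y hy)) hn hx hy
  simpa only [hxa, hyb] using this

lemma iterate_ne_of_free_path {f : (ℝ × ℝ) ≃ₜ (ℝ × ℝ)} (hfix : ∀ z, f z ≠ z)
    (hl : HasAngleLifts f) {γ : ℝ → ℝ × ℝ} (hγ : ContinuousOn γ (Icc 0 1))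
    (hfree : ∀ s ∈ Icc (0 : ℝ) 1, ∀ s' ∈ Icc (0 : ℝ) 1, f (γ s) ≠ γ s') {n : ℕ} (hn : 1 ≤ n)
    {a b : ℝ} (ha : a ∈ Icc (0 : ℝ) 1) (hb : b ∈ Icc (0 : ℝ) 1) : f^[n] (γ a) ≠ γ b := by
  classical
  let δ : ℝ → ℝ × ℝ := fun x => if x ≤ 1 then γ x else γ 1 + (x - 1) • (f (γ 1) - γ 1)
  have hδγ : ∀ x ∈ Icc (0 : ℝ) 1, δ x = γ x := fun x hx => by simp [δ, hx.2]
  have hδ2 : δ 2 = f (γ 1) := by norm_num [δ]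
  have hδc : ContinuousOn δ (Icc 0 2) := by
    rw [← Icc_union_Icc_eq_Icc (b := (1 : ℝ)) (by simp) (by simp)]
    refine (hγ.congr hδγ).union_of_isClosed ?_ isClosed_Icc isClosed_Icc
    refine ContinuousOn.congr (f := fun x => γ 1 + (x - 1) • (f (γ 1) - γ 1)) (by fun_prop) ?_
    intro x hx
    rcases hx.1.eq_or_lt with rfl | h1
    · simp [δ]
    · simp [δ, not_le.2 h1]
  let C : Set (ℝ × ℝ) := {p | p ∈ Icc (0 : ℝ) 2 ×ˢ Icc (0 : ℝ) 2 ∧ f (δ p.1) = δ p.2}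
  have hCc : IsCompact C := by
    have h2 : ContinuousOn (fun p : ℝ × ℝ => (f (δ p.1), δ p.2))
        (Icc (0 : ℝ) 2 ×ˢ Icc (0 : ℝ) 2) :=
      (f.continuous.comp_continuousOn (hδc.comp continuousOn_fst fun p hp => hp.1)).prodMk
        (hδc.comp continuousOn_snd fun p hp => hp.2)
    exact (isCompact_Icc.prod isCompact_Icc).of_isClosed_subset
      (h2.preimage_isClosed_of_isClosed (isClosed_Icc.prod isClosed_Icc)
        (isClosed_diagonal (X := ℝ × ℝ))) fun p hp => hp.1
  have hCne : C.Nonempty := ⟨(1, 2), ⟨by norm_num, by norm_num⟩, by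
    simp only
    rw [hδ2, hδγ 1 (by simp)]⟩
  obtain ⟨⟨s, t⟩, ⟨⟨hs, ht⟩, hst⟩, hmin⟩ := hCc.exists_isMinOn hCne
    (f := fun p : ℝ × ℝ => max p.1 p.2) (by fun_prop)
  simp only at hs ht hst
  set m := max s t with hm
  have hm2 : m ≤ 2 := max_le hs.2 ht.2
  have hfree' : ∀ x ∈ Ico (0 : ℝ) m, ∀ y ∈ Ico (0 : ℝ) m, f (δ x) ≠ δ y := by
    intro x hx y hy hxy
    have := hmin (show (x, y) ∈ C from ⟨⟨⟨hx.1, hx.2.le.trans hm2⟩, ⟨hy.1, hy.2.le.trans hm2⟩⟩, hxy⟩)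
    simp only [mem_ofPred_eq] at this
    exact absurd (max_lt hx.2 hy.2) (not_lt.2 this)
  have hm1 : 1 < m := by
    by_contra! h1
    have h2 := max_le_iff.1 (hm ▸ h1)
    rw [hδγ s ⟨hs.1, h2.1⟩, hδγ t ⟨ht.1, h2.2⟩] at hst
    exact hfree s ⟨hs.1, h2.1⟩ t ⟨ht.1, h2.2⟩ hst
  have hsub : Icc (0 : ℝ) 1 ⊆ Ico 0 m := fun z hz => ⟨hz.1, hz.2.trans_lt hm1⟩
  have hδm : ContinuousOn δ (Icc 0 m) := hδc.mono (Icc_subset_Icc_right hm2)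
  have hne : s ≠ t := by
    rintro rfl
    exact hfix _ hst
  rw [← hδγ a ha, ← hδγ b hb]
  rcases lt_or_gt_of_ne hne with h | h
  · have hmt : m = t := by rw [hm, max_eq_right h.le]
    exact iterate_ne_of_first_return f.continuous f.injective hl hδm hs.1 (hmt ▸ h)
      (by rw [hst, hmt]) hfree' hn (hsub ha) (hsub hb)
  · have hms : m = s := by rw [hm, max_eq_left h.le]
    have := iterate_ne_of_first_return f.symm.continuous f.symm.injective hl.symm hδm ht.1
      (hms ▸ h) (by rw [← hst, hms, f.symm_apply_apply])
      (fun x hx y hy h => hfree' y hy x hx (by rw [← h, f.apply_symm_apply])) hn (hsub hb) (hsub ha)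
    intro h
    refine this ?_
    rw [← h]
    exact (Function.LeftInverse.iterate f.symm_apply_apply n) _

/-- The self-map `φ` of the plane is the end of an isotopy starting at the identity. -/
def IsIsotopicToId (φ : ℝ × ℝ → ℝ × ℝ) : Prop :=
  ∃ H : ℝ → (ℝ × ℝ) → (ℝ × ℝ), Continuous (fun q : ℝ × (ℝ × ℝ) => H q.1 q.2) ∧
    (∀ t ∈ Icc (0 : ℝ) 1, ∃ g : (ℝ × ℝ) ≃ₜ (ℝ × ℝ), ⇑g = H t) ∧ H 0 = id ∧ H 1 = φ

lemma IsIsotopicToId.comp {φ ψ : ℝ × ℝ → ℝ × ℝ} (hφ : IsIsotopicToId φ) (hψ : IsIsotopicToId ψ) :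
    IsIsotopicToId (φ ∘ ψ) := by
  obtain ⟨H, hH, hHh, hH0, hH1⟩ := hφ
  obtain ⟨G, hG, hGh, hG0, hG1⟩ := hψ
  refine ⟨fun t z => H t (G t z), hH.comp (continuous_fst.prodMk hG), fun t ht => ?_, ?_, ?_⟩
  · obtain ⟨h, hh⟩ := hHh t ht
    obtain ⟨g, hg⟩ := hGh t ht
    exact ⟨g.trans h, by ext z : 1; simp [← hh, ← hg]⟩
  · ext z : 1; simp [hH0, hG0]
  · ext z : 1; simp [hH1, hG1]

/-- The map pushing `c` to `c + v` inside the ball of radius `r` about `c`. -/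
noncomputable def pushMap (c : ℝ × ℝ) (r : ℝ) (v x : ℝ × ℝ) : ℝ × ℝ :=
  x + max (1 - ‖x - c‖ / r) 0 • v

lemma exists_homeomorph_pushMap {c : ℝ × ℝ} {r : ℝ} (hr : 0 < r) {v : ℝ × ℝ} (hv : ‖v‖ < r) :
    ∃ g : (ℝ × ℝ) ≃ₜ (ℝ × ℝ), ⇑g = pushMap c r v := by
  have h : ApproximatesLinearOn (pushMap c r v)
      ((ContinuousLinearEquiv.refl ℝ (ℝ × ℝ) : (ℝ × ℝ) ≃L[ℝ] (ℝ × ℝ)) :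
        (ℝ × ℝ) →L[ℝ] (ℝ × ℝ)) univ (‖v‖₊ / r.toNNReal) := by
    intro x _ y _
    have e : pushMap c r v x - pushMap c r v y - (x - y) =
        (max (1 - ‖x - c‖ / r) 0 - max (1 - ‖y - c‖ / r) 0) • v := by
      simp only [pushMap, sub_smul]; abel
    change ‖pushMap c r v x - pushMap c r v y - (x - y)‖ ≤ _
    rw [e, norm_smul, Real.norm_eq_abs]
    have h1 : |max (1 - ‖x - c‖ / r) 0 - max (1 - ‖y - c‖ / r) 0| ≤ ‖x - y‖ / r := by
      refine (abs_max_sub_max_le_abs _ _ _).trans ?_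
      rw [show 1 - ‖x - c‖ / r - (1 - ‖y - c‖ / r) = (‖y - c‖ - ‖x - c‖) / r by ring, abs_div,
        abs_of_pos hr]
      gcongr
      rw [abs_sub_comm]
      simpa only [sub_sub_sub_cancel_right] using abs_norm_sub_norm_le (x - c) (y - c)
    calc _ ≤ ‖x - y‖ / r * ‖v‖ := by gcongr
      _ = _ := by push_cast; rw [Real.coe_toNNReal r hr.le]; ring
  refine ⟨h.toHomeomorph _ (Or.inr ?_), rfl⟩
  have : ‖((ContinuousLinearEquiv.refl ℝ (ℝ × ℝ)).symm : (ℝ × ℝ) →L[ℝ] (ℝ × ℝ))‖₊ = 1 :=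
    ContinuousLinearMap.nnnorm_id
  rw [this, inv_one, ← NNReal.coe_lt_coe]
  push_cast
  rw [Real.coe_toNNReal r hr.le, div_lt_one hr]
  exact hv

/-- Any two points of a connected open set are exchanged by an isotopy supported in the set. -/
lemma exists_isotopic_supported {U : Set (ℝ × ℝ)} (hU : IsOpen U) (hc : IsPreconnected U)
    {p q : ℝ × ℝ} (hp : p ∈ U) (hq : q ∈ U) : ∃ φ : (ℝ × ℝ) ≃ₜ (ℝ × ℝ), φ p = q ∧
      (∀ z ∉ U, φ z = z) ∧ IsIsotopicToId φ := by
  have step : ∀ p q r, 0 < r → ‖q - p‖ < r → Metric.ball p r ⊆ U →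
      ∃ φ : (ℝ × ℝ) ≃ₜ (ℝ × ℝ), φ p = q ∧ (∀ z ∉ U, φ z = z) ∧ IsIsotopicToId φ := by
    intro p q r hr hpq hsub
    obtain ⟨g, hg⟩ := exists_homeomorph_pushMap (c := p) hr hpq
    refine ⟨g, by simp [hg, pushMap], fun z hz => ?_, fun t => pushMap p r (t • (q - p)), ?_,
      fun t ht => exists_homeomorph_pushMap hr ?_, ?_, ?_⟩
    · have : r ≤ ‖z - p‖ := by
        by_contra! h
        exact hz (hsub (by simpa [dist_eq_norm] using h))
      rw [hg, pushMap, max_eq_right, zero_smul, add_zero]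
      rw [sub_nonpos, one_le_div hr]
      exact this
    · unfold pushMap; fun_prop
    · rw [norm_smul, Real.norm_of_nonneg ht.1]
      exact (mul_le_of_le_one_left (norm_nonneg _) ht.2).trans_lt hpq
    · ext z : 1; simp [pushMap]
    · simp [hg]
  refine hc.induction₂' (fun p q => ∃ φ : (ℝ × ℝ) ≃ₜ (ℝ × ℝ), φ p = q ∧
      (∀ z ∉ U, φ z = z) ∧ IsIsotopicToId φ) (fun x hx => ?_) ?_ hp hq
  · obtain ⟨r, hr, hsub⟩ := Metric.isOpen_iff.1 hU x hx
    refine mem_nhdsWithin_of_mem_nhds ?_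
    filter_upwards [Metric.ball_mem_nhds x (half_pos hr)] with y hy
    rw [Metric.mem_ball, dist_eq_norm] at hy
    refine ⟨step x y r hr (by linarith) hsub, step y x (r / 2) (half_pos hr)
      (by rwa [norm_sub_rev]) (subset_trans (fun z hz => ?_) hsub)⟩
    rw [Metric.mem_ball] at hz ⊢
    have := dist_triangle z y x
    rw [dist_eq_norm y x] at this
    linarith
  · rintro x y z - - - ⟨φ, h1, h2, h3⟩ ⟨ψ, k1, k2, k3⟩
    exact ⟨φ.trans ψ, by simp [h1, k1], fun w hw => by simp [h2 w hw, k2 w hw], k3.comp h3⟩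

section Brouwer
variable {f : (ℝ × ℝ) ≃ₜ (ℝ × ℝ)}

lemma IsBrouwer.hasAngleLifts (hf : IsBrouwer f) : HasAngleLifts f := by
  obtain ⟨hfix, H, hH, hHh, hH0, hH1⟩ := hf
  refine HasAngleLifts.of_isotopy hfix hH (fun t ht => ?_) hH0 hH1
  obtain ⟨g, hg⟩ := hHh t ht
  rw [← hg]
  exact g.injective

lemma IsBrouwer.iterate_ne (hf : IsBrouwer f) {n : ℕ} (hn : 1 ≤ n) (z : ℝ × ℝ) : f^[n] z ≠ z :=
  iterate_ne_of_free_path hf.1 hf.hasAngleLifts (γ := fun _ => z) continuousOn_const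
    (fun _ _ _ _ => hf.1 z) hn (a := 0) (b := 0) (by simp) (by simp)

lemma IsBrouwer.iterate_notMem (hf : IsBrouwer f) {U : Set (ℝ × ℝ)} (hU : IsPathConnected U)
    (hfree : ∀ x ∈ U, f x ∉ U) {n : ℕ} (hn : 1 ≤ n) {z : ℝ × ℝ} (hz : z ∈ U) : f^[n] z ∉ U := by
  intro hz'
  have hj := hU.joinedIn z hz _ hz'
  have hmem : ∀ s, hj.somePath.extend s ∈ U := fun s => by
    exact hj.somePath_mem (projIcc 0 1 zero_le_one s)
  refine iterate_ne_of_free_path hf.1 hf.hasAngleLifts (γ := hj.somePath.extend)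
    hj.somePath.continuous_extend.continuousOn
    (fun s hs s' hs' h => hfree _ (hmem s) (h ▸ hmem s')) hn (a := 0) (b := 1) (by simp) (by simp)
    (by simp)

lemma IsBrouwer.no_two_disc_chain (hf : IsBrouwer f) {U V : Set (ℝ × ℝ)} (hU : IsOpen U)
    (hUc : IsConnected U) (hV : IsOpen V) (hVc : IsConnected V) (hfU : ∀ x ∈ U, f x ∉ U)
    (hfV : ∀ x ∈ V, f x ∉ V) (hUV : Disjoint U V) {n m : ℕ} (hn : 1 ≤ n) (hm : 1 ≤ m)
    {a c : ℝ × ℝ} (ha : a ∈ U) (hb : f^[n] a ∈ V) (hc : c ∈ V) : f^[m] c ∉ U := by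
  intro hd
  have hUp := hU.isConnected_iff_isPathConnected.1 hUc
  have hVp := hV.isConnected_iff_isPathConnected.1 hVc
  have hUV' : ∀ z ∈ U, z ∉ V := fun z h1 h2 => Set.disjoint_left.1 hUV h1 h2
  obtain ⟨φU, u1, u2, u3⟩ := exists_isotopic_supported hU hUc.isPreconnected hd ha
  obtain ⟨φV, v1, v2, v3⟩ := exists_isotopic_supported hV hVc.isPreconnected hb hc
  have preserve : ∀ {W : Set (ℝ × ℝ)} {φ : (ℝ × ℝ) ≃ₜ (ℝ × ℝ)}, (∀ z ∉ W, φ z = z) →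
      ∀ z ∈ W, φ z ∈ W := fun {W φ} h z hz => by
    by_contra hcon
    have := φ.injective (h _ hcon)
    rw [this] at hcon
    exact hcon hz
  let g : (ℝ × ℝ) ≃ₜ (ℝ × ℝ) := (φU.trans φV).trans f
  have gU : ∀ z ∈ U, g z = f (φU z) := fun z hz => by
    simp [g, v2 _ (hUV' _ (preserve u2 z hz))]
  have gV : ∀ z ∈ V, g z = f (φV z) := fun z hz => by
    simp [g, u2 z (fun h => hUV' z h hz)]
  have gO : ∀ z ∉ U, z ∉ V → g z = f z := fun z h1 h2 => by
    simp [g, u2 z h1, v2 z h2]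
  have hg : IsBrouwer g := by
    refine ⟨fun z hz => ?_, ?_⟩
    · by_cases h1 : z ∈ U
      · rw [gU z h1] at hz
        exact hfU _ (preserve u2 z h1) (by rwa [hz])
      · by_cases h2 : z ∈ V
        · rw [gV z h2] at hz
          exact hfV _ (preserve v2 z h2) (by rwa [hz])
        · rw [gO z h1 h2] at hz
          exact hf.1 z hz
    · have := IsIsotopicToId.comp (φ := ⇑f) hf.2 (v3.comp u3)
      exact this
  have hit : ∀ {A B : Set (ℝ × ℝ)}, IsPathConnected A → IsPathConnected B →
      (∀ x ∈ A, f x ∉ A) → (∀ x ∈ B, f x ∉ B) → (∀ z ∉ A, z ∉ B → g z = f z) →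
      ∀ {k : ℕ}, 1 ≤ k → ∀ {x y}, y ∈ A → f^[k] y ∈ B → g x = f y → g^[k] x = f^[k] y := by
    intro A B hA hB hfA hfB hO k hk x y hy hky hxy
    have : ∀ j, 1 ≤ j → j ≤ k → g^[j] x = f^[j] y := by
      intro j hj
      induction j, hj using Nat.le_induction with
      | base => intro _; simpa using hxy
      | succ j hj ih =>
        intro hjk
        rw [Function.iterate_succ_apply', Function.iterate_succ_apply', ih (by omega)]
        refine hO _ (hf.iterate_notMem hA hfA hj hy) fun hcon => ?_
        have := hf.iterate_notMem hB hfB (n := k - j) (by omega) hcon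
        rw [← Function.iterate_add_apply, Nat.sub_add_cancel (by omega)] at this
        exact this hky
    exact this k hk le_rfl
  have e1 : g^[n] (f^[m] c) = f^[n] a :=
    hit hUp hVp hfU hfV gO hn ha hb (by rw [gU _ hd, u1])
  have e2 : g^[m] (f^[n] a) = f^[m] c :=
    hit hVp hUp hfV hfU (fun z h1 h2 => gO z h2 h1) hm hc hd (by rw [gV _ hb, v1])
  refine hg.iterate_ne (n := n + m) (by omega) (f^[n] a) ?_
  rw [Function.iterate_add_apply, e2, e1]

lemma IsBrouwer.exists_transit (hf : IsBrouwer f) {U V : Set (ℝ × ℝ)} (hU : IsOpen U)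
    (hUc : IsConnected U) (hV : IsOpen V) (hVc : IsConnected V) (hfU : ∀ x ∈ U, f x ∉ U)
    (hfV : ∀ x ∈ V, f x ∉ V) {i j k : ℕ} (hij : i < j) (hjk : j < k)
    {x y : ℝ × ℝ} (hx : x ∈ U) (hxV : f^[i] x ∈ V) (hy : y ∈ U) (hyV : f^[k] y ∈ V) :
    ∃ z ∈ U, f^[j] z ∈ V := by
  by_contra! hcon
  have hpow : ∀ n : ℕ, ⇑(f ^ n) = f^[n] := fun n => hom_coe_pow DFunLike.coe rfl (fun _ _ => rfl) f n
  have hcont : Continuous f^[j] := f.continuous.iterate j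
  have hV' : IsConnected (f^[j] ⁻¹' V) := by
    rw [← hpow]
    exact (Homeomorph.isConnected_preimage (f ^ j)).2 hVc
  have hx' : f^[i] x = f^[j] ((f ^ (j - i)).symm x) := by
    have : f^[j] ((f ^ (j - i)).symm x) = f^[i] (f^[j - i] ((f ^ (j - i)).symm x)) := by
      rw [← Function.iterate_add_apply, show i + (j - i) = j by omega]
    rw [this, ← hpow (j - i), Homeomorph.apply_symm_apply]
  refine hf.no_two_disc_chain (U := U) (V := f^[j] ⁻¹' V) (n := k - j) (m := j - i) hU hUc
    (hV.preimage hcont) hV' hfU (fun z hz hz' => hfV _ hz ?_) ?_ (by omega) (by omega) hy ?_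
    (c := (f ^ (j - i)).symm x) ?_ ?_
  · have : f^[j] (f z) ∈ V := hz'
    rwa [← Function.iterate_succ_apply, Function.iterate_succ_apply'] at this
  · exact Set.disjoint_left.2 fun z h1 h2 => hcon z h1 h2
  · rw [mem_preimage, ← Function.iterate_add_apply, show j + (k - j) = k by omega]
    exact hyV
  · rw [mem_preimage, ← hx']
    exact hxV
  · rw [← hpow, Homeomorph.apply_symm_apply]
    exact hx

end Brouwer

/-- Compact sets are eventually displaced by the iterates of `f`. -/
def IsEventuallyDisplacing (f : ℝ × ℝ → ℝ × ℝ) : Prop :=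
  ∀ K : Set (ℝ × ℝ), IsCompact K → ∃ N : ℕ, ∀ n ≥ N, ∀ z ∈ K, f^[n] z ∉ K

section Sphere

lemma sphere_dist_eq (a b : OnePoint (ℝ × ℝ)) : dist a b = dist (spherePoint a) (spherePoint b) :=
  rfl

lemma spherePoint_coe (w : ℝ × ℝ) :
    spherePoint (w : OnePoint (ℝ × ℝ)) = ((1 + ‖w‖ ^ 2)⁻¹ • w, (1 + ‖w‖ ^ 2)⁻¹) := rfl

lemma spherePoint_infty : spherePoint (OnePoint.infty : OnePoint (ℝ × ℝ)) = 0 := rfl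

lemma continuous_spherePoint_coe :
    Continuous fun w : ℝ × ℝ => spherePoint (w : OnePoint (ℝ × ℝ)) := by
  have h : Continuous fun w : ℝ × ℝ => (1 + ‖w‖ ^ 2)⁻¹ :=
    (by fun_prop : Continuous fun w : ℝ × ℝ => 1 + ‖w‖ ^ 2).inv₀ fun w => by positivity
  exact (h.smul continuous_id).prodMk h

lemma norm_spherePoint_coe_le (w : ℝ × ℝ) :
    ‖spherePoint (w : OnePoint (ℝ × ℝ))‖ ≤ (1 + ‖w‖) / (1 + ‖w‖ ^ 2) := by
  have hp : (0 : ℝ) < 1 + ‖w‖ ^ 2 := by positivity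
  rw [spherePoint_coe, Prod.norm_mk, norm_smul, Real.norm_of_nonneg (inv_nonneg.2 hp.le),
    div_eq_inv_mul]
  refine max_le ?_ ?_
  · gcongr; linarith [norm_nonneg w]
  · exact le_mul_of_one_le_right (inv_nonneg.2 hp.le) (by linarith [norm_nonneg w])

lemma norm_spherePoint_le (a : OnePoint (ℝ × ℝ)) : ‖spherePoint a‖ ≤ 2 := by
  induction a using OnePoint.rec with
  | infty => simp [spherePoint_infty]
  | coe w =>
    refine (norm_spherePoint_coe_le w).trans ?_
    rw [div_le_iff₀ (by positivity)]
    nlinarith [sq_nonneg (‖w‖ - 1), norm_nonneg w]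

lemma isCompact_norm_spherePoint_ge {ε : ℝ} (hε : 0 < ε) :
    IsCompact {w : ℝ × ℝ | ε ≤ ‖spherePoint (w : OnePoint (ℝ × ℝ))‖} := by
  refine Metric.isCompact_of_isClosed_isBounded
    (isClosed_le continuous_const continuous_spherePoint_coe.norm) ?_
  refine (Metric.isBounded_closedBall (x := (0 : ℝ × ℝ)) (r := 1 + 2 / ε)).subset fun w hw => ?_
  rw [mem_ofPred_eq] at hw
  rw [mem_closedBall_zero_iff]
  by_contra! h
  have h1 := hw.trans (norm_spherePoint_coe_le w)
  rw [le_div_iff₀ (by positivity)] at h1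
  have h2 : 0 < 2 / ε := by positivity
  have h3 : ε * (2 / ε) = 2 := by field_simp
  nlinarith [norm_nonneg w, mul_pos hε h2, mul_lt_mul_of_pos_left h hε]

lemma exists_sphere_dist_lt {K U : Set (ℝ × ℝ)} (hK : IsCompact K) (hU : IsOpen U) (hKU : K ⊆ U) :
    ∃ ε > 0, ∀ a ∈ K, ∀ b ∉ U, ε < dist (a : OnePoint (ℝ × ℝ)) (b : OnePoint (ℝ × ℝ)) := by
  have hρ : ContinuousOn (fun p : (ℝ × ℝ) × ℝ => p.2⁻¹ • p.1) {p | p.2 ≠ 0} :=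
    (continuousOn_snd.inv₀ fun p hp => hp).smul continuousOn_fst
  have hO : IsOpen {p : (ℝ × ℝ) × ℝ | p.2 ≠ 0} := isOpen_ne_fun continuous_snd continuous_const
  have hinv : ∀ w : ℝ × ℝ, (spherePoint (w : OnePoint (ℝ × ℝ))).2⁻¹ •
      (spherePoint (w : OnePoint (ℝ × ℝ))).1 = w := fun w => by
    have hp : (1 + ‖w‖ ^ 2 : ℝ) ≠ 0 := by positivity
    rw [spherePoint_coe, smul_smul, inv_inv, mul_inv_cancel₀ hp, one_smul]
  obtain ⟨δ, hδ, hsub⟩ := (hK.image continuous_spherePoint_coe).exists_thickening_subset_open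
    (hρ.isOpen_inter_preimage hO hU) (by
      rintro _ ⟨w, hw, rfl⟩
      refine ⟨?_, ?_⟩
      · simp only [mem_ofPred_eq, spherePoint_coe]; positivity
      · rw [mem_preimage, hinv]; exact hKU hw)
  refine ⟨δ / 2, half_pos hδ, fun a ha b hb => ?_⟩
  by_contra! hcon
  refine hb ?_
  have : spherePoint (b : OnePoint (ℝ × ℝ)) ∈ Metric.thickening δ
      ((fun w : ℝ × ℝ => spherePoint (w : OnePoint (ℝ × ℝ))) '' K) := by
    rw [Metric.mem_thickening_iff]
    refine ⟨_, mem_image_of_mem _ ha, ?_⟩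
    rw [dist_comm, ← sphere_dist_eq]
    linarith
  have h2 := (hsub this).2
  rwa [mem_preimage, hinv] at h2

lemma iterate_onePointExtend_coe (f : ℝ × ℝ → ℝ × ℝ) (k : ℕ) (w : ℝ × ℝ) :
    (onePointExtend f)^[k] (w : OnePoint (ℝ × ℝ)) = ((f^[k] w : ℝ × ℝ) : OnePoint (ℝ × ℝ)) := by
  induction k generalizing w with
  | zero => rfl
  | succ k ih => rw [Function.iterate_succ_apply, Function.iterate_succ_apply, ← ih]; rfl

lemma iterate_onePointExtend_infty (f : ℝ × ℝ → ℝ × ℝ) (k : ℕ) :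
    (onePointExtend f)^[k] (OnePoint.infty : OnePoint (ℝ × ℝ)) = OnePoint.infty :=
  Function.iterate_fixed rfl k

/-- Finitely many `ε`-cells for the first `n` positions of an orbit. -/
lemma exists_orbit_code (g : OnePoint (ℝ × ℝ) → OnePoint (ℝ × ℝ)) (n : ℕ) {ε : ℝ} (hε : 0 < ε) :
    ∃ (N : ℕ) (c : OnePoint (ℝ × ℝ) → Fin N), ∀ x y, c x = c y →
      ∀ k < n, dist (g^[k] x) (g^[k] y) < ε := by
  let Φ : OnePoint (ℝ × ℝ) → Fin n → (ℝ × ℝ) × ℝ := fun x k => spherePoint (g^[k] x)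
  have hb : Bornology.IsBounded (range Φ) := by
    refine (Metric.isBounded_closedBall (x := (0 : Fin n → (ℝ × ℝ) × ℝ)) (r := 2)).subset ?_
    rintro _ ⟨x, rfl⟩
    rw [mem_closedBall_zero_iff, pi_norm_le_iff_of_nonneg (by norm_num)]
    exact fun k => norm_spherePoint_le _
  have ht : TotallyBounded (range Φ) := hb.isCompact_closure.totallyBounded.subset subset_closure
  obtain ⟨t, htf, hcov⟩ := Metric.totallyBounded_iff.1 ht (ε / 2) (half_pos hε)
  have hch : ∀ x, ∃ y : t, Φ x ∈ Metric.ball (y : Fin n → (ℝ × ℝ) × ℝ) (ε / 2) := fun x => by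
    have := hcov (mem_range_self x)
    simp only [mem_iUnion] at this
    obtain ⟨y, hy, h⟩ := this
    exact ⟨⟨y, hy⟩, h⟩
  choose c hc using hch
  have := htf.fintype
  refine ⟨Fintype.card t, fun x => Fintype.equivFin t (c x), fun x y hxy k hk => ?_⟩
  have hxy' : c x = c y := (Fintype.equivFin t).injective hxy
  have h1 := hc x
  have h2 := hc y
  rw [hxy', Metric.mem_ball] at h1
  rw [Metric.mem_ball] at h2
  have h3 : dist (Φ x) (Φ y) < ε := by
    have := dist_triangle_right (Φ x) (Φ y) (c y)
    linarith
  exact (dist_le_pi_dist (Φ x) (Φ y) ⟨k, hk⟩).trans_lt h3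

lemma bddAbove_card_isDynSeparated (g : OnePoint (ℝ × ℝ) → OnePoint (ℝ × ℝ)) (n : ℕ) {ε : ℝ}
    (hε : 0 < ε) :
    BddAbove {m | ∃ E : Finset (OnePoint (ℝ × ℝ)), IsDynSeparated g n ε ↑E ∧ E.card = m} := by
  obtain ⟨N, c, hc⟩ := exists_orbit_code g n hε
  refine ⟨N, ?_⟩
  rintro _ ⟨E, hE, rfl⟩
  rw [← Fintype.card_fin N]
  refine Finset.card_le_card_of_injOn c (fun _ _ => Finset.mem_coe.2 (Finset.mem_univ _))
    fun x hx y hy hxy => ?_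
  by_contra hne
  obtain ⟨k, hk, hlt⟩ := hE x hx y hy hne
  exact lt_asymm hlt (hc x y hxy k hk)

lemma le_maxSep_of_injective {g : OnePoint (ℝ × ℝ) → OnePoint (ℝ × ℝ)} {n : ℕ} {ε : ℝ}
    (hε : 0 < ε) {ι : Type*} (s : Finset ι) (p : ι → OnePoint (ℝ × ℝ))
    (h : ∀ i ∈ s, ∀ j ∈ s, i ≠ j → ∃ k < n, ε < dist (g^[k] (p i)) (g^[k] (p j))) :
    s.card ≤ maxSep g n ε := by
  classical
  refine le_csSup (bddAbove_card_isDynSeparated g n hε) ⟨s.image p, ?_, ?_⟩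
  · intro x hx y hy hxy
    rw [Finset.coe_image] at hx hy
    obtain ⟨i, hi, rfl⟩ := hx
    obtain ⟨j, hj, rfl⟩ := hy
    exact h i hi j hj fun e => hxy (by rw [e])
  · refine Finset.card_image_of_injOn fun i hi j hj hij => ?_
    by_contra hne
    obtain ⟨k, -, hlt⟩ := h i hi j hj hne
    change p i = p j at hij
    rw [hij, dist_self] at hlt
    exact lt_asymm hε hlt

end Sphere

lemma maxSep_le_of_isEventuallyDisplacing {f : ℝ × ℝ → ℝ × ℝ} (hf : IsEventuallyDisplacing f)
    {ε : ℝ} (hε : 0 < ε) : ∃ N : ℕ, ∀ n, maxSep (onePointExtend f) n ε ≤ n * N + 1 := by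
  classical
  set g := onePointExtend f with hg
  let K := {w : ℝ × ℝ | ε / 2 ≤ ‖spherePoint (w : OnePoint (ℝ × ℝ))‖}
  obtain ⟨M, hM⟩ := hf K (isCompact_norm_spherePoint_ge (half_pos hε))
  obtain ⟨N, c, hc⟩ := exists_orbit_code g M hε
  refine ⟨N, fun n => csSup_le' ?_⟩
  rintro _ ⟨E, hE, rfl⟩
  let P : OnePoint (ℝ × ℝ) → ℕ → Prop := fun x k => ε / 2 ≤ ‖spherePoint (g^[k] x)‖
  have hP : ∀ x k l, P x k → k + M ≤ l → ¬ P x l := by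
    intro x k l hk hkl hl
    induction x using OnePoint.rec with
    | infty =>
      simp only [P, g, iterate_onePointExtend_infty, spherePoint_infty, norm_zero] at hk
      linarith
    | coe w =>
      simp only [P, g, iterate_onePointExtend_coe] at hk hl
      refine hM (l - k) (by omega) (f^[k] w) hk ?_
      rw [← Function.iterate_add_apply, Nat.sub_add_cancel (by omega)]
      exact hl
  let code : OnePoint (ℝ × ℝ) → Option (Fin n × Fin N) := fun x =>
    if h : ∃ k < n, P x k then some (⟨Nat.find h, (Nat.find_spec h).1⟩, c (g^[Nat.find h] x))
    else none
  have hcard : Fintype.card (Option (Fin n × Fin N)) = n * N + 1 := by simp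
  rw [← hcard]
  refine Finset.card_le_card_of_injOn code (fun _ _ => Finset.mem_coe.2 (Finset.mem_univ _))
    fun x hx y hy hxy => ?_
  by_contra hne
  obtain ⟨k, hk, hlt⟩ := hE x hx y hy hne
  have hfar : P x k ∨ P y k := by
    by_contra! hcon
    simp only [P, not_le] at hcon
    rw [sphere_dist_eq] at hlt
    have := dist_le_norm_add_norm (spherePoint (g^[k] x)) (spherePoint (g^[k] y))
    linarith [hcon.1, hcon.2]
  by_cases hX : ∃ k < n, P x k
  · by_cases hY : ∃ k < n, P y k
    · simp only [code, hX, hY, dif_pos, Option.some.injEq, Prod.mk.injEq, Fin.mk.injEq] at hxy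
      obtain ⟨e1, e2⟩ := hxy
      have hle : Nat.find hX ≤ k := by
        rcases hfar with h | h
        · exact Nat.find_min' hX ⟨hk, h⟩
        · rw [e1]; exact Nat.find_min' hY ⟨hk, h⟩
      have hlt' : k < Nat.find hX + M := by
        by_contra! hcon
        rcases hfar with h | h
        · exact hP x _ k (Nat.find_spec hX).2 hcon h
        · exact hP y _ k (Nat.find_spec hY).2 (e1 ▸ hcon) h
      rw [← e1] at e2
      have := hc _ _ e2 (k - Nat.find hX) (by omega)
      rw [← Function.iterate_add_apply, ← Function.iterate_add_apply,
        Nat.sub_add_cancel hle] at this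
      exact lt_asymm hlt this
    · simp [code, hX, hY] at hxy
  · by_cases hY : ∃ k < n, P y k
    · simp [code, hX, hY] at hxy
    · rcases hfar with h | h
      · exact hX ⟨k, hk, h⟩
      · exact hY ⟨k, hk, h⟩

lemma tendsto_log_mul_div_log {C : ℝ} (hC : 0 < C) (m : ℝ) :
    Tendsto (fun n : ℕ => m * Real.log (C * n) / Real.log n) atTop (𝓝 m) := by
  have h1 : Tendsto (fun n : ℕ => Real.log n) atTop atTop :=
    Real.tendsto_log_atTop.comp tendsto_natCast_atTop_atTop
  have h2 : Tendsto (fun n : ℕ => m * (Real.log C / Real.log n + 1)) atTop (𝓝 (m * (0 + 1))) :=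
    ((tendsto_const_nhds.div_atTop h1).add_const 1).const_mul m
  rw [zero_add, mul_one] at h2
  refine h2.congr' ?_
  filter_upwards [eventually_gt_atTop 1] with n hn
  have h3 : (0 : ℝ) < Real.log n := Real.log_pos (by exact_mod_cast hn)
  have h4 : (n : ℝ) ≠ 0 := by positivity
  rw [Real.log_mul hC.ne' h4]
  field_simp

lemma IsEventuallyDisplacing.polEntropy_eq_one {f : (ℝ × ℝ) ≃ₜ (ℝ × ℝ)}
    (hf : IsEventuallyDisplacing f) : polEntropy (onePointExtend f) = 1 := by
  refine le_antisymm (iSup₂_le fun ε hε => ?_) ?_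
  · obtain ⟨N, hN⟩ := maxSep_le_of_isEventuallyDisplacing hf hε
    have ht : Tendsto (fun n : ℕ => ENNReal.ofReal (1 * Real.log ((N + 1 : ℝ) * n) / Real.log n))
        atTop (𝓝 (ENNReal.ofReal 1)) :=
      ENNReal.tendsto_ofReal (tendsto_log_mul_div_log (by positivity) 1)
    rw [ENNReal.ofReal_one] at ht
    rw [← ht.limsup_eq]
    refine limsup_le_limsup ?_
    filter_upwards [eventually_gt_atTop 1] with n hn
    refine ENNReal.ofReal_le_ofReal ?_
    have h3 : (0 : ℝ) < Real.log n := Real.log_pos (by exact_mod_cast hn)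
    rw [one_mul]
    refine div_le_div_of_nonneg_right ?_ h3.le
    rcases Nat.eq_zero_or_pos (maxSep (onePointExtend f) n ε) with h0 | h0
    · rw [h0, Nat.cast_zero, Real.log_zero]
      refine Real.log_nonneg ?_
      have : (1 : ℝ) < n := by exact_mod_cast hn
      nlinarith [(N.cast_nonneg : (0 : ℝ) ≤ N)]
    · refine Real.log_le_log (by exact_mod_cast h0) ?_
      have h1 : (maxSep (onePointExtend f) n ε : ℝ) ≤ n * N + 1 := by exact_mod_cast hN n
      have : (1 : ℝ) < n := by exact_mod_cast hn
      linarith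
  · obtain ⟨M, hM⟩ := hf (Metric.closedBall 0 1) (isCompact_closedBall _ _)
    have hx : ∀ m ≥ 1, f^[m] (0 : ℝ × ℝ) ≠ 0 := by
      intro m hm h
      refine hM (m * M) (by nlinarith) 0 (by simp) ?_
      rw [Function.iterate_mul, Function.iterate_fixed h]
      simp
    let U : Set (ℝ × ℝ) := Metric.ball 0 1 ∩ ⋂ m ∈ Finset.Icc 1 M, {f^[m] (0 : ℝ × ℝ)}ᶜ
    have hU : IsOpen U := Metric.isOpen_ball.inter
      (isOpen_biInter_finset fun m _ => isOpen_compl_singleton)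
    have h0U : (0 : ℝ × ℝ) ∈ U := by
      refine ⟨by simp, mem_iInter₂.2 fun m hm => ?_⟩
      exact (hx m (Finset.mem_Icc.1 hm).1).symm
    obtain ⟨ε, hε, hsep⟩ := exists_sphere_dist_lt isCompact_singleton hU
      (singleton_subset_iff.2 h0U)
    have hout : ∀ m ≥ 1, f^[m] (0 : ℝ × ℝ) ∉ U := by
      intro m hm hmU
      by_cases hmM : m ≤ M
      · exact mem_iInter₂.1 hmU.2 m (Finset.mem_Icc.2 ⟨hm, hmM⟩) rfl
      · exact hM m (by omega) 0 (by simp) (Metric.ball_subset_closedBall hmU.1)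
    have hinv : ∀ k, f^[k] (f.symm^[k] (0 : ℝ × ℝ)) = 0 := fun k =>
      (Function.LeftInverse.iterate (g := f) (f := f.symm) (fun z => by simp) k) 0
    have hinv' : ∀ k l, l < k → f^[k] (f.symm^[l] (0 : ℝ × ℝ)) = f^[k - l] 0 := fun k l hlk => by
      rw [show k = (k - l) + l by omega, Function.iterate_add_apply, hinv, Nat.add_sub_cancel]
    have hlow : ∀ n, n ≤ maxSep (onePointExtend f) n ε := by
      intro n
      conv_lhs => rw [← Finset.card_range n]
      have key : ∀ i l, l < i → ε < dist
          ((onePointExtend f)^[i] ((f.symm^[i] 0 : ℝ × ℝ) : OnePoint (ℝ × ℝ)))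
          ((onePointExtend f)^[i] ((f.symm^[l] 0 : ℝ × ℝ) : OnePoint (ℝ × ℝ))) := by
        intro i l hli
        rw [iterate_onePointExtend_coe, iterate_onePointExtend_coe, hinv, hinv' _ _ hli]
        exact hsep 0 rfl _ (hout _ (by omega))
      refine le_maxSep_of_injective hε (Finset.range n)
        (fun k => ((f.symm^[k] 0 : ℝ × ℝ) : OnePoint (ℝ × ℝ))) fun i hi j hj hij => ?_
      rw [Finset.mem_range] at hi hj
      rcases lt_or_gt_of_ne hij with h | h
      · exact ⟨j, hj, by rw [dist_comm]; exact key j i h⟩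
      · exact ⟨i, hi, key i j h⟩
    refine le_iSup₂_of_le ε hε ?_
    have ht : Tendsto (fun n : ℕ => ENNReal.ofReal (1 * Real.log ((1 : ℝ) * n) / Real.log n))
        atTop (𝓝 (ENNReal.ofReal 1)) :=
      ENNReal.tendsto_ofReal (tendsto_log_mul_div_log one_pos 1)
    rw [ENNReal.ofReal_one] at ht
    rw [← ht.limsup_eq]
    refine limsup_le_limsup ?_
    filter_upwards [eventually_gt_atTop 1] with n hn
    refine ENNReal.ofReal_le_ofReal ?_
    have h3 : (0 : ℝ) < Real.log n := Real.log_pos (by exact_mod_cast hn)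
    rw [one_mul, one_mul]
    refine div_le_div_of_nonneg_right (Real.log_le_log (by positivity) ?_) h3.le
    exact_mod_cast hlow n

lemma isEventuallyDisplacing_of_conj {f h : (ℝ × ℝ) ≃ₜ (ℝ × ℝ)}
    (hh : ∀ z, h (f (h.symm z)) = planeTranslation z) : IsEventuallyDisplacing f := by
  intro K hK
  have hit : ∀ n z, h (f^[n] z) = ((h z).1 + n, (h z).2) := by
    intro n
    induction n with
    | zero => simp
    | succ n ih =>
      intro z
      have := hh (h (f^[n] z))
      rw [Homeomorph.symm_apply_apply, ih] at this
      rw [Function.iterate_succ_apply', this]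
      simp [planeTranslation, add_assoc]
  obtain ⟨R, hR⟩ := (hK.image h.continuous).isBounded.exists_norm_le
  obtain ⟨N, hN⟩ := exists_nat_gt (2 * R)
  refine ⟨N, fun n hn z hz hz' => ?_⟩
  have h1 := (norm_fst_le _).trans (hR _ (mem_image_of_mem h hz))
  have h2 := (norm_fst_le _).trans (hR _ (mem_image_of_mem h hz'))
  rw [hit, Real.norm_eq_abs, abs_le] at h2
  rw [Real.norm_eq_abs, abs_le] at h1
  have : (N : ℝ) ≤ n := by exact_mod_cast hn
  simp only at h2
  linarith [h1.1, h2.2]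

lemma IsBrouwer.isEventuallyDisplacing {f : (ℝ × ℝ) ≃ₜ (ℝ × ℝ)} (hf : IsBrouwer f)
    (h1 : polEntropy (onePointExtend f) ≤ 1) : IsEventuallyDisplacing f := by
  by_contra hpd
  unfold IsEventuallyDisplacing at hpd
  push Not at hpd
  obtain ⟨K, hK, hpd⟩ := hpd
  choose n hn z hz hz' using hpd
  obtain ⟨⟨x, y⟩, -, φ, hφ, hlim⟩ := (hK.prod hK).tendsto_subseq
    (x := fun N => (z N, f^[n N] (z N))) fun N => ⟨hz N, hz' N⟩
  have hfree : ∀ x : ℝ × ℝ, ∃ r > 0, ∀ z ∈ Metric.ball x r, f z ∉ Metric.ball x r := by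
    intro x
    obtain ⟨A, B, hA, hB, hxA, hxB, hAB⟩ := t2_separation (hf.1 x)
    have : B ∩ f ⁻¹' A ∈ 𝓝 x :=
      inter_mem (hB.mem_nhds hxB) (f.continuous.continuousAt.preimage_mem_nhds (hA.mem_nhds hxA))
    obtain ⟨r, hr, hsub⟩ := Metric.mem_nhds_iff.1 this
    exact ⟨r, hr, fun z hz hfz => Set.disjoint_left.1 hAB (hsub hz).2 (hsub hfz).1⟩
  obtain ⟨r, hr, hrx⟩ := hfree x
  obtain ⟨s, hs, hsy⟩ := hfree y
  have hconn : ∀ (c : ℝ × ℝ) {r : ℝ}, 0 < r → IsConnected (Metric.ball c r) := fun c r hr =>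
    ⟨⟨c, Metric.mem_ball_self hr⟩, (convex_ball c r).isPreconnected⟩
  have hev : ∀ N : ℕ, ∃ k ≥ N, ∃ w ∈ Metric.ball x (r / 2), f^[k] w ∈ Metric.ball y (s / 2) := by
    intro N
    have h1 : ∀ᶠ j in atTop, z (φ j) ∈ Metric.ball x (r / 2) :=
      ((continuous_fst.tendsto _).comp hlim).eventually
        (Metric.ball_mem_nhds x (half_pos hr))
    have h2 : ∀ᶠ j in atTop, f^[n (φ j)] (z (φ j)) ∈ Metric.ball y (s / 2) :=
      ((continuous_snd.tendsto _).comp hlim).eventually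
        (Metric.ball_mem_nhds y (half_pos hs))
    obtain ⟨j, ⟨hj1, hj2⟩, hj3⟩ := ((h1.and h2).and (eventually_ge_atTop N)).exists
    exact ⟨n (φ j), (hj3.trans (hφ.id_le j)).trans (hn _), _, hj1, hj2⟩
  obtain ⟨i0, -, w0, hw0, hw0'⟩ := hev 0
  have hsubx : Metric.ball x (r / 2) ⊆ Metric.ball x r := Metric.ball_subset_ball (by linarith)
  have hsuby : Metric.ball y (s / 2) ⊆ Metric.ball y s := Metric.ball_subset_ball (by linarith)
  have htrans : ∀ l, i0 < l → ∃ w ∈ Metric.ball x (r / 2), f^[l] w ∈ Metric.ball y (s / 2) := by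
    intro l hl
    obtain ⟨k, hk, w, hw, hw'⟩ := hev (l + 1)
    exact hf.exists_transit Metric.isOpen_ball (hconn x (half_pos hr)) Metric.isOpen_ball
      (hconn y (half_pos hs)) (fun a ha h => hrx a (hsubx ha) (hsubx h))
      (fun a ha h => hsy a (hsuby ha) (hsuby h)) hl (by omega : l < k) hw0 hw0' hw hw'
  choose! w hw hw' using htrans
  have hvisit : ∀ {c : ℝ × ℝ} {t : ℝ}, 0 < t → (∀ z ∈ Metric.ball c t, f z ∉ Metric.ball c t) →
      ∀ {p : ℝ × ℝ} {i j : ℕ}, f^[i] p ∈ Metric.ball c t → f^[j] p ∈ Metric.ball c t → i = j := by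
    intro c t ht hfr p i j hi hj
    have hpc := Metric.isOpen_ball.isConnected_iff_isPathConnected.1 (hconn c ht)
    rcases lt_trichotomy i j with h | h | h
    · have := hf.iterate_notMem hpc hfr (n := j - i) (by omega) hi
      rw [← Function.iterate_add_apply, Nat.sub_add_cancel h.le] at this
      exact absurd hj this
    · exact h
    · have := hf.iterate_notMem hpc hfr (n := i - j) (by omega) hj
      rw [← Function.iterate_add_apply, Nat.sub_add_cancel h.le] at this
      exact absurd hi this
  have hcl : ∀ (c : ℝ × ℝ) {t : ℝ}, 0 < t → Metric.closedBall c (t / 2) ⊆ Metric.ball c t :=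
    fun c t ht => Metric.closedBall_subset_ball (by linarith)
  obtain ⟨ε₁, hε₁, hsep₁⟩ := exists_sphere_dist_lt (isCompact_closedBall x (r / 2))
    Metric.isOpen_ball (hcl x hr)
  obtain ⟨ε₂, hε₂, hsep₂⟩ := exists_sphere_dist_lt (isCompact_closedBall y (s / 2))
    Metric.isOpen_ball (hcl y hs)
  have hε : 0 < min ε₁ ε₂ := lt_min hε₁ hε₂
  have hinv : ∀ a z, f^[a] (f.symm^[a] z) = z := fun a =>
    Function.LeftInverse.iterate (g := f) (f := f.symm) (fun z => by simp) a
  let p : ℕ × ℕ → ℝ × ℝ := fun q => f.symm^[q.1] (w (i0 + 1 + q.2))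
  have hpx : ∀ q, f^[q.1] (p q) ∈ Metric.ball x (r / 2) := fun q => by
    simp only [p, hinv]; exact hw _ (by omega)
  have hpy : ∀ q, f^[q.1 + (i0 + 1 + q.2)] (p q) ∈ Metric.ball y (s / 2) := fun q => by
    rw [add_comm, Function.iterate_add_apply]
    simp only [p, hinv]; exact hw' _ (by omega)
  have hlow : ∀ n, 2 * (i0 + 1) ≤ n →
      (n / 4) * (n / 4) ≤ maxSep (onePointExtend f) n (min ε₁ ε₂) := by
    intro n hn
    have := le_maxSep_of_injective (g := onePointExtend f) (n := n) hε
      (Finset.range (n / 4) ×ˢ Finset.range (n / 4))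
      (fun q => ((p q : ℝ × ℝ) : OnePoint (ℝ × ℝ))) fun q hq q' hq' hne => ?_
    · simpa using this
    · rw [Finset.mem_product, Finset.mem_range, Finset.mem_range] at hq hq'
      simp only [iterate_onePointExtend_coe]
      by_cases h : q.1 = q'.1
      · refine ⟨q.1 + (i0 + 1 + q.2), by omega, (min_le_right _ _).trans_lt ?_⟩
        refine hsep₂ _ (Metric.ball_subset_closedBall (hpy q)) _ fun hcon => ?_
        have := hvisit hs hsy hcon (hsuby (hpy q'))
        exact hne (Prod.ext h (by omega))
      · refine ⟨q.1, by omega, (min_le_left _ _).trans_lt ?_⟩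
        refine hsep₁ _ (Metric.ball_subset_closedBall (hpx q)) _ fun hcon => ?_
        exact h (hvisit hr hrx hcon (hsubx (hpx q')))
  have h2 : (2 : ℝ≥0∞) ≤ polEntropy (onePointExtend f) := by
    refine le_iSup₂_of_le (min ε₁ ε₂) hε ?_
    have ht : Tendsto (fun n : ℕ => ENNReal.ofReal (2 * Real.log ((1 / 8 : ℝ) * n) / Real.log n))
        atTop (𝓝 (ENNReal.ofReal 2)) :=
      ENNReal.tendsto_ofReal (tendsto_log_mul_div_log (by norm_num) 2)
    rw [ENNReal.ofReal_ofNat] at ht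
    rw [← ht.limsup_eq]
    refine limsup_le_limsup ?_
    filter_upwards [eventually_ge_atTop (2 * (i0 + 1) + 8)] with n hn
    refine ENNReal.ofReal_le_ofReal ?_
    have h3 : (0 : ℝ) < Real.log n := Real.log_pos (by exact_mod_cast (by omega : 1 < n))
    refine div_le_div_of_nonneg_right ?_ h3.le
    have hn8 : (8 : ℝ) ≤ n := by exact_mod_cast (by omega : 8 ≤ n)
    have hq : (1 / 8 : ℝ) * n ≤ (n / 4 : ℕ) := by
      have : n ≤ 8 * (n / 4) := by omega
      have : (n : ℝ) ≤ 8 * (n / 4 : ℕ) := by exact_mod_cast this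
      linarith
    have : (2 : ℝ) * Real.log (1 / 8 * n) = Real.log ((1 / 8 * n) ^ 2) := by
      rw [Real.log_pow]; norm_num
    rw [this]
    refine Real.log_le_log (by positivity) ?_
    calc ((1 / 8 : ℝ) * n) ^ 2 ≤ ((n / 4 : ℕ) : ℝ) ^ 2 := by gcongr
      _ ≤ _ := by rw [sq]; exact_mod_cast hlow n (by omega)
  exact absurd (h2.trans h1) (by norm_num)

/-- No nonempty compact set can be added to `U` to give an open set: the complement of `U` has no
compact relatively open part. -/
def HoleFree (U : Set ℂ) : Prop :=
  ∀ X : Set ℂ, IsCompact X → Disjoint X U → IsOpen (U ∪ X) → X = ∅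

lemma eq_empty_of_isCompact_isOpen {X : Set ℂ} (hX : IsCompact X) (hO : IsOpen X) : X = ∅ := by
  rcases isClopen_iff.1 ⟨hX.isClosed, hO⟩ with h | h
  · exact h
  · exact absurd (h ▸ hX : IsCompact (univ : Set ℂ)) (NoncompactSpace.noncompact_univ)

lemma HoleFree.subset_ball {U X : Set ℂ} {R : ℝ} (hU : U ⊆ Metric.ball 0 R) (hX : IsCompact X)
    (hO : IsOpen (U ∪ X)) : X ⊆ Metric.ball 0 R := by
  intro x hx
  by_contra hcon
  obtain ⟨m, hm, hmax⟩ := hX.exists_isMaxOn ⟨x, hx⟩ continuous_norm.continuousOn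
  have hmR : R ≤ ‖m‖ := by
    rw [mem_ball_zero_iff, not_lt] at hcon
    exact hcon.trans (hmax hx)
  obtain ⟨ε, hε, hsub⟩ := Metric.isOpen_iff.1 hO m (Or.inr hm)
  obtain ⟨y, hy, hlt⟩ : ∃ y ∈ Metric.ball m ε, ‖m‖ < ‖y‖ := by
    rcases eq_or_ne m 0 with rfl | h0
    · refine ⟨(ε / 2 : ℝ), ?_, ?_⟩
      · rw [mem_ball_zero_iff, Complex.norm_real, Real.norm_of_nonneg (by positivity)]
        linarith
      · rw [norm_zero, Complex.norm_real, Real.norm_of_nonneg (by positivity)]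
        linarith
    · have hmp : 0 < ‖m‖ := norm_pos_iff.2 h0
      have hn : ‖((ε / (2 * ‖m‖) : ℝ) : ℂ) * m‖ = ε / 2 := by
        rw [norm_mul, Complex.norm_real, Real.norm_of_nonneg (by positivity)]
        field_simp
      refine ⟨m + ((ε / (2 * ‖m‖) : ℝ) : ℂ) * m, ?_, ?_⟩
      · rw [mem_ball_iff_norm, add_sub_cancel_left, hn]
        linarith
      · have : m + ((ε / (2 * ‖m‖) : ℝ) : ℂ) * m = ((1 + ε / (2 * ‖m‖) : ℝ) : ℂ) * m := by
          push_cast; ring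
        rw [this, norm_mul, Complex.norm_real, Real.norm_of_nonneg (by positivity)]
        exact lt_mul_of_one_lt_left hmp (by linarith [show 0 < ε / (2 * ‖m‖) by positivity])
  rcases hsub hy with h | h
  · have := mem_ball_zero_iff.1 (hU h)
    linarith
  · exact absurd (hmax h) (not_le.2 hlt)

lemma HoleFree.image {V : Set ℂ} (hV : HoleFree V) (hVo : V ⊆ Metric.ball 0 1) {g gi : ℂ → ℂ}
    (hg : ContinuousOn g (Metric.ball 0 1)) (hgi : ContinuousOn gi (Metric.ball 0 1))
    (hm : MapsTo g (Metric.ball 0 1) (Metric.ball 0 1))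
    (hmi : MapsTo gi (Metric.ball 0 1) (Metric.ball 0 1))
    (h1 : LeftInvOn gi g (Metric.ball 0 1)) (h2 : LeftInvOn g gi (Metric.ball 0 1)) :
    HoleFree (g '' V) := by
  intro X hX hd hO
  have hXb : X ⊆ Metric.ball 0 1 := HoleFree.subset_ball ((image_mono hVo).trans hm.image_subset) hX hO
  have hXi := hV (gi '' X) (hX.image_of_continuousOn (hgi.mono hXb)) ?_ ?_
  · exact image_eq_empty.1 hXi
  · refine Set.disjoint_left.2 ?_
    rintro _ ⟨x, hx, rfl⟩ hv
    exact Set.disjoint_left.1 hd hx ⟨_, hv, h2 (hXb hx)⟩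
  · have : V ∪ gi '' X = Metric.ball 0 1 ∩ g ⁻¹' (g '' V ∪ X) := by
      ext z
      constructor
      · rintro (h | ⟨x, hx, rfl⟩)
        · exact ⟨hVo h, Or.inl ⟨z, h, rfl⟩⟩
        · exact ⟨hmi (hXb hx), Or.inr (by rw [h2 (hXb hx)]; exact hx)⟩
      · rintro ⟨hz, ⟨v, hv, hvz⟩ | hx⟩
        · exact Or.inl (h1.injOn (hVo hv) hz hvz ▸ hv)
        · exact Or.inr ⟨_, hx, h1 hz⟩
    rw [this]
    exact hg.isOpen_inter_preimage Metric.isOpen_ball hO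

lemma HoleFree.image_sqrt {U : Set ℂ} (hU : HoleFree U) {s : ℂ → ℂ} (hs : ∀ z ∈ U, s z ^ 2 = z)
    (h0 : (0 : ℂ) ∉ U) (hO2 : IsOpen (s '' U)) : HoleFree (s '' U) := by
  intro X hX hd hO
  have hsq : IsOpenMap fun z : ℂ => z ^ 2 := (Complex.isOpenQuotientMap_pow 2).isOpenMap
  have hneg : IsOpen (Neg.neg ⁻¹' (s '' U)) := hO2.preimage continuous_neg
  have hdis : ∀ z ∈ s '' U, -z ∉ s '' U := by
    rintro _ ⟨u, hu, rfl⟩ ⟨v, hv, hvu⟩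
    have e : u = v := by rw [← hs u hu, ← hs v hv, hvu]; ring
    subst e
    have : s u = 0 := by linear_combination (1 / 2 : ℂ) * hvu
    apply h0
    rw [← hs u hu, this] at hu
    simpa using hu
  have hpre : ∀ z, z ^ 2 ∈ U → z ∈ s '' U ∨ -z ∈ s '' U := by
    intro z hz
    have := hs _ hz
    rcases sq_eq_sq_iff_eq_or_eq_neg.1 this with h | h
    · exact Or.inl ⟨_, hz, h⟩
    · exact Or.inr ⟨_, hz, h⟩
  have hX1 : X \ (Neg.neg ⁻¹' (s '' U)) = ∅ := by
    have := hU ((fun z : ℂ => z ^ 2) '' (X \ (Neg.neg ⁻¹' (s '' U))))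
      ((hX.diff hneg).image (continuous_pow 2)) ?_ ?_
    · exact image_eq_empty.1 this
    · refine Set.disjoint_left.2 ?_
      rintro _ ⟨x, ⟨hx, hxn⟩, rfl⟩ hxU
      rcases hpre x hxU with h | h
      · exact Set.disjoint_left.1 hd hx h
      · exact hxn h
    · have e : U ∪ (fun z : ℂ => z ^ 2) '' (X \ (Neg.neg ⁻¹' (s '' U))) =
          (fun z : ℂ => z ^ 2) '' (s '' U ∪ X) := by
        ext z
        constructor
        · rintro (h | ⟨x, hx, rfl⟩)
          · exact ⟨s z, Or.inl ⟨z, h, rfl⟩, hs z h⟩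
          · exact ⟨x, Or.inr hx.1, rfl⟩
        · rintro ⟨x, ⟨u, hu, rfl⟩ | hx, rfl⟩
          · exact Or.inl (by simp only [hs u hu]; exact hu)
          · by_cases hn : -x ∈ s '' U
            · obtain ⟨u, hu, hux⟩ := hn
              refine Or.inl ?_
              have : x ^ 2 = u := by rw [← hs u hu, hux]; ring
              simp only [this]; exact hu
            · exact Or.inr ⟨x, ⟨hx, hn⟩, rfl⟩
      rw [e]
      exact hsq _ hO
  have hXsub : X ⊆ Neg.neg ⁻¹' (s '' U) := sdiff_eq_empty.1 hX1
  refine eq_empty_of_isCompact_isOpen hX ?_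
  have : X = (s '' U ∪ X) ∩ Neg.neg ⁻¹' (s '' U) := by
    ext z
    constructor
    · exact fun h => ⟨Or.inr h, hXsub h⟩
    · rintro ⟨h | h, hn⟩
      · exact absurd hn (hdis z h)
      · exact h
  rw [this]
  exact hO.inter hneg

/-- On compact subsets of a bounded hole-free set, `z - b` has a logarithm for every `b` outside. -/
lemma HoleFree.exists_log_compact {U : Set ℂ} (hU : HoleFree U) (hUo : IsOpen U) {K : Set ℂ}
    (hK : IsCompact K) (hKU : K ⊆ U) {b : ℂ} (hb : b ∉ U) :
    ∃ L : ℂ → ℂ, ContinuousOn L K ∧ ∀ z ∈ K, Complex.exp (L z) = z - b := by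
  let G : Set ℂ := {b | ∃ L : ℂ → ℂ, ContinuousOn L K ∧ ∀ z ∈ K, Complex.exp (L z) = z - b}
  have key : ∀ b ∉ K, ∃ ε > 0, ∀ b₁ ∈ Metric.ball b ε, ∀ b₂ ∈ Metric.ball b ε, b₁ ∈ G → b₂ ∈ G := by
    intro b hbK
    obtain ⟨δ, hδ, hball⟩ := Metric.isOpen_iff.1 hK.isClosed.isOpen_compl b hbK
    have hfar : ∀ z ∈ K, δ ≤ ‖z - b‖ := fun z hz => by
      by_contra! h
      exact hball (mem_ball_iff_norm.2 h) hz
    refine ⟨δ / 4, by positivity, fun b₁ hb₁ b₂ hb₂ ⟨L, hL, hexp⟩ => ?_⟩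
    rw [mem_ball_iff_norm] at hb₁ hb₂
    have hne : ∀ z ∈ K, z - b₁ ≠ 0 := fun z hz => by rw [← hexp z hz]; exact Complex.exp_ne_zero _
    have hslit : ∀ z ∈ K, 1 + (b₁ - b₂) / (z - b₁) ∈ Complex.slitPlane := by
      intro z hz
      refine Complex.mem_slitPlane_of_norm_lt_one ?_
      rw [norm_div, div_lt_one (norm_pos_iff.2 (hne z hz))]
      have h1 := hfar z hz
      have h2 : ‖z - b‖ ≤ ‖z - b₁‖ + ‖b₁ - b‖ := by
        simpa using norm_add_le (z - b₁) (b₁ - b)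
      have h3 : ‖b₁ - b₂‖ ≤ ‖b₁ - b‖ + ‖b₂ - b‖ := by
        simpa using norm_sub_le (b₁ - b) (b₂ - b)
      linarith
    refine ⟨fun z => L z + Complex.log (1 + (b₁ - b₂) / (z - b₁)), hL.add ?_, fun z hz => ?_⟩
    · refine ContinuousOn.clog ?_ hslit
      exact continuousOn_const.add (continuousOn_const.div (by fun_prop) hne)
    · rw [Complex.exp_add, hexp z hz, Complex.exp_log (Complex.slitPlane_ne_zero (hslit z hz))]
      field_simp [hne z hz]
      ring
  by_contra hcon
  have hX := hU {b | b ∉ U ∧ b ∉ G} ?_ ?_ ?_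
  · have : b ∈ {b | b ∉ U ∧ b ∉ G} := ⟨hb, hcon⟩
    rw [hX] at this
    exact this
  · refine Metric.isCompact_of_isClosed_isBounded ?_ ?_
    · rw [← isOpen_compl_iff, isOpen_iff_mem_nhds]
      intro c hc
      by_cases hcU : c ∈ U
      · filter_upwards [hUo.mem_nhds hcU] with c' hc' h
        exact h.1 hc'
      · have hcG : c ∈ G := by
          by_contra h
          exact hc ⟨hcU, h⟩
        obtain ⟨ε, hε, h⟩ := key c fun h => hcU (hKU h)
        filter_upwards [Metric.ball_mem_nhds c hε] with c' hc' h'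
        exact h'.2 (h c (Metric.mem_ball_self hε) c' hc' hcG)
    · obtain ⟨R, hR⟩ := hK.isBounded.exists_norm_le
      refine (Metric.isBounded_closedBall (x := (0 : ℂ)) (r := R)).subset fun c hc => ?_
      by_contra hcR
      rw [mem_closedBall_zero_iff, not_le] at hcR
      refine hc.2 ?_
      have hc0 : c ≠ 0 ∨ K = ∅ := by
        rcases K.eq_empty_or_nonempty with h | ⟨z, hz⟩
        · exact Or.inr h
        · left
          have := (norm_nonneg z).trans (hR z hz)
          exact norm_pos_iff.1 (by linarith)
      rcases hc0 with hc0 | h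
      · have hslit : ∀ z ∈ K, 1 + (-z / c) ∈ Complex.slitPlane := fun z hz => by
          refine Complex.mem_slitPlane_of_norm_lt_one ?_
          rw [norm_div, norm_neg, div_lt_one (norm_pos_iff.2 hc0)]
          linarith [hR z hz]
        refine ⟨fun z => Complex.log (1 + (-z / c)) + Complex.log (-c), ?_, fun z hz => ?_⟩
        · exact (ContinuousOn.clog (by fun_prop) hslit).add continuousOn_const
        · rw [Complex.exp_add, Complex.exp_log (Complex.slitPlane_ne_zero (hslit z hz)),
            Complex.exp_log (neg_ne_zero.2 hc0)]
          field_simp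
          ring
      · exact ⟨0, by simp [h], by simp [h]⟩
  · exact Set.disjoint_left.2 fun c hc h => hc.1 h
  · rw [isOpen_iff_mem_nhds]
    rintro c hc
    by_cases hcU : c ∈ U
    · filter_upwards [hUo.mem_nhds hcU] with c' hc'
      exact Or.inl hc'
    · have hcG : c ∉ G := by
        rcases hc with h | h
        · exact absurd h hcU
        · exact h.2
      obtain ⟨ε, hε, h⟩ := key c fun h => hcU (hKU h)
      filter_upwards [Metric.ball_mem_nhds c hε] with c' hc'
      by_cases hc'U : c' ∈ U
      · exact Or.inl hc'U
      · exact Or.inr ⟨hc'U, fun h' => hcG (h c' hc' c (Metric.mem_ball_self hε) h')⟩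

lemma HoleFree.exists_log {U : Set ℂ} (hU : HoleFree U) (hUo : IsOpen U) (hUc : IsConnected U)
    (h0 : (0 : ℂ) ∉ U) :
    ∃ L : ℂ → ℂ, ∀ z ∈ U, Complex.exp (L z) = z ∧ HasDerivAt L z⁻¹ z := by
  obtain ⟨p, hp⟩ := hUc.nonempty
  have hpath := (hUo.isConnected_iff_isPathConnected.1 hUc).joinedIn
  have hpn : p ≠ 0 := fun h => h0 (h ▸ hp)
  have hlog : ∀ K : Set ℂ, IsCompact K → K ⊆ U → p ∈ K → ∃ L : ℂ → ℂ, ContinuousOn L K ∧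
      (∀ z ∈ K, Complex.exp (L z) = z) ∧ L p = Complex.log p := by
    intro K hK hKU hpK
    obtain ⟨L, hL, hexp⟩ := hU.exists_log_compact hUo hK hKU h0
    refine ⟨fun z => L z + (Complex.log p - L p), hL.add continuousOn_const, fun z hz => ?_,
      by ring⟩
    rw [Complex.exp_add, hexp z hz, Complex.exp_sub, Complex.exp_log hpn, hexp p hpK, sub_zero,
      sub_zero, div_self hpn, mul_one]
  have hK : ∀ z : ℂ, ∃ K : Set ℂ, z ∈ U → IsCompact K ∧ IsPreconnected K ∧ K ⊆ U ∧ p ∈ K ∧ z ∈ K := by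
    intro z
    by_cases hz : z ∈ U
    · have hj := hpath p hp z hz
      refine ⟨range hj.somePath, fun _ => ⟨isCompact_range hj.somePath.continuous,
        isPreconnected_range hj.somePath.continuous, ?_, ⟨0, by simp⟩, ⟨1, by simp⟩⟩⟩
      rintro _ ⟨t, rfl⟩
      exact hj.somePath_mem t
    · exact ⟨∅, fun h => absurd h hz⟩
  choose K hK using hK
  have hL : ∀ z : ℂ, ∃ L : ℂ → ℂ, z ∈ U → ContinuousOn L (K z) ∧
      (∀ w ∈ K z, Complex.exp (L w) = w) ∧ L p = Complex.log p := by
    intro z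
    by_cases hz : z ∈ U
    · obtain ⟨h1, h2, h3, h4, h5⟩ := hK z hz
      obtain ⟨L, h⟩ := hlog (K z) h1 h3 h4
      exact ⟨L, fun _ => h⟩
    · exact ⟨0, fun h => absurd h hz⟩
  choose L hL using hL
  have huniq : ∀ z ∈ U, ∀ (C : Set ℂ) (l : ℂ → ℂ), K z ⊆ C → ContinuousOn l C →
      (∀ w ∈ C, Complex.exp (l w) = w) → l p = Complex.log p → l z = L z z := by
    intro z hz C l hC hl hexp hlp
    obtain ⟨h1, h2, h3, h4, h5⟩ := hK z hz
    obtain ⟨g1, g2, g3⟩ := hL z hz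
    have := log_sub_const h2 (hl.mono hC) g1 (fun w hw => by rw [hexp w (hC hw), g2 w hw]) h5 h4
    rw [hlp, g3, sub_self] at this
    exact sub_eq_zero.1 this
  have hexp : ∀ z ∈ U, Complex.exp (L z z) = z := fun z hz => (hL z hz).2.1 z (hK z hz).2.2.2.2
  have hcont : ∀ z ∈ U, ContinuousAt (fun z => L z z) z := by
    intro z hz
    obtain ⟨ε, hε, hball⟩ := Metric.nhds_basis_closedBall.mem_iff.1 (hUo.mem_nhds hz)
    obtain ⟨h1, h2, h3, h4, h5⟩ := hK z hz
    obtain ⟨l, l1, l2, l3⟩ := hlog (K z ∪ Metric.closedBall z ε)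
      (h1.union (isCompact_closedBall z ε)) (union_subset h3 hball) (Or.inl h4)
    have hcl : ContinuousAt l z :=
      (l1.mono subset_union_right).continuousAt (Metric.closedBall_mem_nhds z hε)
    refine hcl.congr ?_
    filter_upwards [Metric.closedBall_mem_nhds z hε] with w hw
    have hw' : w ∈ U := hball hw
    obtain ⟨k1, k2, k3, k4, k5⟩ := hK w hw'
    have hcon : IsPreconnected (K z ∪ Metric.closedBall z ε) :=
      h2.union z h5 (Metric.mem_closedBall_self hε.le) (convex_closedBall z ε).isPreconnected
    obtain ⟨m, m1, m2, m3⟩ := hlog (K w ∪ (K z ∪ Metric.closedBall z ε))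
      (k1.union (h1.union (isCompact_closedBall z ε))) (union_subset k3 (union_subset h3 hball))
      (Or.inl k4)
    have e1 := huniq w hw' _ m subset_union_left m1 m2 m3
    have e2 := log_sub_const hcon (m1.mono subset_union_right) l1
      (fun v hv => by rw [m2 v (Or.inr hv), l2 v hv]) (Or.inr hw) (Or.inl h4)
    rw [m3, l3, sub_self] at e2
    rw [← e1, sub_eq_zero.1 e2]
  refine ⟨fun z => L z z, fun z hz => ⟨hexp z hz, ?_⟩⟩
  have hz0 : Complex.exp (L z z) ≠ 0 := Complex.exp_ne_zero _
  have := HasDerivAt.of_local_left_inverse (hcont z hz) (Complex.hasDerivAt_exp (L z z)) hz0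
    (by filter_upwards [hUo.mem_nhds hz] with w hw using hexp w hw)
  rwa [hexp z hz] at this

open scoped ComplexConjugate

/-- The automorphism `z ↦ (z - a) / (1 - conj a * z)` of the unit disc. -/
noncomputable def discMap (a z : ℂ) : ℂ := (z - a) / (1 - conj a * z)

lemma discMap_denom_ne_zero {a z : ℂ} (ha : ‖a‖ < 1) (hz : ‖z‖ ≤ 1) : 1 - conj a * z ≠ 0 := by
  intro h
  have h1 : ‖conj a * z‖ = 1 := by rw [← sub_eq_zero.1 h, norm_one]
  rw [norm_mul, RCLike.norm_conj] at h1
  nlinarith [norm_nonneg a, norm_nonneg z]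

lemma one_sub_normSq_discMap {a z : ℂ} (ha : ‖a‖ < 1) (hz : ‖z‖ ≤ 1) :
    1 - ‖discMap a z‖ ^ 2 = (1 - ‖a‖ ^ 2) * (1 - ‖z‖ ^ 2) / ‖1 - conj a * z‖ ^ 2 := by
  have hd := discMap_denom_ne_zero ha hz
  have hd' : ‖1 - conj a * z‖ ^ 2 ≠ 0 := pow_ne_zero _ (norm_ne_zero_iff.2 hd)
  rw [discMap, norm_div, div_pow, eq_div_iff hd', sub_mul, div_mul_cancel₀ _ hd']
  simp only [← Complex.normSq_eq_norm_sq, Complex.normSq_apply, Complex.sub_re, Complex.sub_im,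
    Complex.one_re, Complex.one_im, Complex.mul_re, Complex.mul_im, Complex.conj_re,
    Complex.conj_im]
  ring

lemma discMap_mem {a z : ℂ} (ha : ‖a‖ < 1) (hz : z ∈ Metric.ball (0 : ℂ) 1) :
    discMap a z ∈ Metric.ball (0 : ℂ) 1 := by
  rw [mem_ball_zero_iff] at hz ⊢
  have h := one_sub_normSq_discMap ha hz.le
  have hd := norm_pos_iff.2 (discMap_denom_ne_zero ha hz.le)
  have h2 : 0 < 1 - ‖discMap a z‖ ^ 2 := by
    rw [h]
    have h3 : 0 < 1 - ‖a‖ ^ 2 := by nlinarith [norm_nonneg a]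
    have h4 : 0 < 1 - ‖z‖ ^ 2 := by nlinarith [norm_nonneg z]
    positivity
  nlinarith [norm_nonneg (discMap a z)]

lemma discMap_neg_discMap {a z : ℂ} (ha : ‖a‖ < 1) (hz : ‖z‖ ≤ 1) :
    discMap (-a) (discMap a z) = z := by
  have hd := discMap_denom_ne_zero ha hz
  have h1 : (1 : ℂ) - conj a * a ≠ 0 := discMap_denom_ne_zero ha ha.le
  have e1 : discMap a z - -a = (1 - conj a * a) * z / (1 - conj a * z) := by
    rw [discMap, eq_div_iff hd, sub_mul, div_mul_cancel₀ _ hd]; ring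
  have e2 : 1 - conj (-a) * discMap a z = (1 - conj a * a) / (1 - conj a * z) := by
    rw [discMap, eq_div_iff hd, sub_mul, map_neg, mul_assoc, div_mul_cancel₀ _ hd]; ring
  rw [discMap, e1, e2]
  field_simp

lemma hasDerivAt_discMap {a z : ℂ} (ha : ‖a‖ < 1) (hz : ‖z‖ ≤ 1) :
    HasDerivAt (discMap a) ((1 - conj a * a) / (1 - conj a * z) ^ 2) z := by
  have hd := discMap_denom_ne_zero ha hz
  have := ((hasDerivAt_id z).sub_const a).div (((hasDerivAt_id z).const_mul (conj a)).const_sub 1) hd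
  refine this.congr_deriv ?_
  simp only [id]
  congr 1
  ring

/-- Holomorphic embeddings of `U` onto hole-free subsets of the unit disc. -/
structure IsDiscEmbedding (U : Set ℂ) (ψ : ℂ → ℂ) : Prop where
  diff : DifferentiableOn ℂ ψ U
  deriv_ne : ∀ z ∈ U, deriv ψ z ≠ 0
  inj : InjOn ψ U
  mapsTo : MapsTo ψ U (Metric.ball 0 1)
  hole : HoleFree (ψ '' U)

lemma IsDiscEmbedding.isOpen_image {U : Set ℂ} (hU : IsOpen U) {ψ : ℂ → ℂ} (h : IsDiscEmbedding U ψ)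
    {V : Set ℂ} (hV : IsOpen V) (hVU : V ⊆ U) : IsOpen (ψ '' V) := by
  rw [isOpen_iff_mem_nhds]
  rintro _ ⟨z, hz, rfl⟩
  have hs : HasStrictDerivAt ψ (deriv ψ z) z :=
    ((h.diff.analyticAt (hU.mem_nhds (hVU hz))).contDiffAt (n := 1)).hasStrictDerivAt one_ne_zero
  rw [← hs.map_nhds_eq (h.deriv_ne z (hVU hz))]
  exact image_mem_map (hV.mem_nhds hz)

lemma IsDiscEmbedding.exists_inverse {U : Set ℂ} (hU : IsOpen U) {ψ : ℂ → ℂ}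
    (h : IsDiscEmbedding U ψ) :
    ∃ χ : ℂ → ℂ, DifferentiableOn ℂ χ (ψ '' U) ∧ LeftInvOn χ ψ U := by
  have hinv : LeftInvOn (Function.invFunOn ψ U) ψ U := h.inj.leftInvOn_invFunOn
  refine ⟨_, ?_, hinv⟩
  have hc : ∀ z ∈ U, ContinuousAt (Function.invFunOn ψ U) (ψ z) := by
    intro z hz
    rw [ContinuousAt, hinv hz]
    intro V hV
    obtain ⟨W, hWs, hWo, hzW⟩ := mem_nhds_iff.1 (inter_mem hV (hU.mem_nhds hz))
    rw [mem_map]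
    filter_upwards [(h.isOpen_image hU hWo fun w hw => (hWs hw).2).mem_nhds ⟨z, hzW, rfl⟩]
    rintro _ ⟨w, hw, rfl⟩
    rw [mem_preimage, hinv (hWs hw).2]
    exact (hWs hw).1
  rintro _ ⟨z, hz, rfl⟩
  have hd : HasDerivAt ψ (deriv ψ z) (Function.invFunOn ψ U (ψ z)) := by
    rw [hinv hz]
    exact (h.diff.differentiableAt (hU.mem_nhds hz)).hasDerivAt
  refine (HasDerivAt.of_local_left_inverse (hc z hz) hd (h.deriv_ne z hz)
    ?_).differentiableAt.differentiableWithinAt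
  filter_upwards [(h.isOpen_image hU hU Subset.rfl).mem_nhds ⟨z, hz, rfl⟩]
  rintro _ ⟨w, hw, rfl⟩
  rw [hinv hw]

lemma IsDiscEmbedding.discMap_comp {U : Set ℂ} (hU : IsOpen U) {ψ : ℂ → ℂ}
    (h : IsDiscEmbedding U ψ) {a : ℂ} (ha : ‖a‖ < 1) :
    IsDiscEmbedding U (fun z => discMap a (ψ z)) ∧ ∀ z ∈ U, deriv (fun z => discMap a (ψ z)) z =
      (1 - conj a * a) / (1 - conj a * ψ z) ^ 2 * deriv ψ z := by
  have hb : ∀ z ∈ U, ‖ψ z‖ ≤ 1 := fun z hz => (mem_ball_zero_iff.1 (h.mapsTo hz)).le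
  have ha' : ‖-a‖ < 1 := by rwa [norm_neg]
  have hd : ∀ z ∈ U, HasDerivAt (fun z => discMap a (ψ z))
      ((1 - conj a * a) / (1 - conj a * ψ z) ^ 2 * deriv ψ z) z := fun z hz =>
    (hasDerivAt_discMap ha (hb z hz)).comp z
      (h.diff.differentiableAt (hU.mem_nhds hz)).hasDerivAt
  have hnb : ∀ z ∈ Metric.ball (0 : ℂ) 1, ‖z‖ ≤ 1 := fun z hz => (mem_ball_zero_iff.1 hz).le
  have hinv2 : ∀ z ∈ Metric.ball (0 : ℂ) 1, discMap a (discMap (-a) z) = z := fun z hz => by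
    simpa using discMap_neg_discMap ha' (hnb z hz)
  refine ⟨⟨fun z hz => (hd z hz).differentiableAt.differentiableWithinAt, fun z hz => ?_, ?_, ?_, ?_⟩,
    fun z hz => (hd z hz).deriv⟩
  · rw [(hd z hz).deriv]
    exact mul_ne_zero (div_ne_zero (discMap_denom_ne_zero ha ha.le)
      (pow_ne_zero _ (discMap_denom_ne_zero ha (hb z hz)))) (h.deriv_ne z hz)
  · intro z hz w hw hzw
    refine h.inj hz hw ?_
    rw [← discMap_neg_discMap ha (hb z hz), ← discMap_neg_discMap ha (hb w hw)]
    exact congrArg _ hzw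
  · exact fun z hz => discMap_mem ha (h.mapsTo hz)
  · have := h.hole.image (image_subset_iff.2 h.mapsTo) (g := discMap a) (gi := discMap (-a))
      (fun z hz => (hasDerivAt_discMap ha (hnb z hz)).continuousAt.continuousWithinAt)
      (fun z hz => (hasDerivAt_discMap ha' (hnb z hz)).continuousAt.continuousWithinAt)
      (fun z hz => discMap_mem ha hz) (fun z hz => discMap_mem ha' hz)
      (fun z hz => discMap_neg_discMap ha (hnb z hz)) hinv2
    rwa [image_image] at this

lemma IsDiscEmbedding.exists_sqrt {U : Set ℂ} (hU : IsOpen U) (hUc : IsConnected U) {ψ : ℂ → ℂ}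
    (h : IsDiscEmbedding U ψ) (h0 : (0 : ℂ) ∉ ψ '' U) :
    ∃ φ : ℂ → ℂ, IsDiscEmbedding U φ ∧ ∀ z ∈ U, φ z ^ 2 = ψ z ∧ 2 * φ z * deriv φ z = deriv ψ z := by
  have hVo := h.isOpen_image hU hU Subset.rfl
  obtain ⟨L, hL⟩ := h.hole.exists_log hVo (hUc.image ψ h.diff.continuousOn) h0
  let s : ℂ → ℂ := fun z => Complex.exp (L z / 2)
  have hs : ∀ z ∈ ψ '' U, s z ^ 2 = z := fun z hz => by
    rw [← Complex.exp_nat_mul]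
    push_cast
    rw [mul_div_cancel₀ _ two_ne_zero, (hL z hz).1]
  have hsd : ∀ z ∈ U, HasDerivAt (fun z => s (ψ z))
      (s (ψ z) * ((ψ z)⁻¹ / 2) * deriv ψ z) z := fun z hz =>
    (((hL _ ⟨z, hz, rfl⟩).2.div_const 2).cexp).comp z
      (h.diff.differentiableAt (hU.mem_nhds hz)).hasDerivAt
  have hne : ∀ z ∈ U, ψ z ≠ 0 := fun z hz e => h0 ⟨z, hz, e⟩
  have hsq : ∀ z ∈ U, s (ψ z) ^ 2 = ψ z := fun z hz => hs _ ⟨z, hz, rfl⟩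
  have hdne : ∀ z ∈ U, deriv (fun z => s (ψ z)) z ≠ 0 := fun z hz => by
    rw [(hsd z hz).deriv]
    exact mul_ne_zero (mul_ne_zero (Complex.exp_ne_zero _)
      (div_ne_zero (inv_ne_zero (hne z hz)) two_ne_zero)) (h.deriv_ne z hz)
  have hdiff : DifferentiableOn ℂ (fun z => s (ψ z)) U :=
    fun z hz => (hsd z hz).differentiableAt.differentiableWithinAt
  have hopen : IsOpen ((fun z => s (ψ z)) '' U) := by
    rw [isOpen_iff_mem_nhds]
    rintro _ ⟨z, hz, rfl⟩
    have hst : HasStrictDerivAt (fun z => s (ψ z)) (deriv (fun z => s (ψ z)) z) z :=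
      ((hdiff.analyticAt (hU.mem_nhds hz)).contDiffAt (n := 1)).hasStrictDerivAt one_ne_zero
    have := hst.map_nhds_eq (hdne z hz)
    rw [← this]
    exact image_mem_map (hU.mem_nhds hz)
  refine ⟨fun z => s (ψ z), ⟨hdiff, hdne, ?_, ?_, ?_⟩, fun z hz => ⟨hsq z hz, ?_⟩⟩
  · intro z hz w hw hzw
    refine h.inj hz hw ?_
    rw [← hsq z hz, ← hsq w hw]
    exact congrArg (· ^ 2) hzw
  · intro z hz
    have := h.mapsTo hz
    rw [mem_ball_zero_iff] at this ⊢
    rw [← hsq z hz, norm_pow] at this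
    exact (sq_lt_one_iff₀ (norm_nonneg _)).1 this
  · have := h.hole.image_sqrt hs h0 (by rwa [image_image])
    rwa [image_image] at this
  · rw [(hsd z hz).deriv]
    have e := hsq z hz
    have hn := hne z hz
    calc 2 * s (ψ z) * (s (ψ z) * ((ψ z)⁻¹ / 2) * deriv ψ z)
        = s (ψ z) ^ 2 * (ψ z)⁻¹ * deriv ψ z := by ring
      _ = deriv ψ z := by rw [e, mul_inv_cancel₀ hn, one_mul]

/-- If the image of `ψ` omits a point of the disc, then `ψ` can be replaced by an embedding with a
larger derivative at `p`. -/
lemma IsDiscEmbedding.exists_larger_deriv {U : Set ℂ} (hU : IsOpen U) (hUc : IsConnected U)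
    {ψ : ℂ → ℂ} (h : IsDiscEmbedding U ψ) {p : ℂ} (hp : p ∈ U) (hψp : ψ p = 0) {a : ℂ}
    (ha : ‖a‖ < 1) (haU : a ∉ ψ '' U) :
    ∃ φ : ℂ → ℂ, IsDiscEmbedding U φ ∧ φ p = 0 ∧
      2 * √‖a‖ * ‖deriv φ p‖ = (1 + ‖a‖) * ‖deriv ψ p‖ := by
  obtain ⟨h1, d1⟩ := h.discMap_comp hU ha
  obtain ⟨φ, h2, d2⟩ := h1.exists_sqrt hU hUc (by
    rintro ⟨z, hz, e⟩
    have e' : discMap (-a) (discMap a (ψ z)) = discMap (-a) 0 := congrArg _ e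
    rw [discMap_neg_discMap ha (mem_ball_zero_iff.1 (h.mapsTo hz)).le] at e'
    exact haU ⟨z, hz, by simpa [discMap] using e'⟩)
  have hb : ‖φ p‖ < 1 := mem_ball_zero_iff.1 (h2.mapsTo hp)
  obtain ⟨h3, d3⟩ := h2.discMap_comp hU hb
  refine ⟨_, h3, by simp [discMap], ?_⟩
  have e1 := d1 p hp
  have e2 := (d2 p hp).1
  have e2' := (d2 p hp).2
  have e3 := d3 p hp
  rw [hψp] at e1
  have ea : φ p ^ 2 = -a := by rw [e2, hψp]; simp [discMap]
  have hn : ‖φ p‖ ^ 2 = ‖a‖ := by rw [← norm_pow, ea, norm_neg]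
  have hsqrt : √‖a‖ = ‖φ p‖ := by rw [← hn, Real.sqrt_sq (norm_nonneg _)]
  have hcc : ∀ z : ℂ, ‖z‖ < 1 → ‖1 - conj z * z‖ = 1 - ‖z‖ ^ 2 := fun z hz => by
    rw [mul_comm, Complex.mul_conj, Complex.normSq_eq_norm_sq]
    have : (1 : ℂ) - ((‖z‖ ^ 2 : ℝ) : ℂ) = ((1 - ‖z‖ ^ 2 : ℝ) : ℂ) := by push_cast; ring
    rw [this, Complex.norm_real, Real.norm_of_nonneg]
    nlinarith [norm_nonneg z]
  have n1 := congrArg norm e1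
  have n2 := congrArg norm e2'
  have n3 := congrArg norm e3
  simp only [norm_mul, norm_div, norm_pow, hcc a ha, hcc _ hb, mul_zero, sub_zero,
    one_pow, div_one, Complex.norm_ofNat] at n1 n2 n3
  rw [n1] at n2
  rw [n3, hsqrt]
  have hpos : 0 < 1 - ‖φ p‖ ^ 2 := by nlinarith [norm_nonneg (φ p)]
  have : 2 * ‖φ p‖ * ((1 - ‖φ p‖ ^ 2) / (1 - ‖φ p‖ ^ 2) ^ 2 * ‖deriv φ p‖) =
      (2 * ‖φ p‖ * ‖deriv φ p‖) / (1 - ‖φ p‖ ^ 2) := by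
    field_simp
  rw [this, n2, hn, div_eq_iff (by rw [← hn]; exact hpos.ne')]
  ring

/-- Pointwise limits of locally uniformly bounded holomorphic functions are locally uniform. -/
lemma tendstoLocallyUniformlyOn_of_bounded {ι : Type*} {F : Filter ι} [F.NeBot] {V : Set ℂ}
    {f : ι → ℂ → ℂ} {g : ℂ → ℂ} {M : ℝ}
    (hb : ∀ z ∈ V, ∃ δ > 0, ∀ᶠ n in F, DifferentiableOn ℂ (f n) (Metric.ball z δ) ∧
      ∀ w ∈ Metric.ball z δ, ‖f n w‖ ≤ M)
    (hlim : ∀ z ∈ V, Tendsto (fun n => f n z) F (𝓝 (g z))) :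
    TendstoLocallyUniformlyOn f g F V := by
  rw [Metric.tendstoLocallyUniformlyOn_iff]
  intro ε hε z hz
  obtain ⟨δ, hδ, hev⟩ := hb z hz
  have hlip : ∀ᶠ n in F, ∀ w ∈ Metric.ball z δ, dist (f n w) (f n z) ≤ 2 * |M| / δ * dist w z := by
    filter_upwards [hev] with n ⟨h1, h2⟩ w hw
    refine Complex.dist_le_div_mul_dist_of_mapsTo_ball h1 (fun v hv => ?_) hw
    have a1 := h2 v hv
    have a2 := h2 z (Metric.mem_ball_self hδ)
    rw [mem_closedBall_iff_norm]
    have := norm_sub_le (f n v) (f n z)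
    linarith [le_abs_self M]
  let r := min δ (ε / (4 * (2 * |M| / δ + 1)))
  have hr : 0 < r := lt_min hδ (by positivity)
  have hbd : ∀ w ∈ Metric.ball z r, 2 * |M| / δ * dist w z ≤ ε / 4 := by
    intro w hw
    have h1 : dist w z ≤ ε / (4 * (2 * |M| / δ + 1)) :=
      (Metric.mem_ball.1 hw).le.trans (min_le_right _ _)
    have h0 : 0 ≤ 2 * |M| / δ := by positivity
    calc 2 * |M| / δ * dist w z ≤ (2 * |M| / δ + 1) * (ε / (4 * (2 * |M| / δ + 1))) := by
          gcongr; linarith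
      _ = ε / 4 := by field_simp
  have hsub : Metric.ball z r ⊆ Metric.ball z δ := Metric.ball_subset_ball (min_le_left _ _)
  refine ⟨Metric.ball z r ∩ V, inter_mem (mem_nhdsWithin_of_mem_nhds (Metric.ball_mem_nhds z hr))
    self_mem_nhdsWithin, ?_⟩
  filter_upwards [hlip, (Metric.tendsto_nhds.1 (hlim z hz)) (ε / 4) (by positivity)] with n h1 h2
  intro w ⟨hw, hwV⟩
  have a1 := (h1 w (hsub hw)).trans (hbd w hw)
  have a2 : dist (g w) (g z) ≤ ε / 4 := by
    refine le_of_tendsto ((hlim w hwV).dist (hlim z hz)) ?_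
    filter_upwards [hlip] with m hm
    exact (hm w (hsub hw)).trans (hbd w hw)
  calc dist (g w) (f n w) ≤ dist (g w) (g z) + dist (g z) (f n z) + dist (f n z) (f n w) :=
        dist_triangle4 _ _ _ _
    _ < ε := by
      rw [dist_comm (g z), dist_comm (f n z) (f n w)]
      linarith

lemma differentiableOn_of_bounded_limit {ι : Type*} {F : Filter ι} [F.NeBot] {V : Set ℂ}
    {f : ι → ℂ → ℂ} {g : ℂ → ℂ} {M : ℝ} (hV : IsOpen V)
    (hb : ∀ z ∈ V, ∃ δ > 0, ∀ᶠ n in F, DifferentiableOn ℂ (f n) (Metric.ball z δ) ∧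
      ∀ w ∈ Metric.ball z δ, ‖f n w‖ ≤ M)
    (hlim : ∀ z ∈ V, Tendsto (fun n => f n z) F (𝓝 (g z))) : DifferentiableOn ℂ g V := by
  intro z hz
  obtain ⟨δ, hδ, hev⟩ := hb z hz
  obtain ⟨η, hη, hηV⟩ := Metric.isOpen_iff.1 hV z hz
  have hsub : Metric.ball z (min δ η) ⊆ V :=
    (Metric.ball_subset_ball (min_le_right _ _)).trans hηV
  have := ((tendstoLocallyUniformlyOn_of_bounded hb hlim).mono hsub).differentiableOn
    (by
      filter_upwards [hev] with n hn
      exact hn.1.mono (Metric.ball_subset_ball (min_le_left _ _))) Metric.isOpen_ball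
  exact (this.differentiableAt (Metric.ball_mem_nhds z (lt_min hδ hη))).differentiableWithinAt

/-- Hurwitz: a limit of nonvanishing holomorphic functions vanishes identically or nowhere. -/
lemma ne_zero_of_limit_ne_zero {ι : Type*} {F : Filter ι} [F.NeBot] {V : Set ℂ}
    {f : ι → ℂ → ℂ} {g : ℂ → ℂ} (hV : IsOpen V) (hVc : IsPreconnected V)
    (hg : DifferentiableOn ℂ g V) (hlim : TendstoLocallyUniformlyOn f g F V)
    (hf : ∀ z ∈ V, ∃ δ > 0, ∀ᶠ n in F, DifferentiableOn ℂ (f n) (Metric.ball z δ) ∧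
      ∀ w ∈ Metric.ball z δ, f n w ≠ 0)
    {p : ℂ} (hp : p ∈ V) (hgp : g p ≠ 0) : ∀ z ∈ V, g z ≠ 0 := by
  intro z hz h0
  have han : AnalyticOnNhd ℂ g V := hg.analyticOnNhd hV
  have hnf : ∀ᶠ w in 𝓝[≠] z, g w ≠ 0 := by
    by_contra hcon
    rw [not_eventually] at hcon
    exact hgp (han.eqOn_zero_of_preconnected_of_frequently_eq_zero hVc hz
      (hcon.mono fun _ => not_not.1) hp)
  obtain ⟨δ, hδ, hev⟩ := hf z hz
  rw [eventually_nhdsWithin_iff] at hnf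
  obtain ⟨η, hη, hball⟩ := Metric.nhds_basis_closedBall.mem_iff.1
    (inter_mem (inter_mem hnf (hV.mem_nhds hz)) (Metric.ball_mem_nhds z hδ))
  have hcs : IsCompact (Metric.sphere z η) := isCompact_sphere z η
  have hsb : Metric.sphere z η ⊆ Metric.closedBall z η := Metric.sphere_subset_closedBall
  obtain ⟨s, hs, hmin⟩ := hcs.exists_isMinOn (NormedSpace.sphere_nonempty.2 hη.le)
    ((hg.continuousOn.mono fun w hw => (hball (hsb hw)).1.2).norm)
  have hspos : 0 < ‖g s‖ := norm_pos_iff.2 ((hball (hsb hs)).1.1 (by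
    rintro rfl
    rw [mem_sphere_iff_norm, sub_self, norm_zero] at hs
    exact hη.ne hs))
  have hunif := Metric.tendstoUniformlyOn_iff.1
    ((tendstoLocallyUniformlyOn_iff_forall_isCompact hV).1 hlim (Metric.closedBall z η)
      (fun w hw => (hball hw).1.2) (isCompact_closedBall z η)) (‖g s‖ / 3) (by positivity)
  obtain ⟨n, ⟨hn1, hn2⟩, hn3⟩ := (hev.and hunif).exists
  have hzb : z ∈ Metric.closedBall z η := Metric.mem_closedBall_self hη.le
  have hinv : DiffContOnCl ℂ (fun w => (f n w)⁻¹) (Metric.ball z η) := by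
    refine DifferentiableOn.diffContOnCl ?_
    rw [closure_ball _ hη.ne']
    exact (hn1.mono fun w hw => (hball hw).2).inv fun w hw => hn2 w (hball hw).2
  have := Complex.norm_le_of_forall_mem_frontier_norm_le Metric.isBounded_ball hinv
    (C := (‖g s‖ / 2)⁻¹) (fun w hw => ?_) (subset_closure (Metric.mem_ball_self hη))
  · rw [norm_inv] at this
    have hzz := hn3 z hzb
    rw [h0, dist_zero_left] at hzz
    have hpos : 0 < ‖f n z‖ := norm_pos_iff.2 (hn2 z (hball hzb).2)
    have := (inv_le_inv₀ hpos (by positivity)).1 this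
    linarith
  · rw [frontier_ball _ hη.ne'] at hw
    have h1 := hn3 w (hsb hw)
    have h2 : ‖g s‖ ≤ ‖g w‖ := hmin hw
    rw [dist_eq_norm] at h1
    have h3 : ‖g w‖ ≤ ‖g w - f n w‖ + ‖f n w‖ := by simpa using norm_add_le (g w - f n w) (f n w)
    rw [norm_inv]
    refine inv_anti₀ (by positivity) ?_
    linarith

lemma HoleFree.image_homeomorph {U : Set ℂ} (hU : HoleFree U) (e : ℂ ≃ₜ ℂ) : HoleFree (e '' U) := by
  intro X hX hd hO
  have := hU (e ⁻¹' X) (e.isCompact_preimage.2 hX) ?_ ?_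
  · rw [← image_preimage_eq X e.surjective, this, image_empty]
  · refine Set.disjoint_left.2 fun z hz hzU => Set.disjoint_left.1 hd hz ⟨z, hzU, rfl⟩
  · have e1 : U ∪ e ⁻¹' X = e ⁻¹' (e '' U ∪ X) := by
      rw [preimage_union, preimage_image_eq _ e.injective]
    rw [e1]
    exact hO.preimage e.continuous

/-- The Riemann mapping theorem for bounded hole-free domains. -/
theorem HoleFree.exists_riemann_map {U : Set ℂ} (hole : HoleFree U) (hU : IsOpen U)
    (hUc : IsConnected U) (hbd : Bornology.IsBounded U) {p : ℂ} (hp : p ∈ U) :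
    ∃ ψ χ : ℂ → ℂ, DifferentiableOn ℂ ψ U ∧ DifferentiableOn ℂ χ (Metric.ball 0 1) ∧
      MapsTo ψ U (Metric.ball 0 1) ∧ MapsTo χ (Metric.ball 0 1) U ∧ LeftInvOn χ ψ U ∧
      LeftInvOn ψ χ (Metric.ball 0 1) := by
  obtain ⟨R, hR⟩ := hbd.exists_norm_le
  have hR0 : 0 ≤ R := (norm_nonneg p).trans (hR p hp)
  let S : Set ℝ := {x | ∃ φ, IsDiscEmbedding U φ ∧ φ p = 0 ∧ ‖deriv φ p‖ = x}
  obtain ⟨δ₀, hδ₀, hball⟩ := Metric.isOpen_iff.1 hU p hp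
  have hSb : BddAbove S := by
    refine ⟨1 / δ₀, ?_⟩
    rintro _ ⟨φ, hφ, h0, rfl⟩
    refine Complex.norm_deriv_le_div_of_mapsTo_ball (hφ.diff.mono hball) (fun z hz => ?_) hδ₀
    rw [h0]
    exact Metric.ball_subset_closedBall (hφ.mapsTo (hball hz))
  obtain ⟨x₀, hx₀S, hx₀⟩ : ∃ x ∈ S, 0 < x := by
    have hc : (2 * R + 1 : ℂ) ≠ 0 := by
      have : ((2 * R + 1 : ℝ) : ℂ) ≠ 0 := by
        rw [Complex.ofReal_ne_zero]; positivity
      simpa using this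
    have hd : ∀ z : ℂ, HasDerivAt (fun z => (2 * R + 1 : ℂ)⁻¹ * (z - p)) (2 * R + 1 : ℂ)⁻¹ z :=
      fun z => by simpa using ((hasDerivAt_id z).sub_const p).const_mul (2 * R + 1 : ℂ)⁻¹
    have hdp : 0 < ‖(2 * R + 1 : ℂ)⁻¹‖ := norm_pos_iff.2 (inv_ne_zero hc)
    refine ⟨_, ⟨fun z => (2 * R + 1 : ℂ)⁻¹ * (z - p), ⟨?_, ?_, ?_, ?_, ?_⟩, by simp, rfl⟩, ?_⟩
    · exact fun z _ => (hd z).differentiableAt.differentiableWithinAt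
    · exact fun z _ => by rw [(hd z).deriv]; exact inv_ne_zero hc
    · intro z _ w _ h
      simpa using mul_left_cancel₀ (inv_ne_zero hc) h
    · intro z hz
      have : (2 * R + 1 : ℂ) = ((2 * R + 1 : ℝ) : ℂ) := by push_cast; ring
      rw [mem_ball_zero_iff, norm_mul, norm_inv, this, Complex.norm_real,
        Real.norm_of_nonneg (by positivity), inv_mul_lt_iff₀ (by positivity)]
      linarith [norm_sub_le z p, hR z hz, hR p hp]
    · have := hole.image_homeomorph
        ((Homeomorph.subRight p).trans (Homeomorph.mulLeft₀ _ (inv_ne_zero hc)))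
      exact this
    · rw [(hd p).deriv]; exact hdp
  have hM : 0 < sSup S := hx₀.trans_le (le_csSup hSb hx₀S)
  have hseq : ∀ n : ℕ, ∃ φ, IsDiscEmbedding U φ ∧ φ p = 0 ∧
      sSup S - 1 / ((n : ℝ) + 1) < ‖deriv φ p‖ := by
    intro n
    obtain ⟨_, ⟨φ, h1, h2, rfl⟩, h3⟩ := exists_lt_of_lt_csSup ⟨x₀, hx₀S⟩
      (show sSup S - 1 / ((n : ℝ) + 1) < sSup S by
        have : (0 : ℝ) < 1 / ((n : ℝ) + 1) := by positivity
        linarith)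
    exact ⟨φ, h1, h2, h3⟩
  choose φ hφ hφp hφd using hseq
  choose χ hχd hχinv using fun n => (hφ n).exists_inverse hU
  have hcover : ∀ r < 1, ∀ᶠ n in atTop, Metric.ball 0 r ⊆ φ n '' U := by
    intro r hr
    rcases le_or_gt r 0 with hr0 | hr0
    · simp [Metric.ball_eq_empty.2 hr0]
    have hsr : √r < 1 := by rw [Real.sqrt_lt' one_pos]; simpa using hr
    have hc : 0 < (1 - √r) ^ 2 := by
      have : 0 < 1 - √r := by linarith
      positivity
    have ht : Tendsto (fun n : ℕ => (1 - √r) ^ 2 * (sSup S - 1 / ((n : ℝ) + 1)) -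
        2 * (1 / ((n : ℝ) + 1))) atTop (𝓝 ((1 - √r) ^ 2 * (sSup S - 0) - 2 * 0)) :=
      ((tendsto_const_nhds.sub tendsto_one_div_add_atTop_nhds_zero_nat).const_mul _).sub
        (tendsto_one_div_add_atTop_nhds_zero_nat.const_mul 2)
    filter_upwards [ht.eventually (lt_mem_nhds (show 0 < (1 - √r) ^ 2 * (sSup S - 0) - 2 * 0 by
      rw [sub_zero, mul_zero, sub_zero]; positivity))] with n hn a ha
    by_contra hcon
    rw [mem_ball_zero_iff] at ha
    obtain ⟨θ, h1, h2, h3⟩ := (hφ n).exists_larger_deriv hU hUc hp (hφp n) (ha.trans hr) hcon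
    have hle : ‖deriv θ p‖ ≤ sSup S := le_csSup hSb ⟨θ, h1, h2, rfl⟩
    have hsa : √‖a‖ ≤ √r := Real.sqrt_le_sqrt ha.le
    have hs0 := Real.sqrt_nonneg ‖a‖
    have hsq := Real.sq_sqrt (norm_nonneg a)
    set s := √‖a‖
    rw [← hsq] at h3
    have k1 : (1 - √r) ^ 2 ≤ (1 - s) ^ 2 := by nlinarith
    have k2 : (1 - s) ^ 2 * ‖deriv (φ n) p‖ = 2 * s * (‖deriv θ p‖ - ‖deriv (φ n) p‖) := by
      linear_combination -h3
    have k3 : ‖deriv θ p‖ - ‖deriv (φ n) p‖ ≤ 1 / ((n : ℝ) + 1) := by linarith [hφd n]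
    have hn0 : (0 : ℝ) < 1 / ((n : ℝ) + 1) := by positivity
    have k4 : 2 * s * (‖deriv θ p‖ - ‖deriv (φ n) p‖) ≤ 2 * (1 / ((n : ℝ) + 1)) := by
      calc _ ≤ 2 * s * (1 / ((n : ℝ) + 1)) := by gcongr
        _ ≤ 2 * 1 * (1 / ((n : ℝ) + 1)) := by gcongr; linarith
        _ = _ := by ring
    have k5 : (1 - √r) ^ 2 * (sSup S - 1 / ((n : ℝ) + 1)) ≤ (1 - s) ^ 2 * ‖deriv (φ n) p‖ := by
      calc _ ≤ (1 - √r) ^ 2 * ‖deriv (φ n) p‖ := by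
            gcongr; exact (hφd n).le
        _ ≤ _ := by gcongr
    linarith
  let F : Ultrafilter ℕ := hyperfilter ℕ
  have hFle : (F : Filter ℕ) ≤ atTop := by
    rw [← Nat.cofinite_eq_atTop]; exact hyperfilter_le_cofinite
  have hcoverF : ∀ r < 1, ∀ᶠ n in (F : Filter ℕ), Metric.ball 0 r ⊆ φ n '' U :=
    fun r hr => (hcover r hr).filter_mono hFle
  have hlimφ : ∀ z : ℂ, ∃ w, z ∈ U → Tendsto (fun n => φ n z) F (𝓝 w) := by
    intro z
    by_cases hz : z ∈ U
    · obtain ⟨w, -, hw⟩ := (isCompact_closedBall (0 : ℂ) 1).ultrafilter_le_nhds (F.map fun n => φ n z)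
        (by
          rw [le_principal_iff, Ultrafilter.mem_coe, Ultrafilter.mem_map]
          exact Filter.univ_mem' fun n => Metric.ball_subset_closedBall ((hφ n).mapsTo hz))
      exact ⟨w, fun _ => hw⟩
    · exact ⟨0, fun h => absurd h hz⟩
  choose ψ hψ using hlimφ
  have hχU : ∀ r < 1, ∀ᶠ n in (F : Filter ℕ), ∀ w ∈ Metric.ball (0 : ℂ) r, χ n w ∈ U ∧
      φ n (χ n w) = w := by
    intro r hr
    filter_upwards [hcoverF r hr] with n hn w hw
    obtain ⟨z, hz, rfl⟩ := hn hw
    rw [hχinv n hz]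
    exact ⟨hz, rfl⟩
  have hexr : ∀ w ∈ Metric.ball (0 : ℂ) 1, ∃ r < 1, w ∈ Metric.ball (0 : ℂ) r := by
    intro w hw
    rw [mem_ball_zero_iff] at hw
    exact ⟨(‖w‖ + 1) / 2, by linarith, by rw [mem_ball_zero_iff]; linarith⟩
  have hlimχ : ∀ w : ℂ, ∃ z, w ∈ Metric.ball (0 : ℂ) 1 → Tendsto (fun n => χ n w) F (𝓝 z) := by
    intro w
    by_cases hw : w ∈ Metric.ball (0 : ℂ) 1
    · obtain ⟨r, hr, hwr⟩ := hexr w hw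
      obtain ⟨z, -, hz⟩ := (isCompact_closedBall (0 : ℂ) R).ultrafilter_le_nhds (F.map fun n => χ n w)
        (by
          rw [le_principal_iff, Ultrafilter.mem_coe, Ultrafilter.mem_map]
          filter_upwards [hχU r hr] with n hn
          exact mem_closedBall_zero_iff.2 (hR _ (hn w hwr).1))
      exact ⟨z, fun _ => hz⟩
    · exact ⟨0, fun h => absurd h hw⟩
  choose X hX using hlimχ
  have hbφ : ∀ z ∈ U, ∃ δ > 0, ∀ᶠ n in (F : Filter ℕ), DifferentiableOn ℂ (φ n) (Metric.ball z δ) ∧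
      ∀ w ∈ Metric.ball z δ, ‖φ n w‖ ≤ 1 := by
    intro z hz
    obtain ⟨δ, hδ, h⟩ := Metric.isOpen_iff.1 hU z hz
    exact ⟨δ, hδ, Eventually.of_forall fun n => ⟨(hφ n).diff.mono h, fun w hw =>
      (mem_ball_zero_iff.1 ((hφ n).mapsTo (h hw))).le⟩⟩
  have hloc : ∀ w ∈ Metric.ball (0 : ℂ) 1, ∃ r < 1, ∃ δ > 0, Metric.ball w δ ⊆ Metric.ball 0 r := by
    intro w hw
    obtain ⟨r, hr, hwr⟩ := hexr w hw
    obtain ⟨δ, hδ, h⟩ := Metric.isOpen_iff.1 Metric.isOpen_ball w hwr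
    exact ⟨r, hr, δ, hδ, h⟩
  have hbχ : ∀ w ∈ Metric.ball (0 : ℂ) 1, ∃ δ > 0, ∀ᶠ n in (F : Filter ℕ),
      DifferentiableOn ℂ (χ n) (Metric.ball w δ) ∧ ∀ v ∈ Metric.ball w δ, ‖χ n v‖ ≤ R := by
    intro w hw
    obtain ⟨r, hr, δ, hδ, h⟩ := hloc w hw
    refine ⟨δ, hδ, ?_⟩
    filter_upwards [hχU r hr, hcoverF r hr] with n h1 h2
    exact ⟨(hχd n).mono (h.trans h2), fun v hv => hR _ (h1 v (h hv)).1⟩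
  have huφ := tendstoLocallyUniformlyOn_of_bounded hbφ hψ
  have huχ := tendstoLocallyUniformlyOn_of_bounded hbχ hX
  have hdψ := differentiableOn_of_bounded_limit hU hbφ hψ
  have hdX := differentiableOn_of_bounded_limit Metric.isOpen_ball hbχ hX
  have hψp : ψ p = 0 := tendsto_nhds_unique (hψ p hp) (by simp [hφp])
  have hψle : ∀ z ∈ U, ‖ψ z‖ ≤ 1 := fun z hz =>
    le_of_tendsto (hψ z hz).norm (Eventually.of_forall fun n =>
      (mem_ball_zero_iff.1 ((hφ n).mapsTo hz)).le)
  have hψm : MapsTo ψ U (Metric.ball 0 1) := by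
    intro z hz
    rw [mem_ball_zero_iff]
    refine (hψle z hz).lt_of_ne fun h1 => ?_
    have := Complex.norm_eqOn_of_isPreconnected_of_isMaxOn hUc.isPreconnected hU hdψ hz
      (fun w hw => by simpa [h1] using hψle w hw) hp
    simp [hψp, h1] at this
  have h0b : (0 : ℂ) ∈ Metric.ball (0 : ℂ) 1 := Metric.mem_ball_self one_pos
  have hX0 : X 0 = p := by
    refine tendsto_nhds_unique (hX 0 h0b) ?_
    have : ∀ n, χ n 0 = p := fun n => by rw [← hφp n, hχinv n hp]
    simp [this]
  have hXm : MapsTo X (Metric.ball 0 1) U := by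
    intro w hw
    by_contra hcon
    refine ne_zero_of_limit_ne_zero (F := (F : Filter ℕ)) (f := fun n v => χ n v - X w)
      (g := fun v => X v - X w) Metric.isOpen_ball (convex_ball (0 : ℂ) 1).isPreconnected
      (hdX.sub_const _) ?_ ?_ h0b ?_ w hw (sub_self _)
    · rw [Metric.tendstoLocallyUniformlyOn_iff] at huχ ⊢
      simpa only [dist_sub_right] using huχ
    · intro v hv
      obtain ⟨r, hr, δ, hδ, h⟩ := hloc v hv
      refine ⟨δ, hδ, ?_⟩
      filter_upwards [hχU r hr, hcoverF r hr] with n h1 h2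
      refine ⟨((hχd n).mono (h.trans h2)).sub_const _, fun u hu e => hcon ?_⟩
      rw [← sub_eq_zero.1 e]
      exact (h1 u (h hu)).1
    · rw [hX0]
      exact fun e => hcon (by rw [← sub_eq_zero.1 e]; exact hp)
  refine ⟨ψ, X, hdψ, hdX, hψm, hXm, fun z hz => ?_, fun w hw => ?_⟩
  · have h1 := huχ.tendsto_comp (hdX.continuousOn _ (hψm hz)) (hψm hz)
      (tendsto_nhdsWithin_iff.2 ⟨hψ z hz, Eventually.of_forall fun n => (hφ n).mapsTo hz⟩)
    refine tendsto_nhds_unique h1 ?_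
    have : ∀ n, χ n (φ n z) = z := fun n => hχinv n hz
    simp [this]
  · obtain ⟨r, hr, hwr⟩ := hexr w hw
    have h1 := huφ.tendsto_comp (hdψ.continuousOn _ (hXm hw)) (hXm hw)
      (tendsto_nhdsWithin_iff.2 ⟨hX w hw, by
        filter_upwards [hχU r hr] with n hn using (hn w hwr).1⟩)
    refine tendsto_nhds_unique h1 (tendsto_const_nhds.congr' ?_)
    filter_upwards [hχU r hr] with n hn
    exact (hn w hwr).2.symm

lemma frontier_connectedComponentIn_subset {V : Set ℂ} (hV : IsOpen V) {p : ℂ} :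
    frontier (connectedComponentIn V p) ⊆ Vᶜ := by
  intro z hz hzV
  obtain ⟨ε, hε, hball⟩ := Metric.isOpen_iff.1 hV z hzV
  rw [hV.connectedComponentIn.frontier_eq] at hz
  obtain ⟨w, hwb, hw⟩ := mem_closure_iff_nhds.1 hz.1 _ (Metric.ball_mem_nhds z hε)
  have h := connectedComponentIn_eq hw
  have hz' : z ∈ connectedComponentIn V w :=
    (convex_ball z ε).isPreconnected.subset_connectedComponentIn hwb hball
      (Metric.mem_ball_self hε)
  exact hz.2 (h ▸ hz')

/-- A path in the punctured plane from a small to a large radius meets, up to the dihedral group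
of order `2 * N`, every path spanning a sector of opening `π / N` in between. -/
lemma exists_dihedral_crossing {N : ℕ} (hN : 0 < N) {l L : ℝ → ℂ}
    (hl : ContinuousOn l (Icc 0 1)) (hL : ContinuousOn L (Icc 0 1)) (h0 : (l 0).im ≤ 0)
    (h1 : Real.pi / N ≤ (l 1).im) (hL0 : ∀ s ∈ Icc (0 : ℝ) 1, (L 0).re < (l s).re)
    (hL1 : ∀ s ∈ Icc (0 : ℝ) 1, (l s).re < (L 1).re) :
    ∃ s ∈ Icc (0 : ℝ) 1, ∃ t ∈ Icc (0 : ℝ) 1, ∃ j : ℤ,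
      L t = l s + j * (2 * (Real.pi / N) * Complex.I) ∨
      L t = conj (l s) + j * (2 * (Real.pi / N) * Complex.I) := by
  have hα : 0 < Real.pi / N := by have := Real.pi_pos; positivity
  set α := Real.pi / N
  have hne : 2 * α ≠ 0 := by positivity
  have hle : ∀ θ : ℝ, ‖(θ : AddCircle (2 * α))‖ ≤ α := fun θ => by
    have := AddCircle.norm_le_half_period (2 * α) (x := (θ : AddCircle (2 * α))) hne
    rwa [abs_of_pos (by positivity), mul_div_cancel_left₀ _ two_ne_zero] at this
  obtain ⟨s, hs, t, ht, hst⟩ := exists_path_crossing (a := fun s => ((l s).im, (l s).re))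
    (b := fun t => (‖((L t).im : AddCircle (2 * α))‖, (L t).re))
    ((Complex.continuous_im.comp_continuousOn hl).prodMk (Complex.continuous_re.comp_continuousOn hl))
    ((continuous_norm.comp_continuousOn ((AddCircle.continuous_mk' _).comp_continuousOn
      (Complex.continuous_im.comp_continuousOn hL))).prodMk
      (Complex.continuous_re.comp_continuousOn hL))
    (fun t _ => h0.trans (norm_nonneg _)) (fun t _ => (hle _).trans h1) hL0 hL1
  refine ⟨s, hs, t, ht, round ((2 * α)⁻¹ * (L t).im), ?_⟩
  simp only [Prod.mk.injEq] at hst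
  obtain ⟨e1, e2⟩ := hst
  rw [AddCircle.norm_eq] at e1
  have e3 : (round ((2 * α)⁻¹ * (L t).im) : ℂ) * (2 * ((α : ℝ) : ℂ) * Complex.I) =
      ((round ((2 * α)⁻¹ * (L t).im) * (2 * α) : ℝ) : ℂ) * Complex.I := by push_cast; ring
  have hα' : ((α : ℝ) : ℂ) = (Real.pi : ℂ) / N := by simp [α]
  rw [← hα', e3]
  rcases abs_choice ((L t).im - round ((2 * α)⁻¹ * (L t).im) * (2 * α)) with h | h
  · left
    rw [h] at e1
    apply Complex.ext
    · simp [e2]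
    · simp only [Complex.add_im, Complex.mul_im, Complex.ofReal_re, Complex.I_im, Complex.ofReal_im,
        Complex.I_re]
      linarith
  · right
    rw [h] at e1
    apply Complex.ext
    · simp [e2]
    · simp only [Complex.add_im, Complex.mul_im, Complex.ofReal_re, Complex.I_im, Complex.ofReal_im,
        Complex.I_re, Complex.conj_im]
      linarith

lemma norm_pow_le_of_small_on_sector_path {F : ℂ → ℂ} (hF : DifferentiableOn ℂ F (Metric.ball 0 1))
    {M : ℝ} (hM : ∀ z ∈ Metric.ball (0 : ℂ) 1, ‖F z‖ ≤ M) {N : ℕ} (hN : 0 < N) {l : ℝ → ℂ}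
    (hl : ContinuousOn l (Icc 0 1)) (h0 : (l 0).im ≤ 0) (h1 : Real.pi / N ≤ (l 1).im)
    (hre : ∀ t ∈ Icc (0 : ℝ) 1, (l t).re < 0) {ε : ℝ}
    (hε : ∀ t ∈ Icc (0 : ℝ) 1, ‖F (Complex.exp (l t))‖ ≤ ε) :
    (‖F 0‖ * ‖F 0‖) ^ N ≤ ε * M * (M * M) ^ (N - 1) := by
  have hM0 : 0 ≤ M := (norm_nonneg _).trans (hM 0 (Metric.mem_ball_self one_pos))
  let ω : ℂ := Complex.exp (2 * (Real.pi / N) * Complex.I)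
  have hωn : ‖ω‖ = 1 := by
    have : (2 * (Real.pi / N) * Complex.I : ℂ) = ((2 * (Real.pi / N) : ℝ) : ℂ) * Complex.I := by
      push_cast; ring
    simp only [ω]
    rw [this, Complex.norm_exp_ofReal_mul_I]
  have hωN : ω ^ N = 1 := by
    rw [← Complex.exp_nat_mul]
    have hN' : (N : ℂ) ≠ 0 := by exact_mod_cast hN.ne'
    rw [show (N : ℂ) * (2 * (Real.pi / N) * Complex.I) = 2 * Real.pi * Complex.I by
      field_simp, Complex.exp_two_pi_mul_I]
  have hωz : ∀ j : ℤ, ∃ k ∈ Finset.range N, ω ^ k * Complex.exp (j * (2 * (Real.pi / N) * Complex.I)) = 1 := by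
    intro j
    have hNz : (0 : ℤ) < N := by exact_mod_cast hN
    have hk0 := Int.emod_nonneg (-j) hNz.ne'
    have hkl := Int.emod_lt_of_pos (-j) hNz
    refine ⟨((-j) % N).toNat, Finset.mem_range.2 (by omega), ?_⟩
    have e1 : Complex.exp (j * (2 * (Real.pi / N) * Complex.I)) = ω ^ j := Complex.exp_int_mul _ _
    have hω0 : ω ≠ 0 := Complex.exp_ne_zero _
    rw [e1, ← zpow_natCast, Int.toNat_of_nonneg hk0, ← zpow_add₀ hω0]
    have e2 : (-j) % N + j = N * (-((-j) / N)) := by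
      have := Int.emod_add_mul_ediv (-j) N
      linarith
    rw [e2, zpow_mul, zpow_natCast, hωN, one_zpow]
  let C : Set ℂ := (fun t => Complex.exp (l t)) '' Icc 0 1
  have hcont : ContinuousOn (fun t => Complex.exp (l t)) (Icc 0 1) := hl.cexp
  have hC : IsCompact C := isCompact_Icc.image_of_continuousOn hcont
  have hCn : C.Nonempty := ⟨_, 0, by simp, rfl⟩
  have hCb : ∀ z ∈ C, ‖z‖ < 1 := by
    rintro _ ⟨t, ht, rfl⟩
    simpa [Complex.norm_exp] using hre t ht
  obtain ⟨u, hu, humax⟩ := hC.exists_isMaxOn hCn continuous_norm.continuousOn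
  obtain ⟨v, hv, hvmin⟩ := hC.exists_isMinOn hCn continuous_norm.continuousOn
  have hv0 : 0 < ‖v‖ := by
    obtain ⟨t, ht, rfl⟩ := hv
    exact norm_pos_iff.2 (Complex.exp_ne_zero _)
  let X : Set ℂ := {z | ∃ k ∈ Finset.range N, ω ^ k * z ∈ C ∨ conj (ω ^ k * z) ∈ C}
  have hX : IsClosed X := by
    have : X = ⋃ k ∈ Finset.range N, ((fun z => ω ^ k * z) ⁻¹' C ∪ (fun z => conj (ω ^ k * z)) ⁻¹' C) := by
      ext z; simp [X]
    rw [this]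
    refine isClosed_biUnion_finset fun k _ => ?_
    exact (hC.isClosed.preimage (by fun_prop)).union
      (hC.isClosed.preimage (Complex.continuous_conj.comp (by fun_prop)))
  let V : Set ℂ := Metric.ball 0 1 \ X
  have hV : IsOpen V := Metric.isOpen_ball.sdiff hX
  have h0V : (0 : ℂ) ∈ V := by
    refine ⟨Metric.mem_ball_self one_pos, ?_⟩
    rintro ⟨k, -, h | h⟩
    · rw [mul_zero] at h
      have := hvmin h
      simp only [norm_zero, mem_ofPred_eq] at this
      linarith
    · rw [mul_zero, map_zero] at h
      have := hvmin h
      simp only [norm_zero, mem_ofPred_eq] at this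
      linarith
  let Ω : Set ℂ := connectedComponentIn V 0
  have hΩo : IsOpen Ω := hV.connectedComponentIn
  have h0Ω : (0 : ℂ) ∈ Ω := mem_connectedComponentIn h0V
  have hΩc : IsConnected Ω := isConnected_connectedComponentIn_iff.2 h0V
  have hΩV : Ω ⊆ V := connectedComponentIn_subset V 0
  have hΩb : Ω ⊆ Metric.closedBall 0 ‖u‖ := by
    intro z hz
    by_contra hcon
    rw [mem_closedBall_zero_iff, not_le] at hcon
    have hj := (hΩo.isConnected_iff_isPathConnected.1 hΩc).joinedIn 0 h0Ω z hz
    let γ : ℝ → ℂ := hj.somePath.extend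
    have hγc : Continuous γ := hj.somePath.continuous_extend
    have hγ0 : γ 0 = 0 := hj.somePath.extend_zero
    have hγ1 : γ 1 = z := hj.somePath.extend_one
    have hγΩ : ∀ t ∈ Icc (0 : ℝ) 1, γ t ∈ Ω := fun t ht => by
      simp only [γ]
      rw [Path.extend_apply _ ht]
      exact hj.somePath_mem _
    obtain ⟨τ, ⟨hτ1, hτ2⟩, hτmax⟩ := (isCompact_Icc.inter_right
      (isClosed_le (continuous_norm.comp hγc) (continuous_const (y := ‖v‖ / 2)))).exists_isGreatest
      (s := Icc (0 : ℝ) 1 ∩ {t | ‖γ t‖ ≤ ‖v‖ / 2}) ⟨0, by simp, by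
        simp only [mem_ofPred_eq, hγ0, norm_zero]; positivity⟩
    have hvz : ‖v‖ < ‖z‖ := (humax hv).trans_lt hcon
    have hpos : ∀ t ∈ Icc τ 1, γ t ≠ 0 := by
      intro t ht h
      obtain ⟨t1, ht1, hh⟩ := intermediate_value_Icc ht.2
        (hγc.norm.continuousOn) (show ‖v‖ / 2 ∈ Icc ‖γ t‖ ‖γ 1‖ by
          rw [h, hγ1, norm_zero]; constructor <;> linarith)
      have h3 : t1 ≤ τ := hτmax ⟨⟨hτ1.1.trans (ht.1.trans ht1.1), ht1.2⟩, hh.le⟩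
      have h4 : t1 = t := le_antisymm (h3.trans ht.1) ht1.1
      simp only at hh
      rw [h4, h, norm_zero] at hh
      linarith
    have hmem : ∀ t ∈ Icc (0 : ℝ) 1, τ + t * (1 - τ) ∈ Icc τ 1 := fun t ht => by
      constructor <;> nlinarith [ht.1, ht.2, hτ1.1, hτ1.2]
    obtain ⟨L, hL, hLe⟩ := exists_log_of_convex (convex_Icc (0 : ℝ) 1)
      (g := fun t => γ (τ + t * (1 - τ))) (by fun_prop) fun t ht => hpos _ (hmem t ht)
    have hnorm : ∀ t ∈ Icc (0 : ℝ) 1, Real.exp (L t).re = ‖γ (τ + t * (1 - τ))‖ := fun t ht => by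
      rw [← hLe t ht, Complex.norm_exp]
    have hlC : ∀ s ∈ Icc (0 : ℝ) 1, ‖v‖ ≤ Real.exp (l s).re ∧ Real.exp (l s).re ≤ ‖u‖ := fun s hs => by
      rw [← Complex.norm_exp]
      exact ⟨hvmin ⟨s, hs, rfl⟩, humax ⟨s, hs, rfl⟩⟩
    obtain ⟨s, hs, t, ht, j, hh⟩ := exists_dihedral_crossing hN hl hL h0 h1
      (fun s hs => by
        rw [← Real.exp_lt_exp, hnorm 0 (by simp)]
        have h5 : ‖γ τ‖ ≤ ‖v‖ / 2 := hτ2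
        have h6 := (hlC s hs).1
        simp only [zero_mul, add_zero]
        linarith)
      (fun s hs => by
        rw [← Real.exp_lt_exp, hnorm 1 (by simp)]
        have h6 := (hlC s hs).2
        simp only [one_mul, add_sub_cancel, hγ1]
        linarith)
    obtain ⟨k, hk, hkj⟩ := hωz j
    refine (hΩV (hγΩ (τ + t * (1 - τ)) ⟨hτ1.1.trans (hmem t ht).1, (hmem t ht).2⟩)).2
      ⟨k, hk, ?_⟩
    simp only [← hLe t ht]
    rcases hh with hh | hh
    · left
      rw [hh, Complex.exp_add, mul_left_comm, hkj, mul_one]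
      exact ⟨s, hs, rfl⟩
    · right
      rw [hh, Complex.exp_add, mul_left_comm, hkj, mul_one, Complex.exp_conj, Complex.conj_conj]
      exact ⟨s, hs, rfl⟩
  have hball : ∀ k : ℕ, ∀ z ∈ Metric.ball (0 : ℂ) 1, ω ^ k * z ∈ Metric.ball (0 : ℂ) 1 := by
    intro k z hz
    rw [mem_ball_zero_iff] at hz ⊢
    rwa [norm_mul, norm_pow, hωn, one_pow, one_mul]
  have hballc : ∀ z ∈ Metric.ball (0 : ℂ) 1, conj z ∈ Metric.ball (0 : ℂ) 1 := by
    intro z hz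
    rw [mem_ball_zero_iff] at hz ⊢
    rwa [RCLike.norm_conj]
  let G : ℂ → ℂ := fun z => ∏ k ∈ Finset.range N, (F (ω ^ k * z) * conj (F (conj (ω ^ k * z))))
  have hFc : DifferentiableOn ℂ (fun z => conj (F (conj z))) (Metric.ball 0 1) := by
    intro z hz
    have := (hF.differentiableAt (Metric.isOpen_ball.mem_nhds (hballc z hz))).star_star
    simp only [starRingEnd_apply, star_star] at this
    exact this.differentiableWithinAt
  have hG : DifferentiableOn ℂ G (Metric.ball 0 1) := by
    refine DifferentiableOn.fun_finsetProd fun k _ => ?_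
    refine DifferentiableOn.mul ?_ ?_
    · exact hF.comp (g := F) (by fun_prop) (hball k)
    · exact hFc.comp (g := fun z => conj (F (conj z))) (f := fun z => ω ^ k * z) (by fun_prop) (hball k)
  have hcl : closure Ω ⊆ Metric.closedBall 0 ‖u‖ := closure_minimal hΩb Metric.isClosed_closedBall
  have hcl' : closure Ω ⊆ Metric.ball 0 1 := hcl.trans (Metric.closedBall_subset_ball (hCb u hu))
  have hnG : ∀ z, ‖G z‖ = ∏ k ∈ Finset.range N, (‖F (ω ^ k * z)‖ * ‖F (conj (ω ^ k * z))‖) := by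
    intro z
    simp only [G]
    rw [norm_prod]
    simp only [norm_mul, RCLike.norm_conj]
  have hmax := Complex.norm_le_of_forall_mem_frontier_norm_le
    (Metric.isBounded_closedBall.subset hΩb) ((hG.mono hcl').diffContOnCl)
    (C := ε * M * (M * M) ^ (N - 1)) (fun z hz => ?_) (subset_closure h0Ω)
  · rw [hnG] at hmax
    simpa using hmax
  · have hz1 : z ∈ Metric.ball (0 : ℂ) 1 := hcl' (frontier_subset_closure hz)
    have hzX : z ∈ X := by
      by_contra h
      exact frontier_connectedComponentIn_subset hV hz ⟨hz1, h⟩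
    obtain ⟨k, hk, hkC⟩ := hzX
    rw [hnG, ← Finset.mul_prod_erase _ _ hk]
    have hε' : ∀ w ∈ C, ‖F w‖ ≤ ε := by
      rintro _ ⟨t, ht, rfl⟩
      exact hε t ht
    have hε0 : 0 ≤ ε := (norm_nonneg _).trans (hε 0 (by simp))
    have b1 : ∀ k : ℕ, ‖F (ω ^ k * z)‖ ≤ M := fun k => hM _ (hball k z hz1)
    have b2 : ∀ k : ℕ, ‖F (conj (ω ^ k * z))‖ ≤ M := fun k => hM _ (hballc _ (hball k z hz1))
    refine mul_le_mul ?_ ?_ (Finset.prod_nonneg fun _ _ => by positivity) (by positivity)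
    · rcases hkC with h | h
      · exact mul_le_mul (hε' _ h) (b2 k) (norm_nonneg _) hε0
      · rw [mul_comm ε]
        exact mul_le_mul (b1 k) (hε' _ h) (norm_nonneg _) hM0
    · have := Finset.prod_le_prod (s := (Finset.range N).erase k)
        (f := fun k => ‖F (ω ^ k * z)‖ * ‖F (conj (ω ^ k * z))‖) (g := fun _ => M * M)
        (fun _ _ => by positivity) (fun k _ => mul_le_mul (b1 k) (b2 k) (norm_nonneg _) hM0)
      simpa [Finset.prod_const, Finset.card_erase_of_mem hk] using this

lemma norm_exp_sub_exp_le {x y : ℂ} (hx : x.re ≤ 0) :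
    ‖Complex.exp x - Complex.exp y‖ ≤ |Real.exp x.re - Real.exp y.re| + |x.im - y.im| +
      |Real.exp x.re - Real.exp y.re| := by
  have e : ∀ z : ℂ, Complex.exp z = Real.exp z.re * Complex.exp (Complex.I * (z.im : ℝ)) := fun z => by
    rw [Complex.ofReal_exp, ← Complex.exp_add]
    congr 1
    rw [mul_comm Complex.I]
    exact (Complex.re_add_im z).symm
  have h1 : Complex.exp x - Complex.exp y = ((Real.exp x.re - Real.exp y.re : ℝ) : ℂ) *
      Complex.exp (Complex.I * (y.im : ℝ)) + Real.exp x.re * (Complex.exp (Complex.I * (y.im : ℝ)) *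
        (Complex.exp (Complex.I * ((x.im - y.im : ℝ) : ℂ)) - 1)) := by
    rw [mul_sub, ← Complex.exp_add, e x, e y]
    have : Complex.I * (y.im : ℝ) + Complex.I * ((x.im - y.im : ℝ) : ℂ) = Complex.I * (x.im : ℝ) := by
      push_cast; ring
    rw [this]
    push_cast
    ring
  have hn : ‖Complex.exp (Complex.I * (y.im : ℝ))‖ = 1 := by
    rw [mul_comm, Complex.norm_exp_ofReal_mul_I]
  rw [h1]
  refine (norm_add_le _ _).trans ?_
  rw [norm_mul, norm_mul, norm_mul, hn, Complex.norm_real, Complex.norm_real, mul_one, one_mul,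
    Real.norm_of_nonneg (Real.exp_pos _).le]
  have h2 := Real.norm_exp_I_mul_ofReal_sub_one_le (x := x.im - y.im)
  have h3 : Real.exp x.re ≤ 1 := Real.exp_le_one_iff.2 hx
  have h4 : Real.exp x.re * ‖Complex.exp (Complex.I * ((x.im - y.im : ℝ) : ℂ)) - 1‖ ≤ |x.im - y.im| := by
    calc _ ≤ 1 * ‖x.im - y.im‖ := by gcongr
      _ = _ := by rw [one_mul, Real.norm_eq_abs]
  rw [Real.norm_eq_abs]
  linarith [abs_nonneg (Real.exp x.re - Real.exp y.re)]

/-- Koebe's lemma: paths near the circle along which a bounded holomorphic function is small have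
close endpoints. -/
lemma exists_koebe_bounds {F : ℂ → ℂ} (hF : DifferentiableOn ℂ F (Metric.ball 0 1))
    {M : ℝ} (hM : ∀ z ∈ Metric.ball (0 : ℂ) 1, ‖F z‖ ≤ M) (h0 : F 0 ≠ 0) {η : ℝ} (hη : 0 < η) :
    ∃ ε > 0, ∃ δ > 0, δ < 1 ∧ ∀ c : ℝ → ℂ, ContinuousOn c (Icc 0 1) →
      (∀ t ∈ Icc (0 : ℝ) 1, 1 - δ < ‖c t‖ ∧ ‖c t‖ < 1 ∧ ‖F (c t)‖ ≤ ε) → ‖c 0 - c 1‖ < η := by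
  have hM0 : 0 ≤ M := (norm_nonneg _).trans (hM 0 (Metric.mem_ball_self one_pos))
  obtain ⟨N, hN⟩ := exists_nat_gt (Real.pi / (η / 4))
  have hNpos : (0 : ℝ) < N := lt_of_le_of_lt (by have := Real.pi_pos; positivity) hN
  have hN0 : 0 < N := by exact_mod_cast hNpos
  have hNη : Real.pi / N ≤ η / 4 := by
    rw [div_lt_iff₀ (by positivity)] at hN
    rw [div_le_iff₀ hNpos]
    linarith
  have hpos : 0 < (‖F 0‖ * ‖F 0‖) ^ N := by
    have := norm_pos_iff.2 h0
    positivity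
  set P := (‖F 0‖ * ‖F 0‖) ^ N
  set K := M * (M * M) ^ (N - 1)
  have hK : 0 ≤ K := by positivity
  have hε : 0 < P / (2 * (K + 1)) := by positivity
  refine ⟨P / (2 * (K + 1)), hε, min (1 / 2) (η / 4), by positivity,
    (min_le_left _ _).trans_lt (by norm_num), fun c hc hct => ?_⟩
  have key : ∀ l : ℝ → ℂ, ContinuousOn l (Icc 0 1) → (∀ t ∈ Icc (0 : ℝ) 1, (l t).re < 0 ∧
      ‖F (Complex.exp (l t))‖ ≤ P / (2 * (K + 1))) → (l 1).im - (l 0).im < Real.pi / N := by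
    intro l hl hlt
    by_contra! hcon
    let w : ℂ := Complex.exp (((l 0).im : ℂ) * Complex.I)
    have hw : ‖w‖ = 1 := Complex.norm_exp_ofReal_mul_I _
    have hwb : ∀ z ∈ Metric.ball (0 : ℂ) 1, w * z ∈ Metric.ball (0 : ℂ) 1 := fun z hz => by
      rw [mem_ball_zero_iff] at hz ⊢
      rwa [norm_mul, hw, one_mul]
    have := norm_pow_le_of_small_on_sector_path (F := fun z => F (w * z))
      (hF.comp (g := F) (by fun_prop) hwb) (fun z hz => hM _ (hwb z hz)) hN0
      (l := fun t => l t - ((l 0).im : ℂ) * Complex.I) (hl.sub continuousOn_const) (by simp)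
      (by simpa using hcon) (fun t ht => by simpa using (hlt t ht).1)
      (ε := P / (2 * (K + 1))) (fun t ht => by
        have e : w * Complex.exp (l t - ((l 0).im : ℂ) * Complex.I) = Complex.exp (l t) := by
          rw [← Complex.exp_add]; congr 1; ring
        rw [e]
        exact (hlt t ht).2)
    rw [mul_zero, mul_assoc] at this
    change P ≤ P / (2 * (K + 1)) * K at this
    have h2 : P / (2 * (K + 1)) * K < P := by
      rw [div_mul_eq_mul_div, div_lt_iff₀ (by positivity)]
      nlinarith
    linarith
  have hc0 : ∀ t ∈ Icc (0 : ℝ) 1, c t ≠ 0 := fun t ht h => by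
    have h1 := (hct t ht).1
    rw [h, norm_zero] at h1
    linarith [min_le_left (1 / 2) (η / 4)]
  obtain ⟨l, hl, hle⟩ := exists_log_of_convex (convex_Icc (0 : ℝ) 1) hc hc0
  have hre : ∀ t ∈ Icc (0 : ℝ) 1, Real.exp (l t).re = ‖c t‖ := fun t ht => by
    rw [← hle t ht, Complex.norm_exp]
  have hlt : ∀ t ∈ Icc (0 : ℝ) 1, (l t).re < 0 ∧
      ‖F (Complex.exp (l t))‖ ≤ P / (2 * (K + 1)) := fun t ht =>
    ⟨by rw [← Real.exp_lt_one_iff, hre t ht]; exact (hct t ht).2.1,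
      by rw [hle t ht]; exact (hct t ht).2.2⟩
  have h01 : (0 : ℝ) ∈ Icc (0 : ℝ) 1 := by simp
  have h11 : (1 : ℝ) ∈ Icc (0 : ℝ) 1 := by simp
  have k1 := key l hl hlt
  have k2 := key (fun t => l (1 - t)) (hl.comp (by fun_prop) fun t ht => ⟨by linarith [ht.2],
    by linarith [ht.1]⟩) fun t ht => hlt _ ⟨by linarith [ht.2], by linarith [ht.1]⟩
  simp only [sub_self, sub_zero] at k2
  have h3 := norm_exp_sub_exp_le (x := l 0) (y := l 1) (hlt 0 h01).1.le
  rw [hle 0 h01, hle 1 h11, hre 0 h01, hre 1 h11] at h3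
  have h4 : |(l 0).im - (l 1).im| ≤ η / 4 := by
    rw [abs_le]; constructor <;> linarith
  have h5 : |‖c 0‖ - ‖c 1‖| < η / 4 := by
    have a1 := hct 0 h01
    have a2 := hct 1 h11
    have := min_le_right (1 / 2) (η / 4)
    rw [abs_lt]; constructor <;> linarith
  linarith

/-- Near `x`, the pair `(D, Q)` looks like the closed and the open upper half plane. -/
def IsFlatAt {X : Type*} [TopologicalSpace X] (D Q : Set X) (x : X) : Prop :=
  ∃ e : ℝ × ℝ → X, IsOpenEmbedding e ∧ e 0 = x ∧ ∀ p, (e p ∈ D ↔ 0 ≤ p.2) ∧ (e p ∈ Q ↔ 0 < p.2)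

/-- A uniformization by the unit disc of the interior `Q` of a domain `D` with flat boundary. -/
structure IsUniformized (D Q : Set ℂ) (ψ χ : ℂ → ℂ) : Prop where
  isOpen : IsOpen Q
  subset : Q ⊆ D
  bdd : Bornology.IsBounded Q
  flat : ∀ x ∈ D \ Q, IsFlatAt D Q x
  diff : DifferentiableOn ℂ ψ Q
  diff_inv : DifferentiableOn ℂ χ (Metric.ball 0 1)
  mapsTo : MapsTo ψ Q (Metric.ball 0 1)
  mapsTo_inv : MapsTo χ (Metric.ball 0 1) Q
  leftInv : LeftInvOn χ ψ Q
  rightInv : LeftInvOn ψ χ (Metric.ball 0 1)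

lemma IsFlatAt.neBot {D Q : Set ℂ} {x : ℂ} (h : IsFlatAt D Q x) : (𝓝[Q] x).NeBot := by
  obtain ⟨e, he, h0, hDQ⟩ := h
  rw [← mem_closure_iff_nhdsWithin_neBot]
  have ht : Tendsto (fun t : ℝ => e (0, t)) (𝓝[>] 0) (𝓝 x) := by
    have : Continuous fun t : ℝ => e (0, t) := he.continuous.comp (by fun_prop)
    rw [← h0]
    exact (this.tendsto 0).mono_left nhdsWithin_le_nhds
  refine mem_closure_of_tendsto ht ?_
  filter_upwards [self_mem_nhdsWithin] with t ht
  exact (hDQ (0, t)).2.2 ht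

lemma IsUniformized.eventually_norm_gt {D Q : Set ℂ} {ψ χ : ℂ → ℂ} (h : IsUniformized D Q ψ χ)
    {x : ℂ} (hx : x ∉ Q) {δ : ℝ} (hδ : 0 < δ) : ∀ᶠ y in 𝓝[Q] x, 1 - δ < ‖ψ y‖ := by
  have hsub : Metric.closedBall (0 : ℂ) (1 - δ) ⊆ Metric.ball 0 1 :=
    Metric.closedBall_subset_ball (by linarith)
  have hK : IsCompact (χ '' Metric.closedBall 0 (1 - δ)) :=
    (isCompact_closedBall _ _).image_of_continuousOn (h.diff_inv.continuousOn.mono hsub)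
  have hxK : x ∉ χ '' Metric.closedBall 0 (1 - δ) := by
    rintro ⟨w, hw, rfl⟩
    exact hx (h.mapsTo_inv (hsub hw))
  filter_upwards [self_mem_nhdsWithin,
    nhdsWithin_le_nhds (hK.isClosed.isOpen_compl.mem_nhds hxK)] with y hy hyK
  by_contra! hcon
  exact hyK ⟨ψ y, mem_closedBall_zero_iff.2 hcon, h.leftInv hy⟩

lemma IsUniformized.exists_limit {D Q : Set ℂ} {ψ χ : ℂ → ℂ} (h : IsUniformized D Q ψ χ) {x : ℂ}
    (hx : x ∈ D \ Q) : ∃ ζ : ℂ, ‖ζ‖ = 1 ∧ Tendsto ψ (𝓝[Q] x) (𝓝 ζ) := by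
  have hflat := h.flat x hx
  have := hflat.neBot
  obtain ⟨e, he, h0, hDQ⟩ := hflat
  obtain ⟨R, hR⟩ := h.bdd.exists_norm_le
  have hcauchy : Cauchy (map ψ (𝓝[Q] x)) := by
    refine Metric.cauchy_iff.2 ⟨inferInstance, fun η hη => ?_⟩
    obtain ⟨ε, hε, δ, hδ, -, hc⟩ := exists_koebe_bounds (F := fun w => χ w - x)
      (h.diff_inv.sub_const x) (M := R + ‖x‖)
      (fun z hz => (norm_sub_le _ _).trans (by gcongr; exact hR _ (h.mapsTo_inv hz)))
      (fun hh => hx.2 (by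
        rw [← sub_eq_zero.1 hh]; exact h.mapsTo_inv (Metric.mem_ball_self one_pos))) hη
    have hev := (h.eventually_norm_gt hx.2 hδ).and
      (mem_nhdsWithin_of_mem_nhds (Metric.closedBall_mem_nhds x hε))
    rw [eventually_nhdsWithin_iff, ← h0] at hev
    obtain ⟨r, hr, hball⟩ := Metric.eventually_nhds_iff_ball.1
      ((he.continuous.tendsto 0).eventually hev)
    have hconv : Convex ℝ (Metric.ball (0 : ℝ × ℝ) r ∩ {p | 0 < p.2}) :=
      (convex_ball _ _).inter (convex_halfSpace_gt (f := Prod.snd) (by constructor <;> simp) 0)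
    refine ⟨ψ '' (e '' (Metric.ball 0 r ∩ {p | 0 < p.2})), ?_, ?_⟩
    · refine image_mem_map ?_
      filter_upwards [self_mem_nhdsWithin, nhdsWithin_le_nhds
        ((he.isOpenMap _ Metric.isOpen_ball).mem_nhds ⟨0, Metric.mem_ball_self hr, h0⟩)] with y hy hyb
      obtain ⟨p, hp, rfl⟩ := hyb
      exact ⟨p, ⟨hp, (hDQ p).2.1 hy⟩, rfl⟩
    · rintro _ ⟨_, ⟨p, hp, rfl⟩, rfl⟩ _ ⟨_, ⟨q, hq, rfl⟩, rfl⟩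
      have hm : ∀ t ∈ Icc (0 : ℝ) 1, AffineMap.lineMap p q t ∈
          Metric.ball (0 : ℝ × ℝ) r ∩ {p | 0 < p.2} := fun t ht => hconv.lineMap_mem hp hq ht
      have hmQ : ∀ t ∈ Icc (0 : ℝ) 1, e (AffineMap.lineMap p q t) ∈ Q := fun t ht =>
        (hDQ _).2.2 (hm t ht).2
      have := hc (fun t => ψ (e (AffineMap.lineMap p q t)))
        (h.diff.continuousOn.comp (he.continuous.comp AffineMap.lineMap_continuous).continuousOn hmQ)
        (fun t ht => by
          obtain ⟨a1, a2⟩ := hball _ (hm t ht).1 (hmQ t ht)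
          refine ⟨a1, mem_ball_zero_iff.1 (h.mapsTo (hmQ t ht)), ?_⟩
          rw [h.leftInv (hmQ t ht), ← mem_closedBall_iff_norm, ← h0]
          exact a2)
      simpa [dist_eq_norm] using this
  obtain ⟨ζ, hζ⟩ := CompleteSpace.complete hcauchy
  refine ⟨ζ, le_antisymm ?_ ?_, hζ⟩
  · refine le_of_tendsto (Tendsto.norm hζ) ?_
    filter_upwards [self_mem_nhdsWithin] with y hy
    exact (mem_ball_zero_iff.1 (h.mapsTo hy)).le
  · refine le_of_forall_pos_lt_add fun δ hδ => ?_
    have : 1 - δ / 2 ≤ ‖ζ‖ := by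
      refine ge_of_tendsto (Tendsto.norm hζ) ?_
      filter_upwards [h.eventually_norm_gt hx.2 (half_pos hδ)] with y hy using hy.le
    linarith

/-- A uniformization extended continuously to the boundary. -/
structure IsUniformizedBdry (D Q : Set ℂ) (ψ χ : ℂ → ℂ) : Prop extends IsUniformized D Q ψ χ where
  cont : ContinuousOn ψ D
  norm_bdry : ∀ x ∈ D \ Q, ‖ψ x‖ = 1

lemma IsUniformized.exists_extension {D Q : Set ℂ} {ψ χ : ℂ → ℂ} (h : IsUniformized D Q ψ χ) :
    ∃ Ψ, IsUniformizedBdry D Q Ψ χ := by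
  have hcl : D ⊆ closure Q := fun x hx => by
    by_cases hxQ : x ∈ Q
    · exact subset_closure hxQ
    · exact mem_closure_iff_nhdsWithin_neBot.2 (h.flat x ⟨hx, hxQ⟩).neBot
  have heq : EqOn (extendFrom Q ψ) ψ Q := fun y hy =>
    extendFrom_eq (subset_closure hy) (h.diff.continuousOn y hy)
  refine ⟨extendFrom Q ψ, ⟨⟨h.isOpen, h.subset, h.bdd, h.flat, h.diff.congr heq, h.diff_inv, ?_,
    h.mapsTo_inv, ?_, ?_⟩, ?_, ?_⟩⟩
  · exact h.mapsTo.congr heq.symm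
  · intro y hy
    rw [heq hy, h.leftInv hy]
  · intro w hw
    rw [heq (h.mapsTo_inv hw), h.rightInv hw]
  · refine continuousOn_extendFrom hcl fun x hx => ?_
    by_cases hxQ : x ∈ Q
    · exact ⟨_, h.diff.continuousOn x hxQ⟩
    · obtain ⟨ζ, -, hζ⟩ := h.exists_limit ⟨hx, hxQ⟩
      exact ⟨ζ, hζ⟩
  · intro x hx
    obtain ⟨ζ, h1, hζ⟩ := h.exists_limit hx
    rwa [extendFrom_eq (hcl hx.1) hζ]

lemma exists_rotation_close {N : ℕ} (hN : 0 < N) {v : ℂ} (hv : ‖v‖ = 1) :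
    ∃ k ∈ Finset.range N, ‖Complex.exp (2 * Real.pi * Complex.I / N) ^ k * v - 1‖ ≤ Real.pi / N := by
  have hNr : (0 : ℝ) < N := by exact_mod_cast hN
  have hNc : (N : ℂ) ≠ 0 := by exact_mod_cast hN.ne'
  have hNz : (0 : ℤ) < N := by exact_mod_cast hN
  have hpi := Real.pi_pos
  let j : ℤ := round (v.arg * N / (2 * Real.pi))
  have hk0 := Int.emod_nonneg (-j) hNz.ne'
  have hkl := Int.emod_lt_of_pos (-j) hNz
  refine ⟨((-j) % N).toNat, Finset.mem_range.2 (by omega), ?_⟩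
  have hvarg : v = Complex.exp (v.arg * Complex.I) := by
    conv_lhs => rw [← Complex.norm_mul_exp_arg_mul_I v, hv]
    simp
  have e2 : (-j) % N = -j - N * ((-j) / N) := by
    have := Int.emod_add_mul_ediv (-j) N
    linarith
  have e3 : Complex.exp (2 * Real.pi * Complex.I / N) ^ ((-j) % N).toNat * v =
      Complex.exp (Complex.I * ((v.arg - j * (2 * Real.pi) / N : ℝ) : ℂ)) := by
    have h1 : Complex.exp (2 * Real.pi * Complex.I / N) ^ ((-j) % N).toNat =
        Complex.exp (((-j) % N : ℤ) * (2 * Real.pi * Complex.I / N)) := by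
      rw [Complex.exp_int_mul, ← zpow_natCast, Int.toNat_of_nonneg hk0]
    rw [h1, e2]
    conv_lhs => rw [hvarg]
    rw [← Complex.exp_add, Complex.exp_eq_exp_iff_exists_int]
    refine ⟨-((-j) / N), ?_⟩
    push_cast
    field_simp
    ring
  rw [e3]
  refine Real.norm_exp_I_mul_ofReal_sub_one_le.trans ?_
  rw [Real.norm_eq_abs]
  have h4 : |v.arg * N / (2 * Real.pi) - j| ≤ 1 / 2 := abs_sub_round _
  have h5 : v.arg - j * (2 * Real.pi) / N = (v.arg * N / (2 * Real.pi) - j) * (2 * Real.pi / N) := by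
    field_simp
  rw [h5, abs_mul, abs_of_pos (show 0 < 2 * Real.pi / N by positivity)]
  calc _ ≤ 1 / 2 * (2 * Real.pi / N) := by gcongr
    _ = _ := by ring

/-- The boundary values of a uniformization are not constant along any boundary arc. -/
lemma IsUniformizedBdry.exists_ne {D Q : Set ℂ} {ψ χ : ℂ → ℂ} (h : IsUniformizedBdry D Q ψ χ)
    {e : ℝ × ℝ → ℂ} (he : IsOpenEmbedding e)
    (hDQ : ∀ p, (e p ∈ D ↔ 0 ≤ p.2) ∧ (e p ∈ Q ↔ 0 < p.2)) {a b : ℝ} (hab : a < b) (ζ : ℂ) :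
    ∃ s ∈ Ioo a b, ψ (e (s, 0)) ≠ ζ := by
  by_contra! hcon
  set m := (a + b) / 2 with hm
  have hmab : m ∈ Ioo a b := ⟨by linarith, by linarith⟩
  have hζ : ‖ζ‖ = 1 := by
    rw [← hcon m hmab]
    exact h.norm_bdry _ ⟨(hDQ _).1.2 le_rfl, fun hh => lt_irrefl _ ((hDQ _).2.1 hh)⟩
  set B : Set ℂ := e '' (Ioo a b ×ˢ univ) with hB
  have hBo : IsOpen B := he.isOpenMap _ (isOpen_Ioo.prod isOpen_univ)
  have hlow : IsOpen (e '' {p | p.2 < 0}) :=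
    he.isOpenMap _ (isOpen_lt continuous_snd continuous_const)
  have hlowQ : ∀ y ∈ e '' {p | p.2 < 0}, y ∉ Q := by
    rintro _ ⟨p, hp, rfl⟩ hh
    exact absurd ((hDQ p).2.1 hh) (not_lt.2 (le_of_lt hp))
  classical
  set H : ℂ → ℂ := fun y => if y ∈ Q then ψ y - ζ else 0 with hH
  have hHQ : ∀ y ∈ Q, H =ᶠ[𝓝 y] fun z => ψ z - ζ := fun y hy => by
    filter_upwards [h.isOpen.mem_nhds hy] with z hz
    simp [hH, hz]
  have hHd : ∀ y ∈ Q, DifferentiableAt ℂ H y := fun y hy =>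
    (((h.diff y hy).differentiableAt (h.isOpen.mem_nhds hy)).sub_const ζ).congr_of_eventuallyEq
      (hHQ y hy)
  have hHne : ∀ y, H y ≠ 0 → y ∈ Q := fun y hy => by
    by_contra hyQ
    exact hy (by simp [hH, hyQ])
  have hHc : ContinuousOn H B := by
    rintro y hyB
    by_cases hyQ : y ∈ Q
    · exact (hHd y hyQ).continuousAt.continuousWithinAt
    refine ContinuousAt.continuousWithinAt ?_
    have hHy : H y = 0 := by simp [hH, hyQ]
    obtain ⟨p, hp, rfl⟩ := hyB
    rw [ContinuousAt, hHy, Metric.tendsto_nhds]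
    intro ε hε
    have key : ∀ᶠ z in 𝓝 (e p), z ∈ Q → ‖ψ z - ζ‖ < ε := by
      rcases lt_or_ge p.2 0 with h0 | h0
      · filter_upwards [hlow.mem_nhds ⟨p, h0, rfl⟩] with z hz hzQ
        exact absurd hzQ (hlowQ z hz)
      · have hp0 : p.2 = 0 := le_antisymm (not_lt.1 fun hh => hyQ ((hDQ p).2.2 hh)) h0
        have hψ : ψ (e p) = ζ := by
          have := hcon p.1 hp.1
          rwa [← hp0] at this
        have := Metric.tendsto_nhds.1 (h.cont (e p) ((hDQ p).1.2 h0)) ε hε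
        rw [eventually_nhdsWithin_iff] at this
        filter_upwards [this] with z hz hzQ
        rw [← dist_eq_norm, ← hψ]
        exact hz (h.subset hzQ)
    filter_upwards [key] with z hz
    by_cases hzQ : z ∈ Q
    · simpa [hH, hzQ] using hz hzQ
    · simpa [hH, hzQ] using hε
  obtain ⟨R, hR, hRB⟩ := Metric.isOpen_iff.1 hBo (e (m, 0)) ⟨(m, 0), ⟨hmab, trivial⟩, rfl⟩
  have hR3 : 0 < R / 3 := by positivity
  have hev : ∀ᶠ t in 𝓝 (0 : ℝ), e (m, t) ∈ Metric.ball (e (m, 0)) (R / 3) := by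
    have : Continuous fun t : ℝ => e (m, t) := he.continuous.comp (by fun_prop)
    exact (this.tendsto 0).eventually (Metric.ball_mem_nhds _ hR3)
  obtain ⟨τ', hτ', hball⟩ := Metric.eventually_nhds_iff_ball.1 hev
  set τ := τ' / 2 with hτ
  have hτ0 : 0 < τ := by positivity
  set p := e (m, τ) with hp
  set u := e (m, -τ) with hu
  have hpb : p ∈ Metric.ball (e (m, 0)) (R / 3) := hball τ (by simp [abs_of_pos hτ0]; linarith)
  have hub : u ∈ Metric.ball (e (m, 0)) (R / 3) := hball (-τ) (by simp [abs_of_pos hτ0]; linarith)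
  have hpQ : p ∈ Q := (hDQ _).2.2 hτ0
  have hup : u ≠ p := fun hh => by
    have := he.injective hh
    simp only [Prod.mk.injEq, true_and] at this
    linarith
  set ρ := ‖u - p‖ with hρ
  have hρ0 : 0 < ρ := norm_pos_iff.2 (sub_ne_zero.2 hup)
  have hρR : ρ < 2 * (R / 3) := by
    have := dist_triangle_right u p (e (m, 0))
    rw [Metric.mem_ball] at hpb hub
    rw [hρ, ← dist_eq_norm]
    linarith
  have hcb : Metric.closedBall p ρ ⊆ B := fun z hz => hRB (by
    have := dist_triangle z p (e (m, 0))
    rw [Metric.mem_ball] at hpb ⊢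
    rw [Metric.mem_closedBall] at hz
    linarith)
  obtain ⟨κ, hκ, hκQ⟩ := Metric.isOpen_iff.1 hlow u ⟨(m, -τ), by simpa using hτ0, rfl⟩
  obtain ⟨N, hN⟩ := exists_nat_gt (ρ * Real.pi / κ)
  have hNr : (0 : ℝ) < N := lt_of_le_of_lt (by positivity) hN
  have hN0 : 0 < N := by exact_mod_cast hNr
  have hNκ : ρ * (Real.pi / N) < κ := by
    rw [div_lt_iff₀ hκ] at hN
    rw [← mul_div_assoc, div_lt_iff₀ hNr]
    linarith
  set ω := Complex.exp (2 * Real.pi * Complex.I / N) with hω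
  have hωn : ‖ω‖ = 1 := by
    have : (2 * Real.pi * Complex.I / N : ℂ) = ((2 * Real.pi / N : ℝ) : ℂ) * Complex.I := by
      push_cast; ring
    rw [hω, this, Complex.norm_exp_ofReal_mul_I]
  have hrot : ∀ k : ℕ, MapsTo (fun z => p + ω ^ k * (z - p)) (Metric.closedBall p ρ)
      (Metric.closedBall p ρ) := fun k z hz => by
    rw [mem_closedBall_iff_norm] at hz ⊢
    simpa [hωn] using hz
  set G : ℂ → ℂ := fun z => ∏ k ∈ Finset.range N, H (p + ω ^ k * (z - p)) with hG
  have hGc : ContinuousOn G (Metric.closedBall p ρ) := by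
    refine continuousOn_finsetProd _ fun k _ => ?_
    exact (hHc.mono hcb).comp (by fun_prop) (hrot k)
  have hGs : ∀ z, ‖z - p‖ = ρ → G z = 0 := fun z hz => by
    obtain ⟨k, hk, hkl⟩ := exists_rotation_close hN0 (v := (z - p) / (u - p))
      (by rw [norm_div, hz, hρ, div_self hρ0.ne'])
    refine Finset.prod_eq_zero hk ?_
    by_contra hne
    refine hlowQ _ (hκQ ?_) (hHne _ hne)
    rw [mem_ball_iff_norm]
    have e1 : p + ω ^ k * (z - p) - u = (u - p) * (ω ^ k * ((z - p) / (u - p)) - 1) := by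
      have := sub_ne_zero.2 hup
      field_simp
      ring
    rw [e1, norm_mul]
    exact (mul_le_mul_of_nonneg_left hkl hρ0.le).trans_lt hNκ
  set W : Set ℂ := Metric.ball p ρ ∩ G ⁻¹' {0}ᶜ with hW
  have hWo : IsOpen W := (hGc.mono Metric.ball_subset_closedBall).isOpen_inter_preimage
    Metric.isOpen_ball isOpen_compl_singleton
  have hWcl : closure W ⊆ Metric.closedBall p ρ :=
    closure_minimal (inter_subset_left.trans Metric.ball_subset_closedBall) Metric.isClosed_closedBall
  have hd : DiffContOnCl ℂ G W := by
    refine ⟨fun z hz => ?_, hGc.mono hWcl⟩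
    refine (DifferentiableAt.fun_finsetProd fun k hk => ?_).differentiableWithinAt
    have : H (p + ω ^ k * (z - p)) ≠ 0 := Finset.prod_ne_zero_iff.1 hz.2 k hk
    have haff : DifferentiableAt ℂ (fun w => p + ω ^ k * (w - p)) z := by fun_prop
    exact DifferentiableAt.comp (g := H) z (hHd _ (hHne _ this)) haff
  have hGp : G p = 0 := by
    by_contra hne
    have hpW : p ∈ W := ⟨Metric.mem_ball_self hρ0, hne⟩
    refine hne (norm_le_zero_iff.1 (Complex.norm_le_of_forall_mem_frontier_norm_le
      (Metric.isBounded_ball.subset inter_subset_left) hd (fun z hz => ?_) (subset_closure hpW)))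
    rw [hWo.frontier_eq] at hz
    rcases (mem_closedBall_iff_norm.1 (hWcl hz.1)).eq_or_lt with h1 | h1
    · rw [hGs z h1, norm_zero]
    · by_cases h2 : G z = 0
      · rw [h2, norm_zero]
      · exact absurd ⟨mem_ball_iff_norm.2 h1, h2⟩ hz.2
  rw [hG] at hGp
  obtain ⟨k, -, hk⟩ := Finset.prod_eq_zero_iff.1 hGp
  simp only [sub_self, mul_zero, add_zero] at hk
  have : ψ p = ζ := by simpa [hH, hpQ, sub_eq_zero] using hk
  have h1 := mem_ball_zero_iff.1 (h.mapsTo hpQ)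
  rw [this, hζ] at h1
  exact lt_irrefl _ h1

/-- `f` and `g` are mutually inverse homeomorphisms between the subsets `A` and `B`. -/
structure IsHomeoOn {X Y : Type*} [TopologicalSpace X] [TopologicalSpace Y] (f : X → Y) (g : Y → X)
    (A : Set X) (B : Set Y) : Prop where
  cont : ContinuousOn f A
  cont_inv : ContinuousOn g B
  mapsTo : MapsTo f A B
  mapsTo_inv : MapsTo g B A
  leftInv : LeftInvOn g f A
  rightInv : LeftInvOn f g B

namespace IsHomeoOn

variable {X Y Z : Type*} [TopologicalSpace X] [TopologicalSpace Y] [TopologicalSpace Z]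
  {f : X → Y} {g : Y → X} {A : Set X} {B : Set Y}

lemma symm (h : IsHomeoOn f g A B) : IsHomeoOn g f B A :=
  ⟨h.cont_inv, h.cont, h.mapsTo_inv, h.mapsTo, h.rightInv, h.leftInv⟩

lemma trans {f' : Y → Z} {g' : Z → Y} {C : Set Z} (h : IsHomeoOn f g A B)
    (h' : IsHomeoOn f' g' B C) : IsHomeoOn (f' ∘ f) (g ∘ g') A C where
  cont := h'.cont.comp h.cont h.mapsTo
  cont_inv := h.cont_inv.comp h'.cont_inv h'.mapsTo_inv
  mapsTo := h'.mapsTo.comp h.mapsTo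
  mapsTo_inv := h.mapsTo_inv.comp h'.mapsTo_inv
  leftInv x hx := by simp [h'.leftInv (h.mapsTo hx), h.leftInv hx]
  rightInv x hx := by simp [h.rightInv (h'.mapsTo_inv hx), h'.rightInv hx]

lemma injOn (h : IsHomeoOn f g A B) : InjOn f A := h.leftInv.injOn

end IsHomeoOn

lemma IsUniformizedBdry.exists_dist_lt_mem {D Q : Set ℂ} {ψ χ : ℂ → ℂ}
    (h : IsUniformizedBdry D Q ψ χ) {x : ℂ} (hx : x ∈ D \ Q) {W : Set ℂ} (hW : W ∈ 𝓝 x) :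
    ∃ δ > 0, ∀ w ∈ Metric.ball (0 : ℂ) 1, ‖w - ψ x‖ < δ → χ w ∈ W := by
  obtain ⟨e, he, h0, hDQ⟩ := h.flat x hx
  have hζ := h.norm_bdry x hx
  have hev : e ⁻¹' W ∈ 𝓝 (0 : ℝ × ℝ) := he.continuous.continuousAt (by rwa [h0])
  obtain ⟨r, hr, hrW⟩ := Metric.nhds_basis_closedBall.mem_iff.1 hev
  obtain ⟨r₁, hr₁, hn₁⟩ := h.exists_ne he hDQ hr (ψ x)
  obtain ⟨r₂, hr₂, hn₂⟩ := h.exists_ne he hDQ (neg_lt_zero.2 hr) (ψ x)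
  set s := r / 2 with hs
  have hs0 : 0 < s := by positivity
  set Bo : Set (ℝ × ℝ) := Ioo r₂ r₁ ×ˢ Ioo (-s) s with hBo
  set Bc : Set (ℝ × ℝ) := Icc r₂ r₁ ×ˢ Icc (-s) s with hBc
  have hBoc : Bo ⊆ Bc := prod_mono Ioo_subset_Icc_self Ioo_subset_Icc_self
  have hBoo : IsOpen (e '' Bo) := he.isOpenMap _ (isOpen_Ioo.prod isOpen_Ioo)
  have hBck : IsCompact Bc := isCompact_Icc.prod isCompact_Icc
  have h0Bo : (0 : ℝ × ℝ) ∈ Bo := ⟨⟨hr₂.2, hr₁.1⟩, ⟨by simpa using hs0, by simpa using hs0⟩⟩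
  have hBcW : e '' Bc ⊆ W := by
    rintro _ ⟨p, ⟨hp1, hp2⟩, rfl⟩
    refine hrW (mem_closedBall_zero_iff.2 (norm_prod_le_iff.2 ⟨abs_le.2 ?_, abs_le.2 ?_⟩))
    · exact ⟨by linarith [hr₂.1, hp1.1], by linarith [hr₁.2, hp1.2]⟩
    · exact ⟨by linarith [hp2.1], by linarith [hp2.2]⟩
  set Γ : Set (ℝ × ℝ) := (Bc \ Bo) ∩ {p | 0 ≤ p.2} with hΓ
  have hΓk : IsCompact Γ := (hBck.diff (isOpen_Ioo.prod isOpen_Ioo)).inter_right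
    (isClosed_le continuous_const continuous_snd)
  have hΓψ : IsCompact ((fun p => ψ (e p)) '' Γ) :=
    hΓk.image_of_continuousOn (h.cont.comp he.continuous.continuousOn fun p hp => (hDQ p).1.2 hp.2)
  have hζΓ : ψ x ∉ (fun p => ψ (e p)) '' Γ := by
    rintro ⟨p, ⟨⟨hp1, hp2⟩, hp3⟩, hp4⟩
    rcases (show (0 : ℝ) ≤ p.2 from hp3).eq_or_lt with h5 | h5
    · have h7 : p = (p.1, 0) := by rw [h5]
      by_cases h6 : p.1 = r₁
      · rw [h7, h6] at hp4; exact hn₁ hp4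
      by_cases h8 : p.1 = r₂
      · rw [h7, h8] at hp4; exact hn₂ hp4
      refine hp2 ⟨⟨lt_of_le_of_ne hp1.1.1 (Ne.symm h8), lt_of_le_of_ne hp1.1.2 h6⟩, ?_⟩
      rw [← h5]
      exact h0Bo.2
    · have := mem_ball_zero_iff.1 (h.mapsTo ((hDQ p).2.2 h5))
      simp only at hp4
      rw [hp4, hζ] at this
      exact lt_irrefl _ this
  obtain ⟨δ, hδ, hδΓ⟩ := Metric.isOpen_iff.1 hΓψ.isClosed.isOpen_compl _ hζΓ
  refine ⟨δ, hδ, ?_⟩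
  set N : Set ℂ := Metric.ball 0 1 ∩ Metric.ball (ψ x) δ with hN
  have hNp : IsPreconnected (χ '' N) :=
    ((convex_ball _ _).inter (convex_ball _ _)).isPreconnected.image _
      (h.diff_inv.continuousOn.mono inter_subset_left)
  have hsub : χ '' N ⊆ e '' Bo := by
    refine hNp.subset_left_of_subset_union hBoo (v := (e '' Bc)ᶜ)
      (hBck.image he.continuous).isClosed.isOpen_compl
      (disjoint_compl_right_iff_subset.2 (image_mono hBoc)) ?_ ?_
    · rintro _ ⟨w, hw, rfl⟩
      by_contra hcon
      rw [mem_union, not_or, mem_compl_iff, not_not] at hcon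
      obtain ⟨hc1, p, hp, hpw⟩ := hcon
      have hpQ : e p ∈ Q := by rw [hpw]; exact h.mapsTo_inv hw.1
      refine hδΓ hw.2 ⟨p, ⟨⟨hp, fun hh => hc1 ⟨p, hh, hpw⟩⟩, ((hDQ p).2.1 hpQ).le⟩, ?_⟩
      simp only
      rw [hpw, h.rightInv hw.1]
    · have := (h.flat x hx).neBot
      have h1 : ∀ᶠ y in 𝓝[Q] x, ψ y ∈ Metric.ball (ψ x) δ :=
        ((h.cont x hx.1).mono h.subset).eventually (Metric.ball_mem_nhds _ hδ)
      have h2 : ∀ᶠ y in 𝓝[Q] x, y ∈ e '' Bo :=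
        nhdsWithin_le_nhds (hBoo.mem_nhds ⟨0, h0Bo, h0⟩)
      obtain ⟨y, ⟨hy1, hy2⟩, hy3⟩ := ((h1.and h2).and self_mem_nhdsWithin).exists
      exact ⟨y, ⟨ψ y, ⟨h.mapsTo hy3, hy1⟩, h.leftInv hy3⟩, hy2⟩
  intro w hw hwδ
  exact hBcW (image_mono hBoc (hsub ⟨w, ⟨hw, mem_ball_iff_norm.2 hwδ⟩, rfl⟩))

/-- The boundary of a uniformized domain covers a relatively open subset of the circle. -/
lemma IsUniformizedBdry.exists_boundary_preimage {D Q : Set ℂ} {ψ χ : ℂ → ℂ}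
    (h : IsUniformizedBdry D Q ψ χ) {x : ℂ} (hx : x ∈ D \ Q) {W : Set ℂ} (hW : W ∈ 𝓝 x) :
    ∃ δ > 0, ∀ ζ : ℂ, ‖ζ‖ = 1 → ‖ζ - ψ x‖ < δ → ∃ y ∈ (D \ Q) ∩ W, ψ y = ζ := by
  obtain ⟨e, he, h0, hDQ⟩ := h.flat x hx
  have hev : e ⁻¹' W ∈ 𝓝 (0 : ℝ × ℝ) := he.continuous.continuousAt (by rwa [h0])
  obtain ⟨r, hr, hrW⟩ := Metric.nhds_basis_closedBall.mem_iff.1 hev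
  obtain ⟨δ, hδ, hδW⟩ := h.exists_dist_lt_mem hx ((he.isOpenMap _ Metric.isOpen_ball).mem_nhds
    ⟨0, Metric.mem_ball_self hr, h0⟩)
  refine ⟨δ, hδ, fun ζ hζ hζδ => ?_⟩
  have hK : IsCompact (e '' (Metric.closedBall 0 r ∩ {p | 0 ≤ p.2})) :=
    ((isCompact_closedBall _ _).inter_right
      (isClosed_le continuous_const continuous_snd)).image he.continuous
  have hcl : (𝓝[Metric.ball (0 : ℂ) 1] ζ).NeBot := by
    rw [← mem_closure_iff_nhdsWithin_neBot, closure_ball _ one_ne_zero]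
    simp [hζ]
  have h1 : ∀ᶠ w in 𝓝[Metric.ball (0 : ℂ) 1] ζ, χ w ∈ e '' (Metric.closedBall 0 r ∩ {p | 0 ≤ p.2}) := by
    have : ∀ᶠ w in 𝓝 ζ, ‖w - ψ x‖ < δ :=
      ((continuous_id.sub continuous_const).norm.tendsto ζ).eventually (gt_mem_nhds hζδ)
    filter_upwards [self_mem_nhdsWithin, nhdsWithin_le_nhds this] with w hw hwδ
    obtain ⟨p, hp, hpw⟩ := hδW w hw hwδ
    refine ⟨p, ⟨Metric.ball_subset_closedBall hp, ?_⟩, hpw⟩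
    exact ((hDQ p).2.1 (by rw [hpw]; exact h.mapsTo_inv hw)).le
  set U := Ultrafilter.of (𝓝[Metric.ball (0 : ℂ) 1] ζ) with hU
  have hUle : (U : Filter ℂ) ≤ 𝓝[Metric.ball (0 : ℂ) 1] ζ := Ultrafilter.of_le _
  obtain ⟨y, ⟨p, hp, rfl⟩, hy⟩ := hK.ultrafilter_le_nhds (U.map χ) (by
    rw [le_principal_iff]; exact hUle h1)
  have hyD : e p ∈ D := (hDQ p).1.2 hp.2
  have hUb : ∀ᶠ w in (U : Filter ℂ), w ∈ Metric.ball (0 : ℂ) 1 := hUle self_mem_nhdsWithin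
  have ht : Tendsto χ U (𝓝[D] (e p)) := tendsto_nhdsWithin_iff.2 ⟨hy, by
    filter_upwards [hUb] with w hw using h.subset (h.mapsTo_inv hw)⟩
  have ht2 : Tendsto (fun w => ψ (χ w)) U (𝓝 (ψ (e p))) := Tendsto.comp (h.cont _ hyD) ht
  have ht3 : Tendsto (fun w => ψ (χ w)) U (𝓝 ζ) := by
    refine Tendsto.congr' (f₁ := id) ?_ (hUle.trans nhdsWithin_le_nhds)
    filter_upwards [hUb] with w hw using (h.rightInv hw).symm
  have heq := tendsto_nhds_unique ht2 ht3
  refine ⟨e p, ⟨⟨hyD, fun hQ => ?_⟩, hrW hp.1⟩, heq⟩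
  have := mem_ball_zero_iff.1 (h.mapsTo hQ)
  rw [heq, hζ] at this
  exact lt_irrefl _ this

lemma IsUniformizedBdry.exists_isHomeoOn {D Q : Set ℂ} {ψ χ : ℂ → ℂ}
    (h : IsUniformizedBdry D Q ψ χ) :
    ∃ g, IsHomeoOn ψ g D (Metric.ball 0 1 ∪ ψ '' (D \ Q)) := by
  have hlim : ∀ x ∈ D \ Q, Tendsto χ (𝓝[Metric.ball 0 1] (ψ x)) (𝓝 x) := fun x hx W hW => by
    obtain ⟨δ, hδ, hδW⟩ := h.exists_dist_lt_mem hx hW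
    rw [mem_map]
    filter_upwards [self_mem_nhdsWithin,
      nhdsWithin_le_nhds (Metric.ball_mem_nhds (ψ x) hδ)] with w hw hwδ
    exact hδW w hw (mem_ball_iff_norm.1 hwδ)
  have hcl : Metric.ball 0 1 ∪ ψ '' (D \ Q) ⊆ closure (Metric.ball (0 : ℂ) 1) := by
    rintro w (hw | ⟨x, hx, rfl⟩)
    · exact subset_closure hw
    · rw [closure_ball _ one_ne_zero]
      simp [h.norm_bdry x hx]
  have hin : EqOn (extendFrom (Metric.ball 0 1) χ) χ (Metric.ball 0 1) := fun w hw =>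
    extendFrom_eq (subset_closure hw) (h.diff_inv.continuousOn w hw)
  have hbd : ∀ x ∈ D \ Q, extendFrom (Metric.ball 0 1) χ (ψ x) = x := fun x hx =>
    extendFrom_eq (hcl (Or.inr ⟨x, hx, rfl⟩)) (hlim x hx)
  refine ⟨extendFrom (Metric.ball 0 1) χ, h.cont, ?_, ?_, ?_, ?_, ?_⟩
  · refine continuousOn_extendFrom hcl ?_
    rintro w (hw | ⟨x, hx, rfl⟩)
    · exact ⟨_, h.diff_inv.continuousOn w hw⟩
    · exact ⟨_, hlim x hx⟩
  · intro x hx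
    by_cases hxQ : x ∈ Q
    · exact Or.inl (h.mapsTo hxQ)
    · exact Or.inr ⟨x, ⟨hx, hxQ⟩, rfl⟩
  · rintro w (hw | ⟨x, hx, rfl⟩)
    · rw [hin hw]; exact h.subset (h.mapsTo_inv hw)
    · rw [hbd x hx]; exact hx.1
  · intro x hx
    by_cases hxQ : x ∈ Q
    · rw [hin (h.mapsTo hxQ), h.leftInv hxQ]
    · exact hbd x ⟨hx, hxQ⟩
  · rintro w (hw | ⟨x, hx, rfl⟩)
    · rw [hin hw, h.rightInv hw]
    · rw [hbd x hx]

/-- A disc model of a plane domain with flat boundary. -/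
structure IsDiscModel {X : Type*} [TopologicalSpace X] (D Q : Set X) (ψ : X → ℂ) (g : ℂ → X) :
    Prop where
  homeo : IsHomeoOn ψ g D (Metric.ball 0 1 ∪ ψ '' (D \ Q))
  mapsTo : MapsTo ψ Q (Metric.ball 0 1)
  norm_bdry : ∀ x ∈ D \ Q, ‖ψ x‖ = 1
  exists_preimage : ∀ x ∈ D \ Q, ∀ W ∈ 𝓝 x, ∃ δ > 0, ∀ ζ : ℂ, ‖ζ‖ = 1 → ‖ζ - ψ x‖ < δ →
    ∃ y ∈ (D \ Q) ∩ W, ψ y = ζ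

lemma exists_isDiscModel_of_isBounded {D Q : Set ℂ} (hole : HoleFree Q) (hQ : IsOpen Q)
    (hQc : IsConnected Q) (hbd : Bornology.IsBounded Q) (hQD : Q ⊆ D)
    (hflat : ∀ x ∈ D \ Q, IsFlatAt D Q x) : ∃ ψ g, IsDiscModel D Q ψ g := by
  obtain ⟨p, hp⟩ := hQc.nonempty
  obtain ⟨ψ, χ, h1, h2, h3, h4, h5, h6⟩ := hole.exists_riemann_map hQ hQc hbd hp
  obtain ⟨Ψ, h⟩ := (IsUniformized.mk hQ hQD hbd hflat h1 h2 h3 h4 h5 h6).exists_extension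
  obtain ⟨g, hg⟩ := h.exists_isHomeoOn
  exact ⟨Ψ, g, hg, h.mapsTo, h.norm_bdry, fun x hx W hW => h.exists_boundary_preimage hx hW⟩

lemma HoleFree.image_of_isOpenEmbedding {Q : Set ℂ} (hole : HoleFree Q) {τ : ℂ → ℂ}
    (hτ : IsOpenEmbedding τ) {R : ℝ} (hR : range τ = Metric.ball 0 R) : HoleFree (τ '' Q) := by
  intro X hX hd hO
  have hXb : X ⊆ range τ := by
    rw [hR]
    exact HoleFree.subset_ball (hR ▸ image_subset_range τ Q) hX hO
  have := hole (τ ⁻¹' X) (hτ.isInducing.isCompact_preimage_iff hXb |>.2 hX) ?_ ?_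
  · rw [← image_preimage_eq_of_subset hXb, this, image_empty]
  · exact Set.disjoint_left.2 fun z hz hzQ => Set.disjoint_left.1 hd hz ⟨z, hzQ, rfl⟩
  · have := hO.preimage hτ.continuous
    rwa [preimage_union, preimage_image_eq _ hτ.injective] at this

lemma IsFlatAt.image {X Y : Type*} [TopologicalSpace X] [TopologicalSpace Y] {D Q : Set X} {x : X}
    (h : IsFlatAt D Q x) {τ : X → Y} (hτ : IsOpenEmbedding τ) :
    IsFlatAt (τ '' D) (τ '' Q) (τ x) := by
  obtain ⟨e, he, h0, hDQ⟩ := h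
  refine ⟨τ ∘ e, hτ.comp he, congrArg τ h0, fun p => ?_⟩
  simp only [Function.comp_apply, hτ.injective.mem_set_image]
  exact hDQ p

lemma IsDiscModel.comp {X Y : Type*} [TopologicalSpace X] [TopologicalSpace Y] {D Q : Set X}
    {τ : X → Y} {τ' : Y → X} {ψ : Y → ℂ} {g : ℂ → Y} (h : IsDiscModel (τ '' D) (τ '' Q) ψ g)
    (hτ : IsOpenEmbedding τ) (hτ' : ContinuousOn τ' (range τ)) (hl : Function.LeftInverse τ' τ) :
    IsDiscModel D Q (ψ ∘ τ) (τ' ∘ g) := by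
  have hDQ : τ '' D \ τ '' Q = τ '' (D \ Q) := (image_sdiff hτ.injective D Q).symm
  have hh : IsHomeoOn τ τ' D (τ '' D) :=
    ⟨hτ.continuous.continuousOn, hτ'.mono (image_subset_range _ _), mapsTo_image _ _,
      by rintro _ ⟨x, hx, rfl⟩; rwa [hl], fun x _ => hl x, by rintro _ ⟨x, hx, rfl⟩; rw [hl]⟩
  refine ⟨?_, fun x hx => h.mapsTo ⟨x, hx, rfl⟩, fun x hx => ?_, fun x hx W hW => ?_⟩
  · rw [image_comp, ← hDQ]
    exact hh.trans h.homeo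
  · exact h.norm_bdry _ (hDQ ▸ ⟨x, hx, rfl⟩)
  · obtain ⟨δ, hδ, H⟩ := h.exists_preimage (τ x) (hDQ ▸ ⟨x, hx, rfl⟩) (τ '' W)
      (hτ.image_mem_nhds.2 hW)
    refine ⟨δ, hδ, fun ζ h1 h2 => ?_⟩
    obtain ⟨_, ⟨hy1, y, hy2, rfl⟩, hy3⟩ := H ζ h1 h2
    rw [hDQ] at hy1
    exact ⟨y, ⟨hτ.injective.mem_set_image.1 hy1, hy2⟩, hy3⟩

lemma exists_isDiscModel {D Q : Set (ℝ × ℝ)} (hole : HoleFree (toCplx '' Q)) (hQ : IsOpen Q)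
    (hQc : IsConnected Q) (hQD : Q ⊆ D) (hflat : ∀ x ∈ D \ Q, IsFlatAt D Q x) :
    ∃ ψ g, IsDiscModel D Q ψ g := by
  let u := OpenPartialHomeomorph.univUnitBall (E := ℂ)
  have hu : IsOpenEmbedding u := u.isOpenEmbedding rfl
  have hr : range u = Metric.ball 0 1 := by
    rw [← image_univ]
    exact u.image_source_eq_target
  have hlu : ∀ z, u.symm (u z) = z := fun z => u.left_inv (mem_univ z)
  have ht : IsOpenEmbedding toCplx := toCplx.toHomeomorph.isOpenEmbedding
  have h1 : HoleFree (u '' (toCplx '' Q)) := hole.image_of_isOpenEmbedding hu hr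
  have hτ : IsOpenEmbedding (u ∘ toCplx) := hu.comp ht
  rw [← image_comp] at h1
  obtain ⟨ψ, g, h⟩ := exists_isDiscModel_of_isBounded (D := (u ∘ toCplx) '' D) h1
    (hτ.isOpenMap _ hQ) (hQc.image _ hτ.continuous.continuousOn)
    (Metric.isBounded_ball.subset (hr ▸ (image_subset_range _ _).trans (range_comp_subset_range _ _)))
    (image_mono hQD) (by
      rw [← image_sdiff hτ.injective]
      rintro _ ⟨x, hx, rfl⟩
      exact (hflat x hx).image hτ)
  refine ⟨_, _, h.comp (τ' := toCplx.symm ∘ u.symm) hτ ?_ fun z => by simp [hlu]⟩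
  refine toCplx.symm.continuous.comp_continuousOn (u.continuousOn_symm.mono ?_)
  exact (range_comp_subset_range _ _).trans hr.le

/-- A fibrewise strictly increasing continuous map is a homeomorphism onto its image. -/
lemma isHomeoOn_fiberwise {F : ℝ × ℝ → ℝ} (hF : Continuous F) {A : Set ℝ}
    (hmono : ∀ t ∈ A, StrictMono fun x => F (t, x)) :
    ∃ g : ℝ × ℝ → ℝ × ℝ, IsHomeoOn (fun p => (p.1, F p)) g (A ×ˢ univ)
      ((fun p => (p.1, F p)) '' (A ×ˢ univ)) := by
  set f : ℝ × ℝ → ℝ × ℝ := fun p => (p.1, F p) with hf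
  have hinj : InjOn f (A ×ˢ univ) := by
    rintro ⟨t, x⟩ hp ⟨t', x'⟩ hq h
    simp only [hf, Prod.mk.injEq] at h
    obtain ⟨rfl, h2⟩ := h
    rw [(hmono t hp.1).injective h2]
  have hl : LeftInvOn (Function.invFunOn f (A ×ˢ univ)) f (A ×ˢ univ) :=
    hinj.leftInvOn_invFunOn
  refine ⟨Function.invFunOn f (A ×ˢ univ), by fun_prop, ?_, mapsTo_image _ _, ?_, hl, ?_⟩
  · rintro _ ⟨⟨t, x⟩, hp, rfl⟩
    rw [ContinuousWithinAt, hl hp]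
    have key : ∀ ε > 0, ∀ᶠ q in 𝓝[f '' (A ×ˢ univ)] (f (t, x)),
        |(Function.invFunOn f (A ×ˢ univ) q).2 - x| < ε := by
      intro ε hε
      have h1 : ∀ᶠ q : ℝ × ℝ in 𝓝 (f (t, x)), F (q.1, x - ε) < q.2 :=
        (isOpen_lt (by fun_prop) continuous_snd).mem_nhds
          (hmono t hp.1 (show x - ε < x by linarith))
      have h2 : ∀ᶠ q : ℝ × ℝ in 𝓝 (f (t, x)), q.2 < F (q.1, x + ε) :=
        (isOpen_lt continuous_snd (by fun_prop)).mem_nhds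
          (hmono t hp.1 (show x < x + ε by linarith))
      filter_upwards [self_mem_nhdsWithin, nhdsWithin_le_nhds h1, nhdsWithin_le_nhds h2]
      rintro _ ⟨⟨s, y⟩, hq, rfl⟩ h3 h4
      rw [hl hq, abs_lt]
      have h5 := (hmono s hq.1).lt_iff_lt.1 h3
      have h6 := (hmono s hq.1).lt_iff_lt.1 h4
      constructor <;> linarith
    have e1 : Tendsto (fun q => (Function.invFunOn f (A ×ˢ univ) q).1)
        (𝓝[f '' (A ×ˢ univ)] (f (t, x))) (𝓝 t) := by
      refine Tendsto.congr' (f₁ := fun q : ℝ × ℝ => q.1) ?_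
        ((continuous_fst.tendsto (f (t, x))).mono_left nhdsWithin_le_nhds)
      filter_upwards [self_mem_nhdsWithin]
      rintro _ ⟨p, hp, rfl⟩
      rw [hl hp]
    exact e1.prodMk_nhds (Metric.tendsto_nhds.2 key)
  · rintro _ ⟨p, hp, rfl⟩
    rwa [hl hp]
  · rintro _ ⟨p, hp, rfl⟩
    rw [hl hp]

/-- Every nonempty open interval is an increasing homeomorphic image of the real line. -/
lemma exists_strictMono_range_eq {J : Set ℝ} (hJo : IsOpen J) (hJc : IsPreconnected J)
    (hJn : J.Nonempty) : ∃ k : ℝ → ℝ, Continuous k ∧ StrictMono k ∧ range k = J := by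
  have hpi := Real.pi_pos
  set S := Real.arctan '' J with hS
  have hSo : IsOpen S := by
    have : S = Ioo (-(Real.pi / 2)) (Real.pi / 2) ∩ Real.tan ⁻¹' J := by
      ext y
      constructor
      · rintro ⟨x, hx, rfl⟩
        exact ⟨⟨Real.neg_pi_div_two_lt_arctan x, Real.arctan_lt_pi_div_two x⟩, by
          simpa [Real.tan_arctan] using hx⟩
      · rintro ⟨hy, hy2⟩
        exact ⟨_, hy2, Real.arctan_tan hy.1 hy.2⟩
    rw [this]
    exact Real.continuousOn_tan_Ioo.isOpen_inter_preimage isOpen_Ioo hJo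
  have hSc : IsPreconnected S := hJc.image _ Real.continuous_arctan.continuousOn
  have hSb : BddBelow S := ⟨-(Real.pi / 2), by
    rintro _ ⟨x, -, rfl⟩; exact (Real.neg_pi_div_two_lt_arctan x).le⟩
  have hSa : BddAbove S := ⟨Real.pi / 2, by
    rintro _ ⟨x, -, rfl⟩; exact (Real.arctan_lt_pi_div_two x).le⟩
  have hSn : S.Nonempty := hJn.image _
  set a := sInf S with ha
  set b := sSup S with hb
  have hS2 : S = Ioo a b := by
    refine Subset.antisymm (fun y hy => ⟨?_, ?_⟩) (IsConnected.Ioo_csInf_csSup_subset ⟨hJn.image _, hSc⟩ hSb hSa)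
    · obtain ⟨z, hz, hzS⟩ := ((show ∀ᶠ z in 𝓝[<] y, z ∈ S from
        nhdsWithin_le_nhds (hSo.mem_nhds hy)).and self_mem_nhdsWithin).exists
      exact (csInf_le hSb hz).trans_lt hzS
    · obtain ⟨z, hz, hzS⟩ := ((show ∀ᶠ z in 𝓝[>] y, z ∈ S from
        nhdsWithin_le_nhds (hSo.mem_nhds hy)).and self_mem_nhdsWithin).exists
      exact lt_of_lt_of_le hzS (le_csSup hSa hz)
  have hab : a < b := by
    obtain ⟨y, hy⟩ := hSn
    rw [hS2] at hy
    exact hy.1.trans hy.2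
  set m : ℝ → ℝ := fun x => a + (b - a) * (Real.arctan x / Real.pi + 1 / 2) with hm
  have hmS : ∀ x, m x ∈ S := fun x => by
    rw [hS2]
    have h1 := Real.neg_pi_div_two_lt_arctan x
    have h2 := Real.arctan_lt_pi_div_two x
    have h3 : 0 < Real.arctan x / Real.pi + 1 / 2 := by
      have : 0 < (Real.arctan x + Real.pi / 2) / Real.pi := by apply div_pos <;> linarith
      convert this using 1; field_simp
    have h4 : Real.arctan x / Real.pi + 1 / 2 < 1 := by
      have : Real.arctan x / Real.pi < 1 / 2 := by rw [div_lt_iff₀ hpi]; linarith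
      linarith
    constructor <;> simp only [hm] <;> nlinarith
  have hmm : StrictMono m := fun x y hxy => by
    have := Real.arctan_strictMono hxy
    have : Real.arctan x / Real.pi < Real.arctan y / Real.pi := by gcongr
    simp only [hm]
    have : 0 < b - a := by linarith
    gcongr
  have hSI : S ⊆ Ioo (-(Real.pi / 2)) (Real.pi / 2) := by
    rintro _ ⟨x, -, rfl⟩
    exact ⟨Real.neg_pi_div_two_lt_arctan x, Real.arctan_lt_pi_div_two x⟩
  have hmc : Continuous m := by
    have := Real.continuous_arctan
    fun_prop
  refine ⟨fun x => Real.tan (m x), ?_, fun x y hxy => ?_, ?_⟩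
  · exact Real.continuousOn_tan_Ioo.comp_continuous hmc fun x => hSI (hmS x)
  · exact Real.strictMonoOn_tan (hSI (hmS x)) (hSI (hmS y)) (hmm hxy)
  · refine Subset.antisymm ?_ fun y hy => ?_
    · rintro _ ⟨x, rfl⟩
      obtain ⟨y, hy, hyx⟩ := hmS x
      simp only [← hyx, Real.tan_arctan]
      exact hy
    · have hyS : Real.arctan y ∈ S := ⟨y, hy, rfl⟩
      set r := (Real.arctan y - a) / (b - a) with hr
      have hba : 0 < b - a := by linarith
      rw [hS2] at hyS
      have hr0 : 0 < r := div_pos (by linarith [hyS.1]) hba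
      have hr1 : r < 1 := by rw [hr, div_lt_one hba]; linarith [hyS.2]
      refine ⟨Real.tan (Real.pi * (r - 1 / 2)), ?_⟩
      have : m (Real.tan (Real.pi * (r - 1 / 2))) = Real.arctan y := by
        simp only [hm]
        rw [Real.arctan_tan (by nlinarith) (by nlinarith), hr]
        field_simp
        ring
      simp only [this, Real.tan_arctan]

/-- The closed strip minus some boundary arcs is homeomorphic to the closed strip, fibrewise. -/
lemma exists_isHomeoOn_strip {J₀ J₁ : Set ℝ} (h₀o : IsOpen J₀) (h₀c : IsPreconnected J₀)
    (h₀n : J₀.Nonempty) (h₁o : IsOpen J₁) (h₁c : IsPreconnected J₁) (h₁n : J₁.Nonempty) :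
    ∃ f g : ℝ × ℝ → ℝ × ℝ, (∀ p, (g p).1 = p.1) ∧
      IsHomeoOn f g {p | p.1 ∈ Icc (0 : ℝ) 1 ∧ (p.1 = 0 → p.2 ∈ J₀) ∧ (p.1 = 1 → p.2 ∈ J₁)}
        (Icc 0 1 ×ˢ univ) := by
  obtain ⟨k₀, hk₀, hm₀, hr₀⟩ := exists_strictMono_range_eq h₀o h₀c h₀n
  obtain ⟨k₁, hk₁, hm₁, hr₁⟩ := exists_strictMono_range_eq h₁o h₁c h₁n
  set F : ℝ × ℝ → ℝ := fun p => (1 - p.1) * k₀ p.2 + p.1 * k₁ p.2 + p.1 * (1 - p.1) * p.2 with hF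
  have hFc : Continuous F := by fun_prop
  have hmono : ∀ t ∈ Icc (0 : ℝ) 1, StrictMono fun x => F (t, x) := by
    intro t ht x y hxy
    have h0 := hm₀ hxy
    have h1 := hm₁ hxy
    simp only [hF]
    rcases ht.1.eq_or_lt with h | h
    · rw [← h]; linarith
    · have h2 : (1 - t) * k₀ x ≤ (1 - t) * k₀ y :=
        mul_le_mul_of_nonneg_left h0.le (by linarith [ht.2])
      have h3 : t * k₁ x < t * k₁ y := mul_lt_mul_of_pos_left h1 h
      have h4 : t * (1 - t) * x ≤ t * (1 - t) * y :=
        mul_le_mul_of_nonneg_left hxy.le (mul_nonneg h.le (by linarith [ht.2]))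
      linarith
  obtain ⟨g, hg⟩ := isHomeoOn_fiberwise hFc hmono
  refine ⟨g, fun p => (p.1, F p), fun p => rfl, ?_⟩
  suffices heq : {p : ℝ × ℝ | p.1 ∈ Icc (0 : ℝ) 1 ∧ (p.1 = 0 → p.2 ∈ J₀) ∧ (p.1 = 1 → p.2 ∈ J₁)} =
      (fun p => (p.1, F p)) '' Icc 0 1 ×ˢ univ by
    rw [heq]
    exact hg.symm
  ext ⟨t, y⟩
  constructor
  · rintro ⟨ht, h0, h1⟩
    simp only at ht h0 h1
    suffices ∃ x, F (t, x) = y by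
      obtain ⟨x, hx⟩ := this
      exact ⟨(t, x), ⟨ht, trivial⟩, by simp [hx]⟩
    rcases ht.1.eq_or_lt with h2 | h2
    · obtain ⟨x, hx⟩ := hr₀.ge (h0 h2.symm)
      exact ⟨x, by simp [hF, ← h2, hx]⟩
    rcases ht.2.eq_or_lt with h3 | h3
    · obtain ⟨x, hx⟩ := hr₁.ge (h1 h3)
      exact ⟨x, by simp [hF, h3, hx]⟩
    have hc : 0 < t * (1 - t) := mul_pos h2 (by linarith)
    have hcont : Continuous fun x => F (t, x) := by fun_prop
    have hmon : Monotone fun x => (1 - t) * k₀ x + t * k₁ x := fun x x' hxx => by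
      have e0 := hm₀.monotone hxx
      have e1 := hm₁.monotone hxx
      have : 0 ≤ 1 - t := by linarith
      simp only
      gcongr
    have htop : Tendsto (fun x => F (t, x)) atTop atTop := by
      refine tendsto_atTop_mono' _ (f₁ := fun x => (1 - t) * k₀ 0 + t * k₁ 0 + t * (1 - t) * x) ?_ ?_
      · filter_upwards [eventually_ge_atTop 0] with x hx
        have := hmon hx
        simp only at this
        simp only [hF]
        linarith
      · exact tendsto_atTop_add_const_left _ _ (tendsto_id.const_mul_atTop hc)
    have hbot : Tendsto (fun x => F (t, x)) atBot atBot := by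
      refine tendsto_atBot_mono' _ (f₁ := fun x => (1 - t) * k₀ 0 + t * k₁ 0 + t * (1 - t) * x) ?_ ?_
      · filter_upwards [eventually_le_atBot 0] with x hx
        have := hmon hx
        simp only at this
        simp only [hF]
        linarith
      · exact tendsto_atBot_add_const_left _ _ (tendsto_id.const_mul_atBot hc)
    exact hcont.surjective htop hbot y
  · rintro ⟨⟨s, x⟩, ⟨hs, -⟩, hp⟩
    simp only [Prod.mk.injEq] at hp
    obtain ⟨rfl, rfl⟩ := hp
    refine ⟨hs, fun h => ?_, fun h => ?_⟩
    · simp only at h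
      simp only [hF, h, ← hr₀]
      exact ⟨x, by ring⟩
    · simp only at h
      simp only [hF, h, ← hr₁]
      exact ⟨x, by ring⟩

lemma IsHomeoOn.restrict {X Y : Type*} [TopologicalSpace X] [TopologicalSpace Y] {f : X → Y}
    {g : Y → X} {A A' : Set X} {B B' : Set Y} (h : IsHomeoOn f g A B) (hA : A' ⊆ A) (hB : B' ⊆ B)
    (hf : MapsTo f A' B') (hg : MapsTo g B' A') : IsHomeoOn f g A' B' :=
  ⟨h.cont.mono hA, h.cont_inv.mono hB, hf, hg, h.leftInv.mono hA, h.rightInv.mono hB⟩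

/-- The Cayley transform sending `a` to infinity and the unit disc to the right half plane. -/
noncomputable def cayley (a z : ℂ) : ℂ := (a + z) / (a - z)

/-- The inverse of `cayley a`. -/
noncomputable def cayleyInv (a w : ℂ) : ℂ := a * (w - 1) / (w + 1)

lemma cayley_re {a : ℂ} (ha : ‖a‖ = 1) (z : ℂ) :
    (cayley a z).re = (1 - ‖z‖ ^ 2) / ‖a - z‖ ^ 2 := by
  have h1 : a.re * a.re + a.im * a.im = 1 := by
    rw [← Complex.normSq_apply, Complex.normSq_eq_norm_sq, ha, one_pow]
  rw [cayley, Complex.div_re, ← Complex.normSq_eq_norm_sq, ← Complex.normSq_eq_norm_sq, ← add_div]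
  congr 1
  simp only [Complex.add_re, Complex.sub_re, Complex.add_im, Complex.sub_im, Complex.normSq_apply]
  linarith

lemma isHomeoOn_cayley {a : ℂ} (ha : ‖a‖ = 1) :
    IsHomeoOn (cayley a) (cayleyInv a) (Metric.closedBall 0 1 \ {a}) {w | 0 ≤ w.re} := by
  have ha0 : a ≠ 0 := fun h => by simp [h] at ha
  have hne : ∀ w : ℂ, 0 ≤ w.re → w + 1 ≠ 0 := fun w hw h => by
    have := congrArg Complex.re h
    simp at this
    linarith
  have hR : LeftInvOn (cayley a) (cayleyInv a) {w | 0 ≤ w.re} := fun w hw => by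
    have := hne w hw
    rw [cayley, cayleyInv]
    have h2 : a - a * (w - 1) / (w + 1) = 2 * a / (w + 1) := by field_simp; ring
    have h3 : a + a * (w - 1) / (w + 1) = 2 * a * w / (w + 1) := by field_simp; ring
    rw [h2, h3]
    field_simp
  refine ⟨?_, ?_, fun z hz => ?_, fun w hw => ?_, fun z hz => ?_, hR⟩
  · refine ContinuousOn.div (by fun_prop) (by fun_prop) fun z hz => ?_
    exact sub_ne_zero.2 (Ne.symm hz.2)
  · exact ContinuousOn.div (by fun_prop) (by fun_prop) fun w hw => hne w hw
  · have : ‖z‖ ≤ 1 := mem_closedBall_zero_iff.1 hz.1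
    rw [mem_ofPred_eq, cayley_re ha]
    have : ‖z‖ ^ 2 ≤ 1 := pow_le_one₀ (norm_nonneg _) this
    apply div_nonneg <;> nlinarith
  · have hne' : cayleyInv a w ≠ a := fun h => by
      have h1 := hne w hw
      rw [cayleyInv, div_eq_iff h1] at h
      have := mul_left_cancel₀ ha0 h
      have := congrArg Complex.re this
      simp at this
      linarith
    refine ⟨?_, hne'⟩
    have h2 : (cayley a (cayleyInv a w)).re = w.re := by rw [hR hw]
    rw [cayley_re ha] at h2
    have h3 : 0 < ‖a - cayleyInv a w‖ ^ 2 := by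
      have := norm_pos_iff.2 (sub_ne_zero.2 (Ne.symm hne'))
      positivity
    rw [div_eq_iff h3.ne'] at h2
    rw [mem_closedBall_zero_iff]
    have h4 : 0 ≤ 1 - ‖cayleyInv a w‖ ^ 2 := by rw [h2]; exact mul_nonneg hw h3.le
    exact (sq_le_one_iff₀ (norm_nonneg _)).1 (by linarith)
  · have hz2 : a - z ≠ 0 := sub_ne_zero.2 (Ne.symm hz.2)
    rw [cayley, cayleyInv]
    have h2 : (a + z) / (a - z) - 1 = 2 * z / (a - z) := by field_simp; ring
    have h3 : (a + z) / (a - z) + 1 = 2 * a / (a - z) := by field_simp; ring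
    rw [h2, h3]
    field_simp

/-- Logarithmic coordinates on the right half plane, centred at the boundary point `b * I`. -/
noncomputable def stripLog (b : ℝ) (w : ℂ) : ℝ × ℝ :=
  ((Complex.log (w - b * Complex.I)).im / Real.pi + 1 / 2, (Complex.log (w - b * Complex.I)).re)

/-- The inverse of `stripLog b`. -/
noncomputable def stripExp (b : ℝ) (p : ℝ × ℝ) : ℂ :=
  Complex.exp (p.2 + (Real.pi * (p.1 - 1 / 2) : ℝ) * Complex.I) + b * Complex.I

lemma stripExp_re (b : ℝ) (p : ℝ × ℝ) :
    (stripExp b p).re = Real.exp p.2 * Real.cos (Real.pi * (p.1 - 1 / 2)) := by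
  simp [stripExp, Complex.exp_re, -Complex.ofReal_mul, -Complex.ofReal_sub]

lemma stripExp_zero (b x : ℝ) : stripExp b (0, x) = (b - Real.exp x : ℝ) * Complex.I := by
  have h : ((Real.pi * (0 - 1 / 2) : ℝ) : ℂ) = -(Real.pi / 2) := by push_cast; ring
  simp only [stripExp, h, Complex.exp_add]
  have : Complex.exp (-(Real.pi / 2) * Complex.I) = -Complex.I := by
    rw [neg_mul, Complex.exp_neg, Complex.exp_pi_div_two_mul_I, Complex.inv_I]
  rw [this]
  push_cast
  ring

lemma stripExp_one (b x : ℝ) : stripExp b (1, x) = (b + Real.exp x : ℝ) * Complex.I := by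
  have h : ((Real.pi * (1 - 1 / 2) : ℝ) : ℂ) = Real.pi / 2 := by push_cast; ring
  simp only [stripExp, h, Complex.exp_add]
  rw [Complex.exp_pi_div_two_mul_I]
  push_cast
  ring

lemma isHomeoOn_stripLog (b : ℝ) :
    IsHomeoOn (stripLog b) (stripExp b) ({w | 0 ≤ w.re} \ {b * Complex.I}) (Icc 0 1 ×ˢ univ) := by
  have hpi := Real.pi_pos
  refine ⟨?_, ?_, fun w hw => ?_, fun p hp => ?_, fun w hw => ?_, fun p hp => ?_⟩
  · have : ContinuousOn (fun w => Complex.log (w - b * Complex.I))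
        ({w | 0 ≤ w.re} \ {b * Complex.I}) := by
      refine ContinuousOn.clog (by fun_prop) fun w hw => ?_
      rw [Complex.mem_slitPlane_iff]
      by_contra! hcon
      refine hw.2 (Complex.ext ?_ ?_)
      · have := hcon.1
        have h1 : 0 ≤ w.re := hw.1
        simp at this ⊢
        linarith
      · have := hcon.2
        simp at this ⊢
        linarith
    exact ((Complex.continuous_im.comp_continuousOn this).div_const _ |>.add_const _).prodMk
      (Complex.continuous_re.comp_continuousOn this)
  · unfold stripExp
    fun_prop
  · have h1 : |(w - b * Complex.I).arg| ≤ Real.pi / 2 :=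
      Complex.abs_arg_le_pi_div_two_iff.2 (by simpa using hw.1)
    rw [abs_le] at h1
    refine ⟨⟨?_, ?_⟩, trivial⟩
    · simp only [stripLog, Complex.log_im]
      have : -(1 / 2) ≤ (w - b * Complex.I).arg / Real.pi := by
        rw [le_div_iff₀ hpi]; linarith
      linarith
    · simp only [stripLog, Complex.log_im]
      have : (w - b * Complex.I).arg / Real.pi ≤ 1 / 2 := by
        rw [div_le_iff₀ hpi]; linarith
      linarith
  · refine ⟨?_, fun h => ?_⟩
    · rw [mem_ofPred_eq, stripExp_re]
      refine mul_nonneg (Real.exp_pos _).le (Real.cos_nonneg_of_mem_Icc ⟨?_, ?_⟩)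
      · nlinarith [hp.1.1]
      · nlinarith [hp.1.2]
    · exact Complex.exp_ne_zero _ (add_eq_right.1 h)
  · have h0 : w - b * Complex.I ≠ 0 := sub_ne_zero.2 hw.2
    simp only [stripExp, stripLog]
    have : ((Complex.log (w - b * Complex.I)).re +
        ((Real.pi * ((Complex.log (w - b * Complex.I)).im / Real.pi + 1 / 2 - 1 / 2) : ℝ) : ℂ) *
          Complex.I) = Complex.log (w - b * Complex.I) := by
      rw [add_sub_cancel_right, mul_div_cancel₀ _ hpi.ne', Complex.re_add_im]
    rw [this, Complex.exp_log h0, sub_add_cancel]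
  · have h1 : Complex.log (stripExp b p - b * Complex.I) =
        p.2 + (Real.pi * (p.1 - 1 / 2) : ℝ) * Complex.I := by
      rw [stripExp, add_sub_cancel_right, Complex.log_exp]
      · simp only [Complex.add_im, Complex.ofReal_im, Complex.im_ofReal_mul, Complex.I_im]
        nlinarith [hp.1.1]
      · simp only [Complex.add_im, Complex.ofReal_im, Complex.im_ofReal_mul, Complex.I_im]
        nlinarith [hp.1.2]
    rw [stripLog, h1]
    ext
    · simp only [Complex.add_im, Complex.ofReal_im, Complex.im_ofReal_mul, Complex.I_im]
      field_simp
      ring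
    · simp [-Complex.ofReal_mul]

lemma IsDiscModel.exists_strip_of_separated {X : Type*} [TopologicalSpace X] {D Q L₀ L₁ : Set X}
    {ψ : X → ℂ} {g : ℂ → X} (h : IsDiscModel D Q ψ g) (hL : D \ Q = L₀ ∪ L₁)
    {a : ℂ} (ha : ‖a‖ = 1) (haL : a ∉ ψ '' (D \ Q)) {S₀ S₁ : Set ℝ}
    (h₀o : IsOpen S₀) (h₀c : IsPreconnected S₀) (h₀n : S₀.Nonempty)
    (h₁o : IsOpen S₁) (h₁c : IsPreconnected S₁) (h₁n : S₁.Nonempty)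
    (hS₀ : ∀ y : ℝ, y ∈ S₀ ↔ cayleyInv a (y * Complex.I) ∈ ψ '' L₀)
    (hS₁ : ∀ y : ℝ, y ∈ S₁ ↔ cayleyInv a (y * Complex.I) ∈ ψ '' L₁)
    {b : ℝ} (hb₀ : ∀ y ∈ S₀, y < b) (hb₁ : ∀ y ∈ S₁, b < y) :
    ∃ (Φ : X → ℝ × ℝ) (Φ' : ℝ × ℝ → X), IsHomeoOn Φ Φ' D (Icc 0 1 ×ˢ univ) ∧
      (∀ x ∈ D, x ∈ L₀ ↔ (Φ x).1 = 0) ∧ (∀ x ∈ D, x ∈ L₁ ↔ (Φ x).1 = 1) := by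
  have hL₀D : L₀ ⊆ D := (subset_union_left.trans hL.ge).trans sdiff_subset
  have hL₁D : L₁ ⊆ D := (subset_union_right.trans hL.ge).trans sdiff_subset
  have hC := isHomeoOn_cayley ha
  have hN := isHomeoOn_stripLog b
  set E₂ : Set ℂ := {w | 0 ≤ w.re ∧ (w.re = 0 → w.im ∈ S₀ ∪ S₁)} with hE₂
  set J₀ : Set ℝ := {x | b - Real.exp x ∈ S₀} with hJ₀
  set J₁ : Set ℝ := {x | b + Real.exp x ∈ S₁} with hJ₁
  set T : Set (ℝ × ℝ) := {p | p.1 ∈ Icc (0 : ℝ) 1 ∧ (p.1 = 0 → p.2 ∈ J₀) ∧ (p.1 = 1 → p.2 ∈ J₁)}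
    with hT
  have hE₁ : Metric.ball 0 1 ∪ ψ '' (D \ Q) ⊆ Metric.closedBall 0 1 \ {a} := by
    rintro z (hz | hz)
    · refine ⟨Metric.ball_subset_closedBall hz, ?_⟩
      rintro rfl
      rw [mem_ball_zero_iff, ha] at hz
      exact lt_irrefl _ hz
    · refine ⟨?_, fun hza => haL (hza ▸ hz)⟩
      obtain ⟨x, hx, rfl⟩ := hz
      simp [h.norm_bdry x hx]
  have him : ∀ w : ℂ, w.re = 0 → w = w.im * Complex.I := fun w hw => by
    apply Complex.ext <;> simp [hw]
  have hpos : ∀ z ∈ Metric.closedBall (0 : ℂ) 1 \ {a}, 0 < (cayley a z).re ↔ ‖z‖ < 1 := by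
    intro z hz
    have h1 : 0 < ‖a - z‖ ^ 2 := by
      have := norm_pos_iff.2 (sub_ne_zero.2 (Ne.symm hz.2))
      positivity
    rw [cayley_re ha, div_pos_iff_of_pos_right h1, sub_pos, sq_lt_one_iff₀ (norm_nonneg _)]
  have himg : ψ '' (D \ Q) = ψ '' L₀ ∪ ψ '' L₁ := by rw [hL, image_union]
  have h1 : IsHomeoOn (cayley a) (cayleyInv a) (Metric.ball 0 1 ∪ ψ '' (D \ Q)) E₂ := by
    refine hC.restrict hE₁ (fun w hw => hw.1) (fun z hz => ⟨hC.mapsTo (hE₁ hz), fun h0 => ?_⟩)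
      fun w hw => ?_
    · have hz1 : z ∉ Metric.ball (0 : ℂ) 1 := fun hz1 =>
        absurd ((hpos z (hE₁ hz)).2 (mem_ball_zero_iff.1 hz1)) (by rw [h0]; exact lt_irrefl _)
      have hz2 := hz.resolve_left hz1
      have hz3 := hC.leftInv (hE₁ hz)
      rw [him _ h0] at hz3
      rw [mem_union, hS₀, hS₁, hz3]
      rwa [himg] at hz2
    · rcases (show 0 ≤ w.re from hw.1).eq_or_lt with h0 | h0
      · refine Or.inr ?_
        rw [himg, him w h0.symm]
        exact (hw.2 h0.symm).imp (hS₀ _).1 (hS₁ _).1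
      · refine Or.inl (mem_ball_zero_iff.2 ?_)
        rw [← hpos _ (hC.mapsTo_inv hw.1), hC.rightInv hw.1]
        exact h0
  have hE₂b : E₂ ⊆ {w | 0 ≤ w.re} \ {b * Complex.I} := by
    refine fun w hw => ⟨hw.1, fun hwb => ?_⟩
    rw [mem_singleton_iff] at hwb
    have h2 := hw.2 (by simp [hwb])
    have h3 : w.im = b := by simp [hwb]
    rw [h3] at h2
    exact h2.elim (fun h4 => lt_irrefl _ (hb₀ _ h4)) fun h4 => lt_irrefl _ (hb₁ _ h4)
  have him2 : ∀ y : ℝ, ((y : ℂ) * Complex.I).re = 0 ∧ ((y : ℂ) * Complex.I).im = y := by simp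
  have h2 : IsHomeoOn (stripLog b) (stripExp b) E₂ T := by
    refine hN.restrict hE₂b (fun p hp => ⟨hp.1, trivial⟩)
      (fun w hw => ⟨(hN.mapsTo (hE₂b hw)).1, fun h0 => ?_, fun h0 => ?_⟩) fun p hp => ?_
    · have h3 := hN.leftInv (hE₂b hw)
      rw [← Prod.mk.eta (p := stripLog b w), h0, stripExp_zero] at h3
      have h4 := hw.2 (by rw [← h3]; exact (him2 _).1)
      rw [← h3, (him2 _).2] at h4
      refine h4.resolve_right fun h5 => ?_
      have := hb₁ _ h5
      linarith [Real.exp_pos (stripLog b w).2]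
    · have h3 := hN.leftInv (hE₂b hw)
      rw [← Prod.mk.eta (p := stripLog b w), h0, stripExp_one] at h3
      have h4 := hw.2 (by rw [← h3]; exact (him2 _).1)
      rw [← h3, (him2 _).2] at h4
      refine h4.resolve_left fun h5 => ?_
      have := hb₀ _ h5
      linarith [Real.exp_pos (stripLog b w).2]
    · refine ⟨(hN.mapsTo_inv ⟨hp.1, trivial⟩).1, fun h0 => ?_⟩
      obtain ⟨t, x⟩ := p
      rcases hp.1.1.eq_or_lt with h3 | h3
      · simp only at h3
        have := hp.2.1 h3.symm
        rw [← h3, stripExp_zero, (him2 _).2]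
        exact Or.inl this
      rcases hp.1.2.eq_or_lt with h4 | h4
      · simp only at h4
        have := hp.2.2 h4
        rw [h4, stripExp_one, (him2 _).2]
        exact Or.inr this
      exfalso
      simp only at h3 h4
      rw [stripExp_re] at h0
      have hpi := Real.pi_pos
      have : 0 < Real.cos (Real.pi * (t - 1 / 2)) :=
        Real.cos_pos_of_mem_Ioo ⟨by nlinarith, by nlinarith⟩
      exact (mul_pos (Real.exp_pos x) this).ne' h0
  have hJ₀' : J₀ = (fun y => Real.log (b - y)) '' S₀ := by
    ext x
    constructor
    · intro hx
      exact ⟨_, hx, by simp⟩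
    · rintro ⟨y, hy, rfl⟩
      have := hb₀ y hy
      simp only [hJ₀, mem_ofPred_eq]
      rwa [Real.exp_log (by linarith), sub_sub_cancel]
  have hJ₁' : J₁ = (fun y => Real.log (y - b)) '' S₁ := by
    ext x
    constructor
    · intro hx
      exact ⟨_, hx, by simp⟩
    · rintro ⟨y, hy, rfl⟩
      have := hb₁ y hy
      simp only [hJ₁, mem_ofPred_eq]
      rwa [Real.exp_log (by linarith), add_sub_cancel]
  obtain ⟨u, v, huv, hst⟩ := exists_isHomeoOn_strip (J₀ := J₀) (J₁ := J₁)
    (h₀o.preimage (f := fun x => b - Real.exp x) (by fun_prop))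
    (hJ₀' ▸ h₀c.image _ (ContinuousOn.log (by fun_prop) fun y hy => by linarith [hb₀ y hy]))
    (hJ₀' ▸ h₀n.image _)
    (h₁o.preimage (f := fun x => b + Real.exp x) (by fun_prop))
    (hJ₁' ▸ h₁c.image _ (ContinuousOn.log (by fun_prop) fun y hy => by linarith [hb₁ y hy]))
    (hJ₁' ▸ h₁n.image _)
  have h12 := (h.homeo.trans h1).trans h2
  have hu1 : ∀ q ∈ T, (u q).1 = q.1 := fun q hq => by rw [← huv, hst.leftInv hq]
  refine ⟨_, _, h12.trans hst, fun x hx => ?_, fun x hx => ?_⟩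
  · have hq := h12.mapsTo hx
    have hl := h12.leftInv hx
    simp only [Function.comp_apply] at hq hl ⊢
    rw [hu1 _ hq]
    constructor
    · intro hxL
      have hψ : ψ x ∈ Metric.ball 0 1 ∪ ψ '' (D \ Q) := h.homeo.mapsTo hx
      have hre : (cayley a (ψ x)).re = 0 := by
        rw [cayley_re ha, h.norm_bdry x (hL.ge (Or.inl hxL))]
        simp
      have hw := him _ hre
      set y := (cayley a (ψ x)).im with hy
      have hyS : y ∈ S₀ := by
        rw [hS₀, ← hw, h1.leftInv hψ]
        exact ⟨x, hxL, rfl⟩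
      have hyb := hb₀ y hyS
      have h3 : stripExp b (0, Real.log (b - y)) = cayley a (ψ x) := by
        rw [stripExp_zero, Real.exp_log (by linarith), sub_sub_cancel, ← hw]
      rw [← h3, hN.rightInv ⟨by simp, trivial⟩]
    · intro h0
      set q := stripLog b (cayley a (ψ x)) with hqd
      have hqJ := hq.2.1 h0
      rw [← Prod.mk.eta (p := q), h0, stripExp_zero] at hl
      obtain ⟨x', hx', hxx⟩ := (hS₀ _).1 hqJ
      rw [← hxx, h.homeo.leftInv (hL₀D hx')] at hl
      rwa [← hl]
  · have hq := h12.mapsTo hx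
    have hl := h12.leftInv hx
    simp only [Function.comp_apply] at hq hl ⊢
    rw [hu1 _ hq]
    constructor
    · intro hxL
      have hψ : ψ x ∈ Metric.ball 0 1 ∪ ψ '' (D \ Q) := h.homeo.mapsTo hx
      have hre : (cayley a (ψ x)).re = 0 := by
        rw [cayley_re ha, h.norm_bdry x (hL.ge (Or.inr hxL))]
        simp
      have hw := him _ hre
      set y := (cayley a (ψ x)).im with hy
      have hyS : y ∈ S₁ := by
        rw [hS₁, ← hw, h1.leftInv hψ]
        exact ⟨x, hxL, rfl⟩
      have hyb := hb₁ y hyS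
      have h3 : stripExp b (1, Real.log (y - b)) = cayley a (ψ x) := by
        rw [stripExp_one, Real.exp_log (by linarith), add_sub_cancel, ← hw]
      rw [← h3, hN.rightInv ⟨by simp, trivial⟩]
    · intro h0
      set q := stripLog b (cayley a (ψ x)) with hqd
      have hqJ := hq.2.2 h0
      rw [← Prod.mk.eta (p := q), h0, stripExp_one] at hl
      obtain ⟨x', hx', hxx⟩ := (hS₁ _).1 hqJ
      rw [← hxx, h.homeo.leftInv (hL₁D hx')] at hl
      rwa [← hl]

lemma exists_separating_point {S T : Set ℝ} (hSo : IsOpen S) (hTo : IsOpen T)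
    (hSc : IsPreconnected S) (hTc : IsPreconnected T) (hSn : S.Nonempty) (hTn : T.Nonempty)
    (hd : Disjoint S T) :
    ∃ b, (∀ y ∈ S, y < b) ∧ (∀ y ∈ T, b < y) ∨ (∀ y ∈ T, y < b) ∧ (∀ y ∈ S, b < y) := by
  have key : ∀ {S T : Set ℝ}, IsOpen S → IsOpen T → S.Nonempty → T.Nonempty →
      (∀ s ∈ S, ∀ t ∈ T, s < t) → ∃ b, (∀ y ∈ S, y < b) ∧ (∀ y ∈ T, b < y) := by
    intro S T hSo hTo hSn hTn hlt
    obtain ⟨t₀, ht₀⟩ := hTn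
    have hbd : BddAbove S := ⟨t₀, fun s hs => (hlt s hs t₀ ht₀).le⟩
    refine ⟨sSup S, fun y hy => ?_, fun y hy => ?_⟩
    · obtain ⟨z, hz, hzS⟩ := ((show ∀ᶠ z in 𝓝[>] y, z ∈ S from
        nhdsWithin_le_nhds (hSo.mem_nhds hy)).and self_mem_nhdsWithin).exists
      exact lt_of_lt_of_le hzS (le_csSup hbd hz)
    · obtain ⟨z, hz, hzT⟩ := ((show ∀ᶠ z in 𝓝[<] y, z ∈ T from
        nhdsWithin_le_nhds (hTo.mem_nhds hy)).and self_mem_nhdsWithin).exists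
      exact (csSup_le hSn fun s hs => (hlt s hs z hz).le).trans_lt hzT
  have hSO := hSc.ordConnected
  have hTO := hTc.ordConnected
  obtain ⟨s₀, hs₀⟩ := id hSn
  obtain ⟨t₀, ht₀⟩ := id hTn
  have hne : ∀ y ∈ S, y ∉ T := fun y hy hyT => Set.disjoint_left.1 hd hy hyT
  have hcross : ∀ {S T : Set ℝ}, S.OrdConnected → T.OrdConnected → (∀ y ∈ S, y ∉ T) →
      ∀ s₀ ∈ S, ∀ t₀ ∈ T, s₀ < t₀ → ∀ s ∈ S, ∀ t ∈ T, s < t := by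
    intro S T hSO hTO hne s₀ hs₀ t₀ ht₀ hlt s hs t ht
    by_contra! hle
    have hst : t < s := lt_of_le_of_ne hle fun h => hne s hs (h ▸ ht)
    rcases le_total s t₀ with h1 | h1
    · exact hne s hs (hTO.out ht ht₀ ⟨hst.le, h1⟩)
    · exact hne t₀ (hSO.out hs₀ hs ⟨hlt.le, h1⟩) ht₀
  rcases lt_trichotomy s₀ t₀ with h | h | h
  · obtain ⟨b, hb⟩ := key hSo hTo hSn hTn (hcross hSO hTO hne s₀ hs₀ t₀ ht₀ h)
    exact ⟨b, Or.inl hb⟩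
  · exact absurd (h ▸ ht₀) (hne s₀ hs₀)
  · obtain ⟨b, hb⟩ := key hTo hSo hTn hSn
      (hcross hTO hSO (fun y hy hyS => hne y hyS hy) t₀ ht₀ s₀ hs₀ h)
    exact ⟨b, Or.inr hb⟩

/-- A disc model with two boundary components is a closed strip. -/
lemma IsDiscModel.exists_strip {X : Type*} [TopologicalSpace X] {D Q L₀ L₁ : Set X}
    {ψ : X → ℂ} {g : ℂ → X} (h : IsDiscModel D Q ψ g) (hL : D \ Q = L₀ ∪ L₁)
    (h₀ : IsClosed L₀) (h₁ : IsClosed L₁) (h₀c : IsConnected L₀) (h₁c : IsConnected L₁)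
    (hd : Disjoint L₀ L₁) :
    ∃ (Φ : X → ℝ × ℝ) (Φ' : ℝ × ℝ → X), IsHomeoOn Φ Φ' D (Icc 0 1 ×ˢ univ) ∧
      (∀ x ∈ D, x ∈ L₀ ↔ (Φ x).1 = 0) ∧ (∀ x ∈ D, x ∈ L₁ ↔ (Φ x).1 = 1) := by
  have hL₀D : L₀ ⊆ D := (subset_union_left.trans hL.ge).trans sdiff_subset
  have hL₁D : L₁ ⊆ D := (subset_union_right.trans hL.ge).trans sdiff_subset
  have hLo : ∀ {L L' : Set X}, L ⊆ D \ Q → D \ Q ⊆ L ∪ L' → IsClosed L' → Disjoint L L' →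
      ∀ x ∈ L, ∃ δ > 0, ∀ ζ : ℂ, ‖ζ‖ = 1 → ‖ζ - ψ x‖ < δ → ζ ∈ ψ '' L := by
    intro L L' hLD hDL hL' hdis x hx
    obtain ⟨δ, hδ, H⟩ := h.exists_preimage x (hLD hx) L'ᶜ
      (hL'.isOpen_compl.mem_nhds (Set.disjoint_left.1 hdis hx))
    refine ⟨δ, hδ, fun ζ h1 h2 => ?_⟩
    obtain ⟨y, ⟨hy1, hy2⟩, rfl⟩ := H ζ h1 h2
    exact ⟨y, (hDL hy1).resolve_right hy2, rfl⟩
  have hLo₀ := hLo (subset_union_left.trans hL.ge) hL.le h₁ hd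
  have hLo₁ := hLo (subset_union_right.trans hL.ge) (hL.le.trans (union_comm _ _).le) h₀ hd.symm
  have hnorm : ∀ z ∈ ψ '' (D \ Q), ‖z‖ = 1 := by
    rintro _ ⟨x, hx, rfl⟩
    exact h.norm_bdry x hx
  have hdisj : Disjoint (ψ '' L₀) (ψ '' L₁) := by
    rw [Set.disjoint_left]
    rintro _ ⟨x, hx, rfl⟩ ⟨y, hy, hxy⟩
    rw [h.homeo.injOn (hL₁D hy) (hL₀D hx) hxy] at hy
    exact Set.disjoint_left.1 hd hx hy
  obtain ⟨a, ha, haL⟩ : ∃ a : ℂ, ‖a‖ = 1 ∧ a ∉ ψ '' (D \ Q) := by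
    by_contra! hcon
    have hsph : IsPreconnected (Metric.sphere (0 : ℂ) 1) :=
      (isConnected_sphere (by rw [Complex.rank_real_complex]; norm_num) 0 zero_le_one).isPreconnected
    have hI : ∀ {L : Set X}, (∀ x ∈ L, ∃ δ > 0, ∀ ζ : ℂ, ‖ζ‖ = 1 → ‖ζ - ψ x‖ < δ → ζ ∈ ψ '' L) →
        ψ '' L ⊆ interior (ψ '' L ∪ (Metric.sphere 0 1)ᶜ) := by
      rintro L H _ ⟨x, hx, rfl⟩
      obtain ⟨δ, hδ, H⟩ := H x hx
      rw [mem_interior_iff_mem_nhds]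
      filter_upwards [Metric.ball_mem_nhds (ψ x) hδ] with z hz
      by_cases h1 : z ∈ Metric.sphere (0 : ℂ) 1
      · exact Or.inl (H z (mem_sphere_zero_iff_norm.1 h1) (mem_ball_iff_norm.1 hz))
      · exact Or.inr h1
    obtain ⟨x₀, hx₀⟩ := h₀c.nonempty
    obtain ⟨x₁, hx₁⟩ := h₁c.nonempty
    have hx₀s : ψ x₀ ∈ Metric.sphere (0 : ℂ) 1 :=
      mem_sphere_zero_iff_norm.2 (h.norm_bdry _ (hL.ge (Or.inl hx₀)))
    have hx₁s : ψ x₁ ∈ Metric.sphere (0 : ℂ) 1 :=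
      mem_sphere_zero_iff_norm.2 (h.norm_bdry _ (hL.ge (Or.inr hx₁)))
    obtain ⟨z, hz, hz0, hz1⟩ := hsph _ _ isOpen_interior isOpen_interior
      (fun z hz => by
        have := hcon z (mem_sphere_zero_iff_norm.1 hz)
        rw [hL, image_union] at this
        exact this.imp (fun hh => hI hLo₀ hh) fun hh => hI hLo₁ hh)
      ⟨_, hx₀s, hI hLo₀ ⟨x₀, hx₀, rfl⟩⟩ ⟨_, hx₁s, hI hLo₁ ⟨x₁, hx₁, rfl⟩⟩
    exact Set.disjoint_left.1 hdisj ((interior_subset hz0).resolve_right (not_not.2 hz))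
      ((interior_subset hz1).resolve_right (not_not.2 hz))
  have hC := isHomeoOn_cayley ha
  have hyre : ∀ y : ℝ, ((y : ℂ) * Complex.I) ∈ {w : ℂ | 0 ≤ w.re} := by simp
  have hyn : ∀ y : ℝ, ‖cayleyInv a (y * Complex.I)‖ = 1 := fun y => by
    have h1 := hC.mapsTo_inv (hyre y)
    have h2 : (cayley a (cayleyInv a (y * Complex.I))).re = 0 := by
      rw [hC.rightInv (hyre y)]; simp
    rw [cayley_re ha, div_eq_zero_iff] at h2
    rcases h2 with h2 | h2
    · have : ‖cayleyInv a (y * Complex.I)‖ ^ 2 = 1 := by linarith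
      exact (pow_eq_one_iff_of_nonneg (norm_nonneg _) two_ne_zero).1 this
    · rw [sq_eq_zero_iff, norm_eq_zero, sub_eq_zero] at h2
      exact absurd h2.symm h1.2
  have hS : ∀ {L : Set X}, L ⊆ D \ Q → IsConnected L →
      (∀ x ∈ L, ∃ δ > 0, ∀ ζ : ℂ, ‖ζ‖ = 1 → ‖ζ - ψ x‖ < δ → ζ ∈ ψ '' L) →
      IsOpen {y : ℝ | cayleyInv a (y * Complex.I) ∈ ψ '' L} ∧
      IsConnected {y : ℝ | cayleyInv a (y * Complex.I) ∈ ψ '' L} := by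
    intro L hLD hLc H
    constructor
    · rw [isOpen_iff_mem_nhds]
      rintro y ⟨x, hx, hxy⟩
      obtain ⟨δ, hδ, H⟩ := H x hx
      have hcont : Continuous fun y : ℝ => cayleyInv a (y * Complex.I) :=
        hC.cont_inv.comp_continuous (by fun_prop) hyre
      filter_upwards [hcont.continuousAt.eventually (Metric.ball_mem_nhds _ hδ)] with y' hy'
      refine H _ (hyn y') ?_
      rw [hxy]
      exact mem_ball_iff_norm.1 hy'
    · have heq : {y : ℝ | cayleyInv a (y * Complex.I) ∈ ψ '' L} =
          (fun x => (cayley a (ψ x)).im) '' L := by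
        ext y
        constructor
        · rintro ⟨x, hx, hxy⟩
          refine ⟨x, hx, ?_⟩
          simp only [hxy, hC.rightInv (hyre y)]
          simp
        · rintro ⟨x, hx, rfl⟩
          have hre : (cayley a (ψ x)).re = 0 := by
            rw [cayley_re ha, h.norm_bdry x (hLD hx)]; simp
          refine ⟨x, hx, ?_⟩
          have : (((cayley a (ψ x)).im : ℂ) * Complex.I) = cayley a (ψ x) := by
            apply Complex.ext <;> simp [hre]
          rw [this, hC.leftInv]
          exact ⟨by simp [h.norm_bdry x (hLD hx)], fun hh => haL ⟨x, hLD hx, hh⟩⟩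
      rw [heq]
      refine hLc.image _ (Complex.continuous_im.comp_continuousOn ?_)
      refine hC.cont.comp (h.homeo.cont.mono (hLD.trans sdiff_subset)) fun x hx => ?_
      exact ⟨by simp [h.norm_bdry x (hLD hx)], fun hh => haL ⟨x, hLD hx, hh⟩⟩
  obtain ⟨hS₀o, hS₀c⟩ := hS (subset_union_left.trans hL.ge) h₀c hLo₀
  obtain ⟨hS₁o, hS₁c⟩ := hS (subset_union_right.trans hL.ge) h₁c hLo₁
  obtain ⟨b, ⟨hb₀, hb₁⟩ | ⟨hb₁, hb₀⟩⟩ := exists_separating_point hS₀o hS₁o hS₀c.isPreconnected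
    hS₁c.isPreconnected hS₀c.nonempty hS₁c.nonempty (Set.disjoint_left.2 fun y hy hy' =>
      Set.disjoint_left.1 hdisj hy hy')
  · exact h.exists_strip_of_separated hL ha haL hS₀o hS₀c.isPreconnected hS₀c.nonempty
      hS₁o hS₁c.isPreconnected hS₁c.nonempty (fun _ => Iff.rfl) (fun _ => Iff.rfl) hb₀ hb₁
  · obtain ⟨Φ, Φ', hΦ, hΦ₁, hΦ₀⟩ := h.exists_strip_of_separated (hL.trans (union_comm _ _)) ha
      haL hS₁o hS₁c.isPreconnected hS₁c.nonempty hS₀o hS₀c.isPreconnected hS₀c.nonempty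
      (fun _ => Iff.rfl) (fun _ => Iff.rfl) hb₁ hb₀
    have hr : IsHomeoOn (fun p : ℝ × ℝ => (1 - p.1, p.2)) (fun p : ℝ × ℝ => (1 - p.1, p.2))
        (Icc 0 1 ×ˢ univ) (Icc 0 1 ×ˢ univ) := by
      refine ⟨by fun_prop, by fun_prop, fun p hp => ?_, fun p hp => ?_, fun p _ => by simp,
        fun p _ => by simp⟩ <;>
      · obtain ⟨h1, h2⟩ := hp.1
        exact ⟨⟨by simp only; linarith, by simp only; linarith⟩, trivial⟩
    refine ⟨_, _, hΦ.trans hr, fun x hx => ?_, fun x hx => ?_⟩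
    · rw [hΦ₀ x hx]
      simp only [Function.comp_apply]
      constructor <;> intro hh <;> linarith
    · rw [hΦ₁ x hx]
      simp only [Function.comp_apply]
      constructor <;> intro hh <;> linarith

/-- `D` is a closed fundamental domain for `f`, overlapping only its two neighbouring translates. -/
structure IsFundDomain {X : Type*} [TopologicalSpace X] (f : X ≃ₜ X) (D : Set X) : Prop where
  isClosed : IsClosed D
  exists_mem : ∀ x, ∃ k : ℤ, (f ^ k) x ∈ D
  locallyFinite : LocallyFinite fun k : ℤ => (f ^ k) ⁻¹' D
  notMem : ∀ x ∈ D, ∀ k : ℤ, 2 ≤ k → (f ^ k) x ∉ D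

lemma IsFundDomain.exists_extension {X Y : Type*} [TopologicalSpace X] [TopologicalSpace Y]
    {f : X ≃ₜ X} {r : Y ≃ₜ Y} {D : Set X} (h : IsFundDomain f D) {Φ : X → Y}
    (hΦ : ContinuousOn Φ D) (hcomp : ∀ x ∈ D, f x ∈ D → Φ (f x) = r (Φ x)) :
    ∃ G : X → Y, Continuous G ∧ ∀ (k : ℤ) x, (f ^ k) x ∈ D → (r ^ k) (G x) = Φ ((f ^ k) x) := by
  have hkey : ∀ k m : ℤ, k ≤ m → ∀ x, (f ^ k) x ∈ D → (f ^ m) x ∈ D →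
      Φ ((f ^ m) x) = (r ^ (m - k)) (Φ ((f ^ k) x)) := by
    intro k m hkm x hk hm
    have hfm : (f ^ m) x = (f ^ (m - k)) ((f ^ k) x) := by
      rw [← Homeomorph.mul_apply, ← zpow_add, sub_add_cancel]
    rcases hkm.eq_or_lt with rfl | hlt
    · simp
    have : m - k = 1 := by
      by_contra hne
      exact h.notMem _ hk (m - k) (by omega) (hfm ▸ hm)
    rw [this, zpow_one] at hfm
    rw [this, hfm, zpow_one]
    exact hcomp _ hk (hfm ▸ hm)
  choose κ hκ using h.exists_mem
  have hG : ∀ (k : ℤ) x, (f ^ k) x ∈ D →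
      (r ^ (-κ x)) (Φ ((f ^ κ x) x)) = (r ^ (-k)) (Φ ((f ^ k) x)) := by
    intro k x hk
    rcases le_total k (κ x) with hle | hle
    · rw [hkey k _ hle x hk (hκ x), ← Homeomorph.mul_apply, ← zpow_add]
      congr 2
      ring
    · rw [hkey _ k hle x (hκ x) hk, ← Homeomorph.mul_apply, ← zpow_add]
      congr 2
      ring
  refine ⟨fun x => (r ^ (-κ x)) (Φ ((f ^ κ x) x)), ?_, fun k x hk => ?_⟩
  · refine h.locallyFinite.continuous ?_ (fun k => h.isClosed.preimage (f ^ k).continuous)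
      fun k => ?_
    · exact eq_univ_of_forall fun x => mem_iUnion.2 (h.exists_mem x)
    · refine ContinuousOn.congr (f := fun x => (r ^ (-k)) (Φ ((f ^ k) x))) ?_ fun x hx => hG k x hx
      exact (r ^ (-k)).continuous.comp_continuousOn
        (hΦ.comp (f ^ k).continuous.continuousOn fun x hx => hx)
  · simp only
    rw [hG k x hk, ← Homeomorph.mul_apply, ← zpow_add, add_neg_cancel]
    rfl

/-- Homeomorphisms with matching fundamental domains are conjugate. -/
lemma IsFundDomain.exists_conj {X Y : Type*} [TopologicalSpace X] [TopologicalSpace Y]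
    {f : X ≃ₜ X} {r : Y ≃ₜ Y} {D : Set X} {E : Set Y} (hD : IsFundDomain f D)
    (hE : IsFundDomain r E) {Φ : X → Y} {Φ' : Y → X} (hΦ : IsHomeoOn Φ Φ' D E)
    (h1 : ∀ x ∈ D, f x ∈ D → Φ (f x) = r (Φ x))
    (h2 : ∀ y ∈ E, r y ∈ E → Φ' (r y) = f (Φ' y)) :
    ∃ h : X ≃ₜ Y, ∀ x, h (f x) = r (h x) := by
  obtain ⟨G, hGc, hG⟩ := hD.exists_extension hΦ.cont h1
  obtain ⟨G', hGc', hG'⟩ := hE.exists_extension hΦ.cont_inv h2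
  have hl : ∀ x, G' (G x) = x := fun x => by
    obtain ⟨k, hk⟩ := hD.exists_mem x
    have e1 := hG k x hk
    have e2 := hG' k (G x) (by rw [e1]; exact hΦ.mapsTo hk)
    rw [e1, hΦ.leftInv hk] at e2
    exact (f ^ k).injective e2
  have hr : ∀ y, G (G' y) = y := fun y => by
    obtain ⟨k, hk⟩ := hE.exists_mem y
    have e1 := hG' k y hk
    have e2 := hG k (G' y) (by rw [e1]; exact hΦ.mapsTo_inv hk)
    rw [e1, hΦ.rightInv hk] at e2
    exact (r ^ k).injective e2
  refine ⟨⟨⟨G, G', hl, hr⟩, hGc, hGc'⟩, fun x => ?_⟩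
  change G (f x) = r (G x)
  obtain ⟨k, hk⟩ := hD.exists_mem (f x)
  have e1 := hG k (f x) hk
  have e3 : (f ^ k) (f x) = (f ^ (k + 1)) x := by rw [zpow_add_one, Homeomorph.mul_apply]
  rw [e3] at hk e1
  have e2 := hG (k + 1) x hk
  rw [← e1, zpow_add_one, Homeomorph.mul_apply] at e2
  exact ((r ^ k).injective e2).symm

/-- The unit horizontal translation combined with a homeomorphism `s` of the vertical axis. -/
def shiftProd (s : ℝ ≃ₜ ℝ) : (ℝ × ℝ) ≃ₜ (ℝ × ℝ) := (Homeomorph.addRight (1 : ℝ)).prodCongr s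

lemma shiftProd_apply (s : ℝ ≃ₜ ℝ) (p : ℝ × ℝ) : shiftProd s p = (p.1 + 1, s p.2) := rfl

lemma shiftProd_zpow_fst (s : ℝ ≃ₜ ℝ) (k : ℤ) : ∀ p : ℝ × ℝ, ((shiftProd s ^ k) p).1 = p.1 + k := by
  induction k using Int.induction_on with
  | zero => simp
  | succ n ih =>
    intro p
    rw [zpow_add_one, Homeomorph.mul_apply, ih, shiftProd_apply]
    push_cast
    ring
  | pred n ih =>
    intro p
    have h1 := ih ((shiftProd s)⁻¹ p)
    rw [← Homeomorph.mul_apply, ← zpow_sub_one] at h1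
    have h2 : ((shiftProd s)⁻¹ p).1 = p.1 - 1 := rfl
    rw [h1, h2]
    push_cast
    ring

lemma isFundDomain_shiftProd (s : ℝ ≃ₜ ℝ) :
    IsFundDomain (shiftProd s) (Icc (0 : ℝ) 1 ×ˢ univ) where
  isClosed := isClosed_Icc.prod isClosed_univ
  exists_mem p := ⟨-⌊p.1⌋, by
    refine ⟨?_, trivial⟩
    rw [shiftProd_zpow_fst]
    push_cast
    constructor
    · linarith [Int.floor_le p.1]
    · linarith [Int.lt_floor_add_one p.1]⟩
  locallyFinite p := by
    refine ⟨{q | |q.1 - p.1| < 1}, ?_, ?_⟩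
    · exact (isOpen_lt (by fun_prop) continuous_const).mem_nhds (by simp)
    · refine (finite_Icc ⌊-p.1 - 1⌋ ⌈2 - p.1⌉).subset ?_
      rintro k ⟨q, hq, hq2⟩
      replace hq : ((shiftProd s ^ k) q).1 ∈ Icc (0 : ℝ) 1 := hq.1
      replace hq2 := abs_lt.1 (show |q.1 - p.1| < 1 from hq2)
      rw [shiftProd_zpow_fst] at hq
      refine ⟨?_, ?_⟩
      · have : (⌊-p.1 - 1⌋ : ℝ) ≤ k := (Int.floor_le _).trans (by linarith [hq.1])
        exact_mod_cast this
      · have : (k : ℝ) ≤ ⌈2 - p.1⌉ := le_trans (by linarith [hq.2]) (Int.le_ceil _)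
        exact_mod_cast this
  notMem p hp k hk h := by
    have h1 : ((shiftProd s ^ k) p).1 ≤ 1 := h.1.2
    rw [shiftProd_zpow_fst] at h1
    have h2 : (0 : ℝ) ≤ p.1 := hp.1.1
    have h3 : (2 : ℝ) ≤ k := by exact_mod_cast hk
    linarith

/-- The homeomorphism of the strip that is the identity on the left edge and `k` on the right. -/
lemma exists_isHomeoOn_interpolate {k : ℝ → ℝ} (hk : Continuous k) (hm : StrictMono k)
    (hs : Function.Surjective k) :
    ∃ g : ℝ × ℝ → ℝ × ℝ, IsHomeoOn (fun p => (p.1, (1 - p.1) * p.2 + p.1 * k p.2)) g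
      (Icc (0 : ℝ) 1 ×ˢ univ) (Icc (0 : ℝ) 1 ×ˢ univ) := by
  have hmono : ∀ t ∈ Icc (0 : ℝ) 1, StrictMono fun x => (1 - t) * x + t * k x := by
    intro t ht x y hxy
    have h1 := hm hxy
    simp only
    rcases ht.1.eq_or_lt with h | h
    · rw [← h]; linarith
    · have h2 : (1 - t) * x ≤ (1 - t) * y := mul_le_mul_of_nonneg_left hxy.le (by linarith [ht.2])
      have h3 : t * k x < t * k y := mul_lt_mul_of_pos_left h1 h
      linarith
  obtain ⟨g, hg⟩ := isHomeoOn_fiberwise (F := fun p => (1 - p.1) * p.2 + p.1 * k p.2)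
    (by fun_prop) hmono
  refine ⟨g, ?_⟩
  convert hg using 1
  ext ⟨t, y⟩
  constructor
  · rintro ⟨ht, -⟩
    simp only at ht
    have h1 : 0 ≤ t := ht.1
    have h2 : 0 ≤ 1 - t := by linarith [ht.2]
    obtain ⟨x, hx⟩ : ∃ x, (1 - t) * x + t * k x = y := by
      refine Continuous.surjective (f := fun x => (1 - t) * x + t * k x) (by fun_prop)
        (tendsto_atTop_atTop.2 fun b => ?_) (tendsto_atBot_atBot.2 fun b => ?_) y
      · obtain ⟨b', hb'⟩ := hs b
        refine ⟨max b b', fun a ha => ?_⟩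
        have e1 : b ≤ k a := hb' ▸ hm.monotone ((le_max_right _ _).trans ha)
        have e2 : b ≤ a := (le_max_left _ _).trans ha
        nlinarith
      · obtain ⟨b', hb'⟩ := hs b
        refine ⟨min b b', fun a ha => ?_⟩
        have e1 : k a ≤ b := hb' ▸ hm.monotone (ha.trans (min_le_right _ _))
        have e2 : a ≤ b := ha.trans (min_le_left _ _)
        nlinarith
    exact ⟨(t, x), ⟨ht, trivial⟩, by simp [hx]⟩
  · rintro ⟨⟨s, x⟩, ⟨hs, -⟩, hp⟩
    simp only [Prod.mk.injEq] at hp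
    exact ⟨by simp only; rw [← hp.1]; exact hs, trivial⟩

/-- A homeomorphism with a strip as fundamental domain is conjugate to a translation or a glide
reflection. -/
lemma IsFundDomain.exists_conj_shiftProd {f : (ℝ × ℝ) ≃ₜ (ℝ × ℝ)} {D L : Set (ℝ × ℝ)}
    (hD : IsFundDomain f D) (hL : L ⊆ D) (hfL : f '' L ⊆ D) (hLf : ∀ x ∈ D, f x ∈ D → x ∈ L)
    {Φ Φ' : ℝ × ℝ → ℝ × ℝ} (hΦ : IsHomeoOn Φ Φ' D (Icc (0 : ℝ) 1 ×ˢ univ))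
    (h0 : ∀ x ∈ D, x ∈ L ↔ (Φ x).1 = 0) (h1 : ∀ x ∈ D, x ∈ f '' L ↔ (Φ x).1 = 1) :
    ∃ h : (ℝ × ℝ) ≃ₜ (ℝ × ℝ), (∀ x, h (f x) = shiftProd (Homeomorph.refl ℝ) (h x)) ∨
      ∀ x, h (f x) = shiftProd (Homeomorph.neg ℝ) (h x) := by
  have z0 : ∀ y : ℝ, ((0 : ℝ), y) ∈ Icc (0 : ℝ) 1 ×ˢ (univ : Set ℝ) := fun y =>
    ⟨⟨le_rfl, zero_le_one⟩, trivial⟩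
  have z1 : ∀ y : ℝ, ((1 : ℝ), y) ∈ Icc (0 : ℝ) 1 ×ˢ (univ : Set ℝ) := fun y =>
    ⟨⟨zero_le_one, le_rfl⟩, trivial⟩
  have q0 : ∀ y : ℝ, Φ' (0, y) ∈ L := fun y =>
    (h0 _ (hΦ.mapsTo_inv (z0 y))).2 (by rw [hΦ.rightInv (z0 y)])
  have fq0 : ∀ y : ℝ, f (Φ' (0, y)) ∈ D := fun y => hfL (mem_image_of_mem _ (q0 y))
  set g : ℝ → ℝ := fun y => (Φ (f (Φ' (0, y)))).2 with hg
  have hgΦ : ∀ y, Φ (f (Φ' (0, y))) = (1, g y) := fun y =>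
    Prod.ext ((h1 _ (fq0 y)).1 (mem_image_of_mem _ (q0 y))) rfl
  have hgc : Continuous g := by
    refine continuous_snd.comp (hΦ.cont.comp_continuous ?_ fq0)
    exact f.continuous.comp (hΦ.cont_inv.comp_continuous (by fun_prop) z0)
  have hgi : Function.Injective g := fun y y' hy => by
    have e1 : Φ (f (Φ' (0, y))) = Φ (f (Φ' (0, y'))) := by rw [hgΦ, hgΦ, hy]
    have e2 := f.injective (hΦ.injOn (fq0 y) (fq0 y') e1)
    have e3 := hΦ.symm.injOn (z0 y) (z0 y') e2
    exact (Prod.mk.injEq _ _ _ _ ▸ e3).2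
  have hgs : Function.Surjective g := fun y => by
    obtain ⟨x, hx, hxy⟩ : Φ' (1, y) ∈ f '' L :=
      (h1 _ (hΦ.mapsTo_inv (z1 y))).2 (by rw [hΦ.rightInv (z1 y)])
    have e1 : Φ x = (0, (Φ x).2) := Prod.ext ((h0 _ (hL hx)).1 hx) rfl
    refine ⟨(Φ x).2, ?_⟩
    simp only [hg]
    rw [← e1, hΦ.leftInv (hL hx), hxy, hΦ.rightInv (z1 y)]
  have main : ∀ s : ℝ ≃ₜ ℝ, (∀ y, s (s y) = y) → StrictMono (fun y => g (s y)) →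
      ∃ h : (ℝ × ℝ) ≃ₜ (ℝ × ℝ), ∀ x, h (f x) = shiftProd s (h x) := by
    intro s hss hs
    obtain ⟨K', hK⟩ := exists_isHomeoOn_interpolate (hgc.comp s.continuous) hs
      (hgs.comp s.surjective)
    set K : ℝ × ℝ → ℝ × ℝ :=
      fun p => (p.1, (1 - p.1) * p.2 + p.1 * (g ∘ s) p.2) with hKdef
    have k0 : ∀ y, K (0, y) = (0, y) := fun y => by simp [hKdef]
    have k1 : ∀ y, K (1, y) = (1, g (s y)) := fun y => by simp [hKdef]
    have k0' : ∀ y, K' (0, y) = (0, y) := fun y => by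
      have := hK.leftInv (z0 y)
      rwa [k0] at this
    have k1' : ∀ y, K' (1, g y) = (1, s y) := fun y => by
      have := hK.leftInv (z1 (s y))
      rwa [k1, hss] at this
    refine hD.exists_conj (isFundDomain_shiftProd s) (hΦ.trans hK.symm) ?_ ?_
    · intro x hx hfx
      have e1 : Φ x = (0, (Φ x).2) := Prod.ext ((h0 _ hx).1 (hLf x hx hfx)) rfl
      have e2 : Φ (f x) = (1, g (Φ x).2) := by
        rw [← hgΦ, ← e1, hΦ.leftInv hx]
      simp only [Function.comp]
      rw [e2, e1, k0', k1', shiftProd_apply]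
      simp
    · rintro ⟨t, y⟩ ⟨ht, -⟩ ⟨ht', -⟩
      simp only [shiftProd_apply] at ht ht'
      obtain rfl : t = 0 := le_antisymm (by linarith [ht'.2]) ht.1
      simp only [Function.comp, shiftProd_apply, zero_add]
      rw [k0, k1, hss, ← hgΦ, hΦ.leftInv (fq0 y)]
  rcases hgc.strictMono_of_inj hgi with hm | hm
  · obtain ⟨h, hh⟩ := main (Homeomorph.refl ℝ) (fun _ => rfl) hm
    exact ⟨h, Or.inl hh⟩
  · obtain ⟨h, hh⟩ := main (Homeomorph.neg ℝ) (fun y => neg_neg y) fun x y hxy =>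
      hm (neg_lt_neg hxy)
    exact ⟨h, Or.inr hh⟩

lemma toCplx_cos_sin (θ : ℝ) : toCplx (Real.cos θ, Real.sin θ) = Complex.exp (θ * Complex.I) := by
  rw [Complex.exp_mul_I]
  apply Complex.ext <;> simp [toCplx, Complex.cos_ofReal_re, Complex.sin_ofReal_re]

/-- A homeomorphism isotopic to the identity is not conjugate to a glide reflection. -/
lemma IsBrouwer.not_conj_neg {f : (ℝ × ℝ) ≃ₜ (ℝ × ℝ)} (hf : IsBrouwer f) (h : (ℝ × ℝ) ≃ₜ (ℝ × ℝ)) :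
    ¬ ∀ x, h (f x) = shiftProd (Homeomorph.neg ℝ) (h x) := by
  intro hh
  obtain ⟨-, H, hHc, hHh, hH0, hH1⟩ := hf
  set G : ℝ → ℝ × ℝ → ℝ × ℝ := fun t p => h (H t (h.symm p)) with hG
  have hGc : Continuous fun q : ℝ × (ℝ × ℝ) => G q.1 q.2 :=
    h.continuous.comp (hHc.comp (continuous_fst.prodMk (h.symm.continuous.comp continuous_snd)))
  have hGi : ∀ t ∈ Icc (0 : ℝ) 1, Function.Injective (G t) := fun t ht => by
    obtain ⟨g, hg⟩ := hHh t ht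
    have : G t = h ∘ g ∘ h.symm := by rw [hg]; rfl
    rw [this]
    exact h.injective.comp (g.injective.comp h.symm.injective)
  have hG0 : ∀ p, G 0 p = p := fun p => by simp [hG, hH0]
  have hG1 : ∀ p, G 1 p = (p.1 + 1, -p.2) := fun p => by
    simp only [hG, hH1]
    rw [hh, shiftProd_apply, h.apply_symm_apply]
    rfl
  set g : ℝ × ℝ → ℂ := fun q =>
    toCplx (G q.1 (Real.cos q.2, Real.sin q.2) - G q.1 (0, 0)) with hg
  have hgc : Continuous g := by
    refine toCplx.continuous.comp (Continuous.sub ?_ ?_)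
    · exact hGc.comp (continuous_fst.prodMk (by fun_prop))
    · exact hGc.comp (continuous_fst.prodMk (by fun_prop))
  set S : Set (ℝ × ℝ) := Icc 0 1 ×ˢ univ with hS
  have hSconv : Convex ℝ S := (convex_Icc 0 1).prod convex_univ
  have hne : ∀ x ∈ S, g x ≠ 0 := fun x hx => toCplx_sub_ne_zero fun he => by
    have := hGi x.1 hx.1 he
    rw [Prod.mk.injEq] at this
    have h1 := Real.cos_sq_add_sin_sq x.2
    rw [this.1, this.2] at h1
    norm_num at h1
  obtain ⟨Λ, hΛ, hΛe⟩ := exists_log_of_convex hSconv hgc.continuousOn hne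
  have hSc : IsPreconnected S := hSconv.isPreconnected
  have hmem : ∀ t ∈ Icc (0 : ℝ) 1, ∀ θ : ℝ, ((t, θ) : ℝ × ℝ) ∈ S := fun t ht θ => ⟨ht, trivial⟩
  have z0 : (0 : ℝ) ∈ Icc (0 : ℝ) 1 := by simp
  have z1 : (1 : ℝ) ∈ Icc (0 : ℝ) 1 := by simp
  have e1 := log_sub_const hSc (L₁ := fun q => Λ (q.1, q.2 + 2 * Real.pi)) (L₂ := Λ)
    (hΛ.comp (by fun_prop) fun q hq => ⟨hq.1, trivial⟩) hΛ
    (fun q hq => by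
      rw [hΛe _ hq, hΛe _ (hmem _ hq.1 _)]
      simp [hg]) (hmem 0 z0 0) (hmem 1 z1 0)
  have hP0 : IsPreconnected ({(0 : ℝ)} ×ˢ (univ : Set ℝ)) :=
    isPreconnected_singleton.prod isPreconnected_univ
  have hP1 : IsPreconnected ({(1 : ℝ)} ×ˢ (univ : Set ℝ)) :=
    isPreconnected_singleton.prod isPreconnected_univ
  have e2 := log_sub_const hP0 (L₁ := Λ) (L₂ := fun q => (q.2 : ℂ) * Complex.I)
    (hΛ.mono (prod_mono (by simp) Subset.rfl)) (by fun_prop)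
    (fun q hq => by
      obtain ⟨hq, -⟩ := hq
      have : q = (0, q.2) := Prod.ext hq rfl
      rw [this, hΛe _ (hmem 0 z0 _)]
      simp only [hg, hG0]
      rw [← toCplx_cos_sin]
      simp) (x := (0, 0 + 2 * Real.pi)) (y := (0, 0)) ⟨rfl, trivial⟩ ⟨rfl, trivial⟩
  have e3 := log_sub_const hP1 (L₁ := Λ) (L₂ := fun q => (((-q.2 : ℝ)) : ℂ) * Complex.I)
    (hΛ.mono (prod_mono (by simp) Subset.rfl)) (by fun_prop)
    (fun q hq => by
      obtain ⟨hq, -⟩ := hq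
      have : q = (1, q.2) := Prod.ext hq rfl
      rw [this, hΛe _ (hmem 1 z1 _)]
      simp only [hg, hG1]
      rw [← toCplx_cos_sin]
      simp) (x := (1, 0 + 2 * Real.pi)) (y := (1, 0)) ⟨rfl, trivial⟩ ⟨rfl, trivial⟩
  simp only at e1 e2 e3
  push_cast at e2 e3
  have e4 : (4 * Real.pi : ℂ) * Complex.I = 0 := by
    linear_combination e1 - e2 + e3
  have := Real.pi_pos
  simp [Complex.I_ne_zero, this.ne'] at e4

/-- An eventually displacing Brouwer homeomorphism with a strip-like fundamental domain is
conjugate to the translation. -/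
lemma IsBrouwer.exists_conj_of_isFundDomain {f : (ℝ × ℝ) ≃ₜ (ℝ × ℝ)} (hf : IsBrouwer f)
    {D L : Set (ℝ × ℝ)}
    (hD : IsFundDomain f D) (hL : L ⊆ D) (hfL : f '' L ⊆ D) (hLf : ∀ x ∈ D, f x ∈ D → x ∈ L)
    {Φ Φ' : ℝ × ℝ → ℝ × ℝ} (hΦ : IsHomeoOn Φ Φ' D (Icc (0 : ℝ) 1 ×ˢ univ))
    (h0 : ∀ x ∈ D, x ∈ L ↔ (Φ x).1 = 0) (h1 : ∀ x ∈ D, x ∈ f '' L ↔ (Φ x).1 = 1) :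
    ∃ h : (ℝ × ℝ) ≃ₜ (ℝ × ℝ), ∀ z, h (f (h.symm z)) = planeTranslation z := by
  obtain ⟨h, hh | hh⟩ := hD.exists_conj_shiftProd hL hfL hLf hΦ h0 h1
  · exact ⟨h, fun z => by rw [hh, shiftProd_apply, h.apply_symm_apply]; rfl⟩
  · exact absurd hh (hf.not_conj_neg h)

lemma Homeomorph.coe_pow_eq_iterate {X : Type*} [TopologicalSpace X] (f : X ≃ₜ X) (n : ℕ) :
    ⇑(f ^ n) = f^[n] :=
  hom_coe_pow DFunLike.coe rfl (fun _ _ => rfl) f n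

lemma IsEventuallyDisplacing.zpow_notMem {f : (ℝ × ℝ) ≃ₜ (ℝ × ℝ)} (hf : IsEventuallyDisplacing f)
    {K : Set (ℝ × ℝ)} (hK : IsCompact K) :
    ∃ N : ℕ, ∀ k : ℤ, N ≤ k.natAbs → ∀ z ∈ K, (f ^ k) z ∉ K := by
  obtain ⟨N, hN⟩ := hf K hK
  refine ⟨N, fun k hk z hz hzk => ?_⟩
  rcases Int.natAbs_eq k with h | h
  · rw [h, zpow_natCast, Homeomorph.coe_pow_eq_iterate] at hzk
    exact hN _ hk z hz hzk
  · refine hN _ hk _ hzk ?_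
    rw [← Homeomorph.coe_pow_eq_iterate, ← zpow_natCast, ← Homeomorph.mul_apply, ← zpow_add]
    have : (k.natAbs : ℤ) + k = 0 := by omega
    rw [this]
    exact hz

lemma summable_half_pow_natAbs : Summable fun k : ℤ => (1 / 2 : ℝ) ^ k.natAbs := by
  apply Summable.of_nat_of_neg <;> simpa using summable_geometric_two

/-- A positive weight that decays fast along orbits. -/
lemma IsEventuallyDisplacing.exists_weight {f : (ℝ × ℝ) ≃ₜ (ℝ × ℝ)}
    (hf : IsEventuallyDisplacing f) :
    ∃ w : ℝ × ℝ → ℝ, Continuous w ∧ (∀ z, 0 < w z) ∧ ∀ m : ℕ, ∃ C : ℝ, ∀ k : ℤ,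
      ∀ z ∈ Metric.closedBall (0 : ℝ × ℝ) m,
        (1 + |(k : ℝ)|) * w ((f ^ k) z) ≤ C * (1 / 2) ^ k.natAbs := by
  choose N hN using fun j : ℕ =>
    hf.zpow_notMem (isCompact_closedBall (0 : ℝ × ℝ) (j : ℝ))
  set M : ℕ → ℕ := fun j => j + ∑ i ∈ Finset.range (j + 1), N i with hM
  have hMN : ∀ j, N j ≤ M j := fun j =>
    (Finset.single_le_sum (f := N) (fun _ _ => Nat.zero_le _)
      (Finset.self_mem_range_succ j)).trans (Nat.le_add_left _ _)
  have hMj : ∀ j, j ≤ M j := fun j => Nat.le_add_right _ _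
  have hMm : Monotone M := fun i j hij => by
    refine Nat.add_le_add hij (Finset.sum_le_sum_of_subset ?_)
    exact Finset.range_subset_range.2 (by omega)
  obtain ⟨w, hw⟩ := exists_continuous_forall_mem_convex_of_local_const (X := ℝ × ℝ) (E := ℝ)
    (t := fun z => Ioo 0 ((1 / 4 : ℝ) ^ M (⌊‖z‖⌋₊ + 1))) (fun z => convex_Ioo _ _) (fun z =>
      ⟨(1 / 4 : ℝ) ^ M (⌊‖z‖⌋₊ + 2) / 2, by
        have : ∀ᶠ y : ℝ × ℝ in 𝓝 z, ‖y‖ < ⌊‖z‖⌋₊ + 1 :=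
          (isOpen_lt continuous_norm continuous_const).mem_nhds (Nat.lt_floor_add_one ‖z‖)
        filter_upwards [this] with y hy
        have h1 : ⌊‖y‖⌋₊ < ⌊‖z‖⌋₊ + 1 := by
          rw [Nat.floor_lt (norm_nonneg _)]
          exact_mod_cast hy
        have h2 : (1 / 4 : ℝ) ^ M (⌊‖z‖⌋₊ + 2) ≤ (1 / 4 : ℝ) ^ M (⌊‖y‖⌋₊ + 1) :=
          pow_le_pow_of_le_one (by norm_num) (by norm_num) (hMm (by omega))
        have h3 : 0 < (1 / 4 : ℝ) ^ M (⌊‖z‖⌋₊ + 2) := by positivity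
        constructor <;> linarith⟩)
  refine ⟨w, w.continuous, fun z => (hw z).1, fun m => ⟨(1 + M m) * 2 ^ M m, fun k z hz => ?_⟩⟩
  have hw1 : w ((f ^ k) z) ≤ 1 := (hw _).2.le.trans (pow_le_one₀ (by norm_num) (by norm_num))
  have hw0 := (hw ((f ^ k) z)).1
  have hk : |(k : ℝ)| = (k.natAbs : ℝ) := by simp [Nat.cast_natAbs]
  rw [hk]
  set n := k.natAbs with hn
  rcases lt_or_ge n (M m) with hlt | hge
  · have h1 : ((n : ℕ) : ℝ) ≤ M m := by exact_mod_cast hlt.le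
    have h2 : (1 : ℝ) ≤ 2 ^ M m * (1 / 2) ^ n := by
      rw [one_div, inv_pow, ← div_eq_mul_inv, one_le_div (by positivity)]
      exact pow_le_pow_right₀ (by norm_num) hlt.le
    calc (1 + (n : ℝ)) * w ((f ^ k) z) ≤ (1 + M m) * 1 := by gcongr
      _ ≤ (1 + M m) * (2 ^ M m * (1 / 2) ^ n) := by gcongr
      _ = _ := by ring
  · obtain ⟨j, hmj, hj, hj1⟩ : ∃ j, m ≤ j ∧ M j ≤ n ∧ n < M (j + 1) := by
      have hmn : m ≤ n := (hMj m).trans hge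
      refine ⟨Nat.findGreatest (fun j => M j ≤ n) n, Nat.le_findGreatest hmn hge,
        Nat.findGreatest_spec (P := fun j => M j ≤ n) hmn hge, ?_⟩
      by_contra! hcon
      have h1 := Nat.le_findGreatest (P := fun j => M j ≤ n) ((hMj _).trans hcon) hcon
      omega
    have h1 := hN j k ((hMN j).trans hj) z
      (Metric.closedBall_subset_closedBall (by exact_mod_cast hmj) hz)
    rw [mem_closedBall_zero_iff, not_le] at h1
    have h2 : j ≤ ⌊‖(f ^ k) z‖⌋₊ := Nat.le_floor h1.le
    have h3 : w ((f ^ k) z) ≤ (1 / 4) ^ n := (hw _).2.le.trans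
      (pow_le_pow_of_le_one (by norm_num) (by norm_num) (hj1.le.trans (hMm (by omega))))
    have h4 : (1 + n : ℝ) ≤ 2 ^ n := by
      have : n + 1 ≤ 2 ^ n := Nat.lt_two_pow_self
      have : ((n + 1 : ℕ) : ℝ) ≤ ((2 ^ n : ℕ) : ℝ) := by exact_mod_cast this
      push_cast at this
      linarith
    have h5 : (1 : ℝ) ≤ (1 + M m) * 2 ^ M m := by
      have : (1 : ℝ) ≤ 2 ^ M m := one_le_pow₀ (by norm_num)
      have : (0 : ℝ) ≤ M m := by positivity
      nlinarith
    calc (1 + (n : ℝ)) * w ((f ^ k) z) ≤ 2 ^ n * (1 / 4) ^ n := by gcongr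
      _ = (1 / 2) ^ n := by rw [← mul_pow]; norm_num
      _ = 1 * (1 / 2) ^ n := (one_mul _).symm
      _ ≤ (1 + M m) * 2 ^ M m * (1 / 2) ^ n := by gcongr

/-- An eventually displacing homeomorphism has a continuous height function increasing by one. -/
lemma IsEventuallyDisplacing.exists_height {f : (ℝ × ℝ) ≃ₜ (ℝ × ℝ)}
    (hf : IsEventuallyDisplacing f) :
    ∃ φ : ℝ × ℝ → ℝ, Continuous φ ∧ ∀ z, φ (f z) = φ z + 1 := by
  obtain ⟨w, hwc, hw0, hw⟩ := hf.exists_weight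
  choose C hC using hw
  have hmem : ∀ z : ℝ × ℝ, z ∈ Metric.closedBall (0 : ℝ × ℝ) (⌈‖z‖⌉₊ : ℕ) := fun z => by
    simpa using Nat.le_ceil ‖z‖
  have b0 : ∀ (m : ℕ) (k : ℤ), ∀ z ∈ Metric.closedBall (0 : ℝ × ℝ) m,
      ‖w ((f ^ k) z)‖ ≤ C m * (1 / 2) ^ k.natAbs := fun m k z hz => by
    refine le_trans ?_ (hC m k z hz)
    rw [Real.norm_of_nonneg (hw0 _).le]
    nlinarith [hw0 ((f ^ k) z), abs_nonneg (k : ℝ)]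
  have b1 : ∀ (m : ℕ) (k : ℤ), ∀ z ∈ Metric.closedBall (0 : ℝ × ℝ) m,
      ‖(k : ℝ) * w ((f ^ k) z)‖ ≤ C m * (1 / 2) ^ k.natAbs := fun m k z hz => by
    refine le_trans ?_ (hC m k z hz)
    rw [norm_mul, Real.norm_of_nonneg (hw0 _).le, Real.norm_eq_abs]
    nlinarith [hw0 ((f ^ k) z)]
  have hs : ∀ m, Summable fun k : ℤ => C m * (1 / 2) ^ k.natAbs := fun m =>
    summable_half_pow_natAbs.mul_left _
  have s0 : ∀ z, Summable fun k : ℤ => w ((f ^ k) z) := fun z =>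
    Summable.of_norm_bounded (hs _) fun k => b0 _ k z (hmem z)
  have s1 : ∀ z, Summable fun k : ℤ => (k : ℝ) * w ((f ^ k) z) := fun z =>
    Summable.of_norm_bounded (hs _) fun k => b1 _ k z (hmem z)
  have hcont : ∀ F : ℤ → ℝ × ℝ → ℝ, (∀ k, Continuous (F k)) →
      (∀ (m : ℕ) (k : ℤ), ∀ z ∈ Metric.closedBall (0 : ℝ × ℝ) m,
        ‖F k z‖ ≤ C m * (1 / 2) ^ k.natAbs) → Continuous fun z => ∑' k, F k z := by
    intro F hF hb
    rw [continuous_iff_continuousAt]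
    intro z
    have := continuousOn_tsum (s := Metric.closedBall (0 : ℝ × ℝ) ((⌈‖z‖⌉₊ + 1 : ℕ) : ℝ))
      (fun k => (hF k).continuousOn) (hs (⌈‖z‖⌉₊ + 1)) (fun k z hz => hb _ k z hz)
    refine this.continuousAt (mem_of_superset (Metric.isOpen_ball.mem_nhds ?_)
      Metric.ball_subset_closedBall)
    rw [mem_ball_zero_iff]
    push_cast
    linarith [Nat.le_ceil ‖z‖]
  have c0 : Continuous fun z => ∑' k : ℤ, w ((f ^ k) z) :=
    hcont (fun k z => w ((f ^ k) z)) (fun k => hwc.comp (f ^ k).continuous) b0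
  have c1 : Continuous fun z => ∑' k : ℤ, (k : ℝ) * w ((f ^ k) z) :=
    hcont (fun k z => (k : ℝ) * w ((f ^ k) z))
      (fun k => continuous_const.mul (hwc.comp (f ^ k).continuous)) b1
  have hpos : ∀ z, 0 < ∑' k : ℤ, w ((f ^ k) z) := fun z =>
    (s0 z).tsum_pos (fun k => (hw0 _).le) 0 (hw0 _)
  refine ⟨fun z => -(∑' k : ℤ, (k : ℝ) * w ((f ^ k) z)) / ∑' k : ℤ, w ((f ^ k) z),
    c1.neg.div c0 fun z => (hpos z).ne', fun z => ?_⟩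
  have hk : ∀ k : ℤ, (f ^ k) (f z) = (f ^ (k + 1)) z := fun k => by
    rw [zpow_add_one, Homeomorph.mul_apply]
  have e0 : ∑' k : ℤ, w ((f ^ k) (f z)) = ∑' k : ℤ, w ((f ^ k) z) := by
    simp_rw [hk]
    exact (Equiv.addRight (1 : ℤ)).tsum_eq fun k => w ((f ^ k) z)
  have e1 : ∑' k : ℤ, (k : ℝ) * w ((f ^ k) (f z)) =
      ∑' k : ℤ, (k : ℝ) * w ((f ^ k) z) - ∑' k : ℤ, w ((f ^ k) z) := by
    rw [← (s1 z).tsum_sub (s0 z),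
      ← (Equiv.addRight (1 : ℤ)).tsum_eq fun k : ℤ => (k : ℝ) * w ((f ^ k) z) - w ((f ^ k) z)]
    refine tsum_congr fun k => ?_
    rw [hk]
    simp only [Equiv.coe_addRight]
    push_cast
    ring
  simp only
  rw [e0, e1]
  have := (hpos z).ne'
  field_simp
  ring

/-- Continuous functions on the plane are uniformly approximated by smooth functions for which
zero is a regular value. -/
lemma exists_contDiff_regular {φ : ℝ × ℝ → ℝ} (hφ : Continuous φ) :
    ∃ v : ℝ × ℝ → ℝ, ContDiff ℝ 1 v ∧ (∀ z, |v z - φ z| < 1 / 2) ∧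
      ∀ z, v z = 0 → fderiv ℝ v z ≠ 0 := by
  obtain ⟨u, hu⟩ := exists_contMDiffMap_forall_mem_convex_of_local_const (n := 2)
    (modelWithCornersSelf ℝ (ℝ × ℝ)) (F := ℝ)
    (t := fun z => Ioo (φ z - 1 / 4) (φ z + 1 / 4)) (fun z => convex_Ioo _ _) (fun z =>
      ⟨φ z, by
        have h1 : ∀ᶠ y in 𝓝 z, φ y < φ z + 1 / 4 :=
          (isOpen_lt hφ continuous_const).mem_nhds (show φ z < φ z + 1 / 4 by linarith)
        have h2 : ∀ᶠ y in 𝓝 z, φ z - 1 / 4 < φ y :=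
          (isOpen_lt continuous_const hφ).mem_nhds (show φ z - 1 / 4 < φ z by linarith)
        filter_upwards [h1, h2] with y h1 h2
        constructor <;> linarith⟩)
  have huc : ContDiff ℝ 2 (u : ℝ × ℝ → ℝ) := u.contMDiff.contDiff
  set u₁ : ℝ × ℝ → ℝ := fun z => fderiv ℝ u z (1, 0) with hu₁
  set u₂ : ℝ × ℝ → ℝ := fun z => fderiv ℝ u z (0, 1) with hu₂
  have hdu : ContDiff ℝ 1 (fderiv ℝ (u : ℝ × ℝ → ℝ)) := huc.fderiv_right (by norm_num)
  have hu₁c : ContDiff ℝ 1 u₁ := hdu.clm_apply contDiff_const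
  have hu₂c : ContDiff ℝ 1 u₂ := hdu.clm_apply contDiff_const
  set a : ℝ × ℝ → ℝ := fun z => -((1 + z.1 ^ 2) * u₁ z) with ha
  set b : ℝ × ℝ → ℝ := fun z => -((1 + z.2 ^ 2) * u₂ z) with hb
  have hac : ContDiff ℝ 1 a := by fun_prop
  have hbc : ContDiff ℝ 1 b := by fun_prop
  have hat1 : ContDiff ℝ 1 fun z : ℝ × ℝ => Real.arctan z.1 := contDiff_fst.arctan
  have hat2 : ContDiff ℝ 1 fun z : ℝ × ℝ => Real.arctan z.2 := contDiff_snd.arctan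
  set G : ℝ × ℝ → ℝ × ℝ × ℝ := fun z =>
    (a z, b z, u z + a z * Real.arctan z.1 + b z * Real.arctan z.2) with hG
  have hGc : ContDiff ℝ 1 G := by
    refine hac.prodMk (hbc.prodMk ?_)
    exact ((huc.of_le (by norm_num)).add (hac.mul hat1)).add (hbc.mul hat2)
  have hd := hGc.dense_compl_range_of_finrank_lt_finrank (by simp)
  obtain ⟨⟨α, β, c⟩, hp, hpG⟩ := hd.inter_open_nonempty (Metric.ball (0 : ℝ × ℝ × ℝ) (1 / 100))
    Metric.isOpen_ball ⟨0, by simp⟩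
  rw [mem_ball_zero_iff, Prod.norm_def, Prod.norm_def] at hp
  simp only [Real.norm_eq_abs, sup_lt_iff] at hp
  obtain ⟨hα, hβ, hc⟩ := hp
  set v : ℝ × ℝ → ℝ := fun z => u z + α * Real.arctan z.1 + β * Real.arctan z.2 - c with hv
  have hvc : ContDiff ℝ 1 v :=
    (((huc.of_le (by norm_num)).add (contDiff_const.mul hat1)).add
      (contDiff_const.mul hat2)).sub contDiff_const
  refine ⟨v, hvc, fun z => ?_, fun z hz hdz => hpG ⟨z, ?_⟩⟩
  · have h2 : ∀ x : ℝ, |Real.arctan x| ≤ 2 := fun x => by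
      rw [abs_le]
      have := Real.pi_lt_four
      constructor
      · linarith [Real.neg_pi_div_two_lt_arctan x]
      · linarith [Real.arctan_lt_pi_div_two x]
    have h3 : |α * Real.arctan z.1| ≤ 1 / 100 * 2 := by
      rw [abs_mul]; exact mul_le_mul hα.le (h2 _) (abs_nonneg _) (by norm_num)
    have h4 : |β * Real.arctan z.2| ≤ 1 / 100 * 2 := by
      rw [abs_mul]; exact mul_le_mul hβ.le (h2 _) (abs_nonneg _) (by norm_num)
    have h5 := hu z
    simp only [hv]
    rw [abs_le] at h3 h4
    rw [abs_lt] at hc ⊢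
    constructor <;> linarith [h5.1, h5.2]
  · have hud : HasFDerivAt (u : ℝ × ℝ → ℝ) (fderiv ℝ u z) z :=
      (huc.differentiable (by norm_num) z).hasFDerivAt
    have e1 : HasFDerivAt (fun z : ℝ × ℝ => Real.arctan z.1)
      ((1 / (1 + z.1 ^ 2)) • ContinuousLinearMap.fst ℝ ℝ ℝ) z := hasFDerivAt_fst.arctan
    have e2 : HasFDerivAt (fun z : ℝ × ℝ => Real.arctan z.2)
      ((1 / (1 + z.2 ^ 2)) • ContinuousLinearMap.snd ℝ ℝ ℝ) z := hasFDerivAt_snd.arctan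
    have hvd := (((hud.add (e1.const_mul α)).add (e2.const_mul β)).sub_const c).fderiv
    change fderiv ℝ v z = _ at hvd
    rw [hdz] at hvd
    have f1 := congrArg (fun T : ℝ × ℝ →L[ℝ] ℝ => T (1, 0)) hvd
    have f2 := congrArg (fun T : ℝ × ℝ →L[ℝ] ℝ => T (0, 1)) hvd
    simp at f1 f2
    have ha' : a z = α := by
      simp only [ha, hu₁]
      have : 1 + z.1 ^ 2 ≠ 0 := by positivity
      field_simp at f1
      linear_combination f1
    have hb' : b z = β := by
      simp only [hb, hu₂]
      have : 1 + z.2 ^ 2 ≠ 0 := by positivity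
      field_simp at f2
      linear_combination f2
    simp only [hG, ha', hb', Prod.mk.injEq, true_and]
    simp only [hv] at hz
    linarith

/-- The plane embeds as an arbitrarily small neighbourhood of a point, keeping the side of each
point with respect to the horizontal line. -/
lemma exists_isOpenEmbedding_small (c : ℝ × ℝ) {W : Set (ℝ × ℝ)} (hW : W ∈ 𝓝 c) :
    ∃ e : ℝ × ℝ → ℝ × ℝ, IsOpenEmbedding e ∧ e 0 = c ∧ (∀ p, e p ∈ W) ∧
      ∀ p, ∃ t : ℝ, 0 < t ∧ (e p).2 = c.2 + t * p.2 := by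
  obtain ⟨r, hr, hrW⟩ := Metric.mem_nhds_iff.1 hW
  refine ⟨OpenPartialHomeomorph.univBall c r, ?_, by simp, fun p => hrW ?_, fun p => ?_⟩
  · exact (OpenPartialHomeomorph.univBall c r).isOpenEmbedding (by simp)
  · rw [← OpenPartialHomeomorph.univBall_target c hr]
    exact (OpenPartialHomeomorph.univBall c r).map_source (by simp)
  · refine ⟨r * (√(1 + ‖p‖ ^ 2))⁻¹, by positivity, ?_⟩
    unfold OpenPartialHomeomorph.univBall
    rw [dif_pos hr]
    change r * ((√(1 + ‖p‖ ^ 2))⁻¹ * p.2) + c.2 = _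
    ring

/-- Flatness is a local property. -/
lemma IsFlatAt.congr_of_mem_nhds {X : Type*} [TopologicalSpace X] {D Q D' Q' U : Set X} {x : X}
    (h : IsFlatAt D Q x) (hU : U ∈ 𝓝 x) (hD : ∀ y ∈ U, y ∈ D ↔ y ∈ D')
    (hQ : ∀ y ∈ U, y ∈ Q ↔ y ∈ Q') : IsFlatAt D' Q' x := by
  obtain ⟨e, he, h0, hDQ⟩ := h
  obtain ⟨s, hs, hs0, hsU, hst⟩ := exists_isOpenEmbedding_small 0
    (he.continuous.continuousAt.preimage_mem_nhds (h0 ▸ hU))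
  refine ⟨e ∘ s, he.comp hs, by simp [hs0, h0], fun p => ?_⟩
  obtain ⟨t, ht, htp⟩ := hst p
  rw [Prod.snd_zero, zero_add] at htp
  have h1 := hDQ (s p)
  rw [htp, mul_nonneg_iff_of_pos_left ht, mul_pos_iff_of_pos_left ht] at h1
  exact ⟨(hD _ (hsU p)).symm.trans h1.1, (hQ _ (hsU p)).symm.trans h1.2⟩

/-- Near a regular zero, the sign of a function is the sign of a coordinate. -/
lemma exists_chart_of_regular {v : ℝ × ℝ → ℝ} (hv : ContDiff ℝ 1 v) {z : ℝ × ℝ} (hz : v z = 0)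
    (hd : fderiv ℝ v z ≠ 0) :
    ∃ e : ℝ × ℝ → ℝ × ℝ, IsOpenEmbedding e ∧ e 0 = z ∧
      ∀ p, (v (e p) ≤ 0 ↔ p.2 ≤ 0) ∧ (v (e p) < 0 ↔ p.2 < 0) := by
  set T := fderiv ℝ v z with hT
  set a := T (1, 0) with ha
  set b := T (0, 1) with hb
  have hTp : ∀ p : ℝ × ℝ, T p = a * p.1 + b * p.2 := fun p => by
    have : p = p.1 • ((1, 0) : ℝ × ℝ) + p.2 • ((0, 1) : ℝ × ℝ) := by ext <;> simp
    conv_lhs => rw [this]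
    rw [map_add, map_smul, map_smul, smul_eq_mul, smul_eq_mul]
    ring
  have hab : a ^ 2 + b ^ 2 ≠ 0 := fun h => hd (by
    have h1 : a = 0 := by nlinarith [sq_nonneg a, sq_nonneg b]
    have h2 : b = 0 := by nlinarith [sq_nonneg a, sq_nonneg b]
    ext <;> simp [hTp, h1, h2])
  set ℓ : ℝ × ℝ →L[ℝ] ℝ :=
    (-b) • ContinuousLinearMap.fst ℝ ℝ ℝ + a • ContinuousLinearMap.snd ℝ ℝ ℝ with hℓ
  have hℓp : ∀ p : ℝ × ℝ, ℓ p = -b * p.1 + a * p.2 := fun p => by simp [hℓ]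
  set S : ℝ × ℝ →L[ℝ] ℝ × ℝ := ℓ.prod T with hS
  have hinj : Function.Injective (S : ℝ × ℝ →ₗ[ℝ] ℝ × ℝ) := by
    rw [← LinearMap.ker_eq_bot, LinearMap.ker_eq_bot']
    intro p hp
    have hp' : (ℓ p, T p) = (0, 0) := hp
    rw [Prod.mk.injEq, hℓp, hTp] at hp'
    obtain ⟨h1, h2⟩ := hp'
    have e1 : (a ^ 2 + b ^ 2) * p.1 = 0 := by linear_combination a * h2 - b * h1
    have e2 : (a ^ 2 + b ^ 2) * p.2 = 0 := by linear_combination b * h2 + a * h1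
    exact Prod.ext ((mul_eq_zero.1 e1).resolve_left hab) ((mul_eq_zero.1 e2).resolve_left hab)
  set S' : (ℝ × ℝ) ≃L[ℝ] ℝ × ℝ :=
    (LinearEquiv.ofInjectiveEndo (S : ℝ × ℝ →ₗ[ℝ] ℝ × ℝ) hinj).toContinuousLinearEquiv with hS'
  have hSS : (S' : ℝ × ℝ →L[ℝ] ℝ × ℝ) = S := by
    ext <;> rfl
  have hF : HasStrictFDerivAt (fun y => (ℓ y, v y)) (S' : ℝ × ℝ →L[ℝ] ℝ × ℝ) z := by
    rw [hSS]
    exact ℓ.hasStrictFDerivAt.prodMk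
      (hv.contDiffAt.hasStrictFDerivAt (by norm_num))
  set Ψ := hF.toOpenPartialHomeomorph (fun y => (ℓ y, v y)) with hΨ
  have hΨz : z ∈ Ψ.source := hF.mem_toOpenPartialHomeomorph_source
  have hΨp : ∀ y, Ψ y = (ℓ y, v y) := fun y => rfl
  obtain ⟨s, hs, hs0, hsU, hst⟩ := exists_isOpenEmbedding_small (Ψ z)
    (Ψ.open_target.mem_nhds (Ψ.map_source hΨz))
  refine ⟨fun p => Ψ.symm (s p), ?_, ?_, fun p => ?_⟩
  · have h1 : Continuous fun p => Ψ.symm (s p) :=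
      Ψ.continuousOn_symm.comp_continuous hs.continuous hsU
    refine IsOpenEmbedding.of_continuous_injective_isOpenMap h1 (fun p q hpq => ?_) fun O hO => ?_
    · exact hs.injective (Ψ.symm.injOn (hsU p) (hsU q) hpq)
    · have := Ψ.symm.isOpen_image_of_subset_source (hs.isOpenMap O hO)
        (by rintro _ ⟨p, -, rfl⟩; exact hsU p)
      rwa [image_image] at this
  · simp only [hs0]
    exact Ψ.left_inv hΨz
  · obtain ⟨t, ht, htp⟩ := hst p
    have h1 : v (Ψ.symm (s p)) = t * p.2 := by
      have := Ψ.right_inv (hsU p)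
      rw [hΨp] at this
      have h2 := congrArg Prod.snd this
      rw [htp, hΨp, hz] at h2
      simpa using h2
    simp only [h1]
    constructor
    · rw [← not_lt, ← not_lt, mul_pos_iff_of_pos_left ht]
    · rw [← not_le, ← not_le, mul_nonneg_iff_of_pos_left ht]

lemma isClosed_connectedComponentIn {X : Type*} [TopologicalSpace X] {F : Set X} (hF : IsClosed F)
    (x : X) : IsClosed (connectedComponentIn F x) := by
  by_cases hx : x ∈ F
  · rw [connectedComponentIn_eq_image hx]
    exact hF.isClosedEmbedding_subtypeVal.isClosedMap _ isClosed_connectedComponent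
  · rw [connectedComponentIn_eq_empty hx]
    exact isClosed_empty

lemma notMem_of_mem_closure_connectedComponentIn {X : Type*} [TopologicalSpace X]
    [LocallyConnectedSpace X] {U : Set X} (hU : IsOpen U) {x y : X}
    (hy : y ∈ closure (connectedComponentIn U x)) (hyn : y ∉ connectedComponentIn U x) : y ∉ U := by
  intro hyU
  obtain ⟨z, hz, hzx⟩ := mem_closure_iff.1 hy _ hU.connectedComponentIn (mem_connectedComponentIn hyU)
  rw [connectedComponentIn_eq hzx, ← connectedComponentIn_eq hz] at hyn
  exact hyn (mem_connectedComponentIn hyU)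

/-- Filling in all but one of the complementary components of a connected closed set keeps it
connected. -/
lemma isPreconnected_compl_connectedComponentIn {X : Type*} [TopologicalSpace X]
    [ConnectedSpace X] [LocallyConnectedSpace X] {C : Set X} (hC : IsClosed C)
    (hCc : IsConnected C) (x : X) : IsPreconnected (connectedComponentIn Cᶜ x)ᶜ := by
  obtain ⟨a, ha⟩ := hCc.nonempty
  have hsub : C ⊆ (connectedComponentIn Cᶜ x)ᶜ := fun y hy hy' =>
    connectedComponentIn_subset _ _ hy' hy
  refine isPreconnected_of_forall a fun y hy => ?_
  by_cases hyC : y ∈ C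
  · exact ⟨C, hsub, ha, hyC, hCc.isPreconnected⟩
  set W := connectedComponentIn Cᶜ y with hW
  have hyW : y ∈ W := mem_connectedComponentIn hyC
  have hWo : IsOpen W := hC.isOpen_compl.connectedComponentIn
  have hWC : closure W ⊆ W ∪ C := fun z hz => by
    by_cases hzW : z ∈ W
    · exact Or.inl hzW
    · exact Or.inr (not_not.1 (notMem_of_mem_closure_connectedComponentIn hC.isOpen_compl hz hzW))
  have hWx : Disjoint W (connectedComponentIn Cᶜ x) := by
    rw [Set.disjoint_left]
    intro z hz hzx
    apply hy
    rw [connectedComponentIn_eq hzx, ← connectedComponentIn_eq hz]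
    exact hyW
  have hcl : ((closure W) ∩ C).Nonempty := by
    by_contra hcon
    have h1 : closure W ⊆ W := fun z hz => (hWC hz).resolve_right fun h => hcon ⟨z, hz, h⟩
    have h2 : IsClopen W := ⟨isClosed_of_closure_subset h1, hWo⟩
    have h3 := h2.eq_univ ⟨y, hyW⟩
    have h4 : a ∈ W := by rw [h3]; trivial
    exact connectedComponentIn_subset Cᶜ y h4 ha
  obtain ⟨b, hb, hbC⟩ := hcl
  refine ⟨closure W ∪ C, ?_, Or.inr ha, Or.inl (subset_closure hyW), ?_⟩
  · rintro z (hz | hz)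
    · exact (hWC hz).elim (fun h => Set.disjoint_left.1 hWx h) fun h => hsub h
    · exact hsub hz
  · exact IsPreconnected.union b hb hbC isPreconnected_connectedComponentIn.closure
      hCc.isPreconnected

/-- The interior of a connected set with flat boundary is connected. -/
lemma isPreconnected_of_isFlatAt {X : Type*} [TopologicalSpace X] {D Q : Set X}
    (hD : IsPreconnected D) (hQ : IsOpen Q) (hQD : Q ⊆ D) (hflat : ∀ x ∈ D \ Q, IsFlatAt D Q x) :
    IsPreconnected Q := by
  have hpos : IsPreconnected {p : ℝ × ℝ | 0 < p.2} := by
    have : {p : ℝ × ℝ | 0 < p.2} = univ ×ˢ Ioi 0 := by ext p; simp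
    rw [this]
    exact isPreconnected_univ.prod isPreconnected_Ioi
  have hcl : D ⊆ closure Q := fun x hx => by
    by_cases hxQ : x ∈ Q
    · exact subset_closure hxQ
    obtain ⟨e, he, h0, hDQ⟩ := hflat x ⟨hx, hxQ⟩
    have ht : Tendsto (fun t : ℝ => e (0, t)) (𝓝[>] 0) (𝓝 x) := by
      have : Continuous fun t : ℝ => e (0, t) := he.continuous.comp (by fun_prop)
      rw [← h0]
      exact (this.tendsto 0).mono_left nhdsWithin_le_nhds
    refine mem_closure_of_tendsto ht ?_
    filter_upwards [self_mem_nhdsWithin] with t ht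
    exact (hDQ _).2.2 ht
  intro U V hU hV hQUV ⟨a, haQ, haU⟩ ⟨b, hbQ, hbV⟩
  by_contra hne
  have hdis : ∀ y ∈ Q, y ∈ U → y ∈ V → False := fun y h1 h2 h3 => hne ⟨y, h1, h2, h3⟩
  have hcov : D ⊆ closure (Q ∩ U) ∪ closure (Q ∩ V) := by
    rw [← closure_union, ← inter_union_distrib_left, inter_eq_left.2 hQUV]
    exact hcl
  obtain ⟨x, hxD, hxU, hxV⟩ := isPreconnected_closed_iff.1 hD _ _ isClosed_closure isClosed_closure
    hcov ⟨a, hQD haQ, subset_closure ⟨haQ, haU⟩⟩ ⟨b, hQD hbQ, subset_closure ⟨hbQ, hbV⟩⟩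
  by_cases hxQ : x ∈ Q
  · rcases hQUV hxQ with h | h
    · obtain ⟨y, ⟨hyQ, hyU⟩, -, hyV⟩ := mem_closure_iff.1 hxV _ (hQ.inter hU) ⟨hxQ, h⟩
      exact hdis y hyQ hyU hyV
    · obtain ⟨y, ⟨hyQ, hyV⟩, -, hyU⟩ := mem_closure_iff.1 hxU _ (hQ.inter hV) ⟨hxQ, h⟩
      exact hdis y hyQ hyU hyV
  · obtain ⟨e, he, h0, hDQ⟩ := hflat x ⟨hxD, hxQ⟩
    have hx : x ∈ range e := ⟨0, h0⟩
    obtain ⟨_, ⟨p, rfl⟩, hpQ, hpU⟩ := mem_closure_iff.1 hxU _ he.isOpen_range hx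
    obtain ⟨_, ⟨q, rfl⟩, hqQ, hqV⟩ := mem_closure_iff.1 hxV _ he.isOpen_range hx
    obtain ⟨_, ⟨s, hs, rfl⟩, hsU, hsV⟩ := hpos.image e he.continuous.continuousOn U V hU hV
      (by rintro _ ⟨s, hs, rfl⟩; exact hQUV ((hDQ s).2.2 hs))
      ⟨_, mem_image_of_mem e ((hDQ p).2.1 hpQ), hpU⟩ ⟨_, mem_image_of_mem e ((hDQ q).2.1 hqQ), hqV⟩
    exact hdis _ ((hDQ s).2.2 hs) hsU hsV

/-- If all compact sets are eventually mapped into `U`, they are eventually mapped into a single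
component of `U`. -/
lemma exists_absorbing_component {g : ℝ × ℝ → ℝ × ℝ} (hg : Continuous g) {U : Set (ℝ × ℝ)}
    (hU : ∀ K, IsCompact K → ∃ N : ℕ, ∀ n ≥ N, ∀ z ∈ K, g^[n] z ∈ U) :
    ∃ q ∈ U, ∀ K, IsCompact K → ∃ N : ℕ, ∀ n ≥ N, ∀ z ∈ K, g^[n] z ∈ connectedComponentIn U q := by
  set S := segment ℝ 0 (g 0) with hS
  have hSc : IsPreconnected S := (convex_segment _ _).isPreconnected
  have hSk : IsCompact S := by
    rw [hS, segment_eq_image_lineMap]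
    exact isCompact_Icc.image (by fun_prop)
  obtain ⟨N, hN⟩ := hU S hSk
  have h0S : (0 : ℝ × ℝ) ∈ S := left_mem_segment _ _ _
  set R := ⋃ n : ℕ, g^[N + n] '' S with hR
  have hRc : IsPreconnected R := by
    refine IsPreconnected.iUnion_of_chain
      (fun n => hSc.image _ (hg.iterate _).continuousOn) fun n => ⟨g^[N + n] (g 0), ?_, ?_⟩
    · exact mem_image_of_mem _ (right_mem_segment _ _ _)
    · refine ⟨0, h0S, ?_⟩
      rw [Nat.succ_eq_succ, Nat.succ_eq_add_one, ← add_assoc, Function.iterate_succ_apply]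
  have hRU : R ⊆ U := by
    refine iUnion_subset fun n => ?_
    rintro _ ⟨z, hz, rfl⟩
    exact hN _ (Nat.le_add_right _ _) z hz
  have hq : g^[N] 0 ∈ R := mem_iUnion.2 ⟨0, mem_image_of_mem _ h0S⟩
  refine ⟨g^[N] 0, hRU hq, fun K hK => ?_⟩
  obtain ⟨r, hr⟩ := hK.isBounded.subset_closedBall 0
  set K' := Metric.closedBall (0 : ℝ × ℝ) (max r 0) with hK'
  obtain ⟨M, hM⟩ := hU K' (isCompact_closedBall _ _)
  refine ⟨max M N, fun n hn z hz => ?_⟩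
  have hK'c : IsPreconnected K' := (convex_closedBall _ _).isPreconnected
  have h0K : (0 : ℝ × ℝ) ∈ K' := by simp [hK']
  have hun : IsPreconnected (g^[n] '' K' ∪ R) := by
    refine IsPreconnected.union (g^[n] 0) (mem_image_of_mem _ h0K) ?_
      (hK'c.image _ (hg.iterate _).continuousOn) hRc
    obtain ⟨m, rfl⟩ := Nat.exists_eq_add_of_le ((le_max_right _ _).trans hn)
    exact mem_iUnion.2 ⟨m, mem_image_of_mem _ h0S⟩
  refine hun.subset_connectedComponentIn (Or.inr hq) ?_ (Or.inl (mem_image_of_mem _ ?_))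
  · refine union_subset ?_ hRU
    rintro _ ⟨y, hy, rfl⟩
    exact hM n ((le_max_left _ _).trans hn) y hy
  · exact Metric.closedBall_subset_closedBall (le_max_left _ _) (hr hz)

/-- A connected open set with connected complement and flat boundary, mapped by `f` strictly inside
itself, that absorbs all compact sets in forward time and none in backward time. -/
structure IsTrap (f : (ℝ × ℝ) ≃ₜ (ℝ × ℝ)) (B : Set (ℝ × ℝ)) : Prop where
  isOpen : IsOpen B
  isPreconnected : IsPreconnected B
  compl : IsPreconnected Bᶜ
  mapsTo : ∀ x ∈ closure B, f x ∈ B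
  flat : ∀ x ∈ closure B \ B, IsFlatAt (closure B) B x
  flat_compl : ∀ x ∈ closure B \ B, IsFlatAt Bᶜ (closure B)ᶜ x
  forward : ∀ K, IsCompact K → ∃ N : ℕ, ∀ n ≥ N, ∀ z ∈ K, f^[n] z ∈ B
  backward : ∀ K, IsCompact K → ∃ N : ℕ, ∀ n ≥ N, ∀ z ∈ K, f.symm^[n] z ∉ closure B

lemma IsFlatAt.of_chart {v : ℝ × ℝ → ℝ} {A₀ B : Set (ℝ × ℝ)} {x : ℝ × ℝ}
    {e : ℝ × ℝ → ℝ × ℝ} (he : IsOpenEmbedding e) (h0 : e 0 = x)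
    (hv : ∀ p, (v (e p) ≤ 0 ↔ p.2 ≤ 0) ∧ (v (e p) < 0 ↔ p.2 < 0))
    (hA : ∀ T : Set (ℝ × ℝ), IsPreconnected T → (∀ y ∈ T, v y ≤ 0) → (T ∩ A₀).Nonempty → T ⊆ A₀)
    (hBc : ∀ T : Set (ℝ × ℝ), IsPreconnected T → (∀ y ∈ T, 0 < v y) → (T ∩ B).Nonempty → T ⊆ B)
    (hAB : Disjoint A₀ B) (hxA : x ∈ A₀) (hxB : x ∈ closure B) :
    IsFlatAt (closure B) B x ∧ IsFlatAt Bᶜ (closure B)ᶜ x := by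
  have hlow : IsPreconnected {p : ℝ × ℝ | p.2 ≤ 0} := by
    have : {p : ℝ × ℝ | p.2 ≤ 0} = univ ×ˢ Iic 0 := by ext p; simp
    rw [this]
    exact isPreconnected_univ.prod isPreconnected_Iic
  have hup : IsPreconnected {p : ℝ × ℝ | 0 < p.2} := by
    have : {p : ℝ × ℝ | 0 < p.2} = univ ×ˢ Ioi 0 := by ext p; simp
    rw [this]
    exact isPreconnected_univ.prod isPreconnected_Ioi
  have h1 : e '' {p | p.2 ≤ 0} ⊆ A₀ := by
    refine hA _ (hlow.image _ he.continuous.continuousOn) ?_ ⟨x, ⟨0, by simp, h0⟩, hxA⟩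
    rintro _ ⟨p, hp, rfl⟩
    exact (hv p).1.2 hp
  have h1' : ∀ p : ℝ × ℝ, p.2 ≤ 0 → e p ∉ B := fun p hp hpB =>
    Set.disjoint_left.1 hAB (h1 (mem_image_of_mem e hp)) hpB
  have h2 : e '' {p | 0 < p.2} ⊆ B := by
    obtain ⟨_, ⟨p, rfl⟩, hpB⟩ := mem_closure_iff.1 hxB _ he.isOpen_range ⟨0, h0⟩
    have hp : 0 < p.2 := by
      by_contra hcon
      exact h1' p (not_lt.1 hcon) hpB
    refine hBc _ (hup.image _ he.continuous.continuousOn) ?_ ⟨_, mem_image_of_mem e hp, hpB⟩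
    rintro _ ⟨p, hp, rfl⟩
    rw [← not_le, (hv p).1, not_le]
    exact hp
  have hBiff : ∀ p, e p ∈ B ↔ 0 < p.2 := fun p =>
    ⟨fun h => by by_contra hcon; exact h1' p (not_lt.1 hcon) h,
      fun h => h2 (mem_image_of_mem e h)⟩
  have hBcl : ∀ p, e p ∈ closure B ↔ 0 ≤ p.2 := fun p => by
    constructor
    · intro h
      by_contra! hcon
      have hO : IsOpen (e '' {q | q.2 < 0}) :=
        he.isOpenMap _ (isOpen_lt continuous_snd continuous_const)
      obtain ⟨_, ⟨q, hq, rfl⟩, hqB⟩ := mem_closure_iff.1 h _ hO (mem_image_of_mem e hcon)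
      exact h1' q (le_of_lt hq) hqB
    · intro h
      have ht : Tendsto (fun t : ℝ => e (p.1, p.2 + t)) (𝓝[>] 0) (𝓝 (e p)) := by
        have : Continuous fun t : ℝ => e (p.1, p.2 + t) := he.continuous.comp (by fun_prop)
        have := this.tendsto 0
        rw [add_zero] at this
        exact this.mono_left nhdsWithin_le_nhds
      refine mem_closure_of_tendsto ht ?_
      filter_upwards [self_mem_nhdsWithin] with t ht
      exact (hBiff _).2 (add_pos_of_nonneg_of_pos h ht)
  refine ⟨⟨e, he, h0, fun p => ⟨hBcl p, hBiff p⟩⟩, ?_⟩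
  let σ : (ℝ × ℝ) ≃ₜ (ℝ × ℝ) := (Homeomorph.refl ℝ).prodCongr (Homeomorph.neg ℝ)
  have hσ : ∀ p : ℝ × ℝ, σ p = (p.1, -p.2) := fun p => rfl
  refine ⟨e ∘ σ, he.comp σ.isOpenEmbedding, ?_, fun p => ?_⟩
  · have h : σ 0 = 0 := by rw [hσ]; simp
    rw [Function.comp_apply, h, h0]
  · simp only [Function.comp, mem_compl_iff, hBcl, hBiff, hσ]
    constructor <;> constructor <;> intro h <;> linarith

lemma IsEventuallyDisplacing.exists_isTrap {f : (ℝ × ℝ) ≃ₜ (ℝ × ℝ)}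
    (hf : IsEventuallyDisplacing f) : ∃ B, IsTrap f B := by
  obtain ⟨φ, hφ, hφf⟩ := hf.exists_height
  obtain ⟨v, hvc, hvφ, hvd⟩ := exists_contDiff_regular hφ
  have hv : Continuous v := hvc.continuous
  have hφn : ∀ (n : ℕ) z, φ (f^[n] z) = φ z + n := fun n => by
    induction n with
    | zero => simp
    | succ n ih => intro z; rw [Function.iterate_succ_apply, ih, hφf]; push_cast; ring
  have hφs : ∀ z, φ (f.symm z) = φ z - 1 := fun z => by
    have := hφf (f.symm z)
    rw [f.apply_symm_apply] at this
    linarith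
  have hφsn : ∀ (n : ℕ) z, φ (f.symm^[n] z) = φ z - n := fun n => by
    induction n with
    | zero => simp
    | succ n ih => intro z; rw [Function.iterate_succ_apply, ih, hφs]; push_cast; ring
  have hbd : ∀ K, IsCompact K → ∃ N : ℕ, ∀ z ∈ K, |φ z| ≤ N := fun K hK => by
    obtain ⟨C, hC⟩ := hK.exists_bound_of_continuousOn hφ.continuousOn
    obtain ⟨N, hN⟩ := exists_nat_ge C
    exact ⟨N, fun z hz => (hC z hz).trans hN⟩
  set A : Set (ℝ × ℝ) := {z | v z ≤ 0} with hA
  have hAc : IsClosed A := isClosed_le hv continuous_const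
  have hAint : ∀ z, v z < 0 → z ∈ interior A := fun z hz =>
    mem_interior_iff_mem_nhds.2 (mem_of_superset
      ((isOpen_lt hv continuous_const).mem_nhds hz) fun y (hy : v y < 0) => show v y ≤ 0 from hy.le)
  have hsymmA : ∀ z ∈ A, f.symm z ∈ interior A := fun z hz => hAint _ (by
    have h1 := abs_lt.1 (hvφ z)
    have h2 := abs_lt.1 (hvφ (f.symm z))
    rw [hφs] at h2
    have h3 : v z ≤ 0 := hz
    linarith)
  obtain ⟨q, hqA, hq⟩ := exists_absorbing_component (g := f.symm) f.symm.continuous (U := A)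
    fun K hK => by
      obtain ⟨N, hN⟩ := hbd K hK
      refine ⟨N + 1, fun n hn z hz => ?_⟩
      have h1 := abs_lt.1 (hvφ (f.symm^[n] z))
      have h2 := abs_le.1 (hN z hz)
      have h3 : ((N + 1 : ℕ) : ℝ) ≤ n := by exact_mod_cast hn
      push_cast at h3
      rw [hφsn] at h1
      change v _ ≤ 0
      linarith
  set A₀ := connectedComponentIn A q with hA₀
  have hA₀c : IsClosed A₀ := isClosed_connectedComponentIn hAc q
  have hA₀A : A₀ ⊆ A := connectedComponentIn_subset _ _
  have hA₀conn : IsConnected A₀ := isConnected_connectedComponentIn_iff.2 hqA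
  have hA₀max : ∀ T : Set (ℝ × ℝ), IsPreconnected T → (∀ y ∈ T, v y ≤ 0) → (T ∩ A₀).Nonempty →
      T ⊆ A₀ := fun T hT hTA ⟨y, hyT, hy⟩ => by
    rw [hA₀, connectedComponentIn_eq hy]
    exact hT.subset_connectedComponentIn hyT hTA
  obtain ⟨p, hpA, hp⟩ := exists_absorbing_component (g := f) f.continuous (U := A₀ᶜ)
    fun K hK => by
      obtain ⟨N, hN⟩ := hbd K hK
      refine ⟨N + 1, fun n hn z hz hcon => ?_⟩
      have h1 := abs_lt.1 (hvφ (f^[n] z))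
      have h2 := abs_le.1 (hN z hz)
      have h3 : ((N + 1 : ℕ) : ℝ) ≤ n := by exact_mod_cast hn
      push_cast at h3
      rw [hφn] at h1
      have h4 : v (f^[n] z) ≤ 0 := hA₀A hcon
      linarith
  set B := connectedComponentIn A₀ᶜ p with hB
  have hBo : IsOpen B := hA₀c.isOpen_compl.connectedComponentIn
  have hBA : B ⊆ A₀ᶜ := connectedComponentIn_subset _ _
  have hBmax : ∀ T : Set (ℝ × ℝ), IsPreconnected T → T ⊆ A₀ᶜ → (T ∩ B).Nonempty →
      T ⊆ B := fun T hT hTA ⟨y, hyT, hy⟩ => by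
    rw [hB, connectedComponentIn_eq hy]
    exact hT.subset_connectedComponentIn hyT hTA
  -- backward invariance of `A₀`
  have hinterior : ∀ z ∈ A₀, z ∈ interior A → z ∈ interior A₀ := fun z hz hzi => by
    obtain ⟨r, hr, hrA⟩ := Metric.isOpen_iff.1 isOpen_interior z hzi
    refine mem_interior_iff_mem_nhds.2 (mem_of_superset (Metric.ball_mem_nhds z hr) ?_)
    exact hA₀max _ (convex_ball z r).isPreconnected (fun y hy => interior_subset (s := A) (hrA hy))
      ⟨z, Metric.mem_ball_self hr, hz⟩
  have hsymm₀ : ∀ z ∈ A₀, f.symm z ∈ A₀ := by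
    obtain ⟨N, hN⟩ := hq {0} isCompact_singleton
    have : f.symm '' A₀ ⊆ A₀ := by
      refine hA₀max _ (hA₀conn.isPreconnected.image _ f.symm.continuous.continuousOn) ?_
        ⟨f.symm^[N + 1] 0, ?_, hN _ (Nat.le_succ _) 0 rfl⟩
      · rintro _ ⟨z, hz, rfl⟩
        exact interior_subset (s := A) (hsymmA z (hA₀A hz))
      · rw [Function.iterate_succ_apply']
        exact mem_image_of_mem _ (hN N le_rfl 0 rfl)
    exact fun z hz => this (mem_image_of_mem _ hz)
  have hsymmI : ∀ z ∈ A₀, f.symm z ∈ interior A₀ := fun z hz =>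
    hinterior _ (hsymm₀ z hz) (hsymmA z (hA₀A hz))
  have hclB : ∀ z ∈ closure B, z ∉ interior A₀ := fun z hz hzi => by
    obtain ⟨y, hy, hyB⟩ := mem_closure_iff.1 hz _ isOpen_interior hzi
    exact hBA hyB (interior_subset hy)
  have hBconn : IsPreconnected B := isPreconnected_connectedComponentIn
  have hcharts : ∀ x ∈ closure B \ B, IsFlatAt (closure B) B x ∧ IsFlatAt Bᶜ (closure B)ᶜ x := by
    rintro x ⟨hx, hxB⟩
    have hxA : x ∈ A₀ := not_not.1
      (notMem_of_mem_closure_connectedComponentIn hA₀c.isOpen_compl hx hxB)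
    have hvx : v x = 0 := by
      refine le_antisymm (hA₀A hxA) (not_lt.1 fun hlt => ?_)
      exact hclB x hx (hinterior x hxA (hAint x hlt))
    obtain ⟨e, he, h0, hev⟩ := exists_chart_of_regular hvc hvx (hvd x hvx)
    exact IsFlatAt.of_chart he h0 hev hA₀max
      (fun T hT hTv => hBmax T hT fun y hy hyA => not_le.2 (hTv y hy) (hA₀A hyA))
      (Set.disjoint_left.2 fun y hy hyB => hBA hyB hy) hxA hx
  refine ⟨B, hBo, hBconn, isPreconnected_compl_connectedComponentIn hA₀c hA₀conn p, ?_,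
    fun x hx => (hcharts x hx).1, fun x hx => (hcharts x hx).2, hp, fun K hK => ?_⟩
  · obtain ⟨N, hN⟩ := hp {0} isCompact_singleton
    have : f '' closure B ⊆ B := by
      refine hBmax _ (hBconn.closure.image _ f.continuous.continuousOn) ?_
        ⟨f^[N + 1] 0, ?_, hN _ (Nat.le_succ _) 0 rfl⟩
      · rintro _ ⟨z, hz, rfl⟩ hfz
        have := hsymmI _ hfz
        rw [f.symm_apply_apply] at this
        exact hclB z hz this
      · rw [Function.iterate_succ_apply']
        exact mem_image_of_mem _ (subset_closure (hN N le_rfl 0 rfl))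
    exact fun z hz => this (mem_image_of_mem _ hz)
  · obtain ⟨N, hN⟩ := hq K hK
    refine ⟨N + 1, fun n hn z hz hcl => hclB _ hcl ?_⟩
    obtain ⟨m, rfl⟩ := Nat.exists_eq_add_of_le hn
    rw [show N + 1 + m = (N + m) + 1 by ring, Function.iterate_succ_apply']
    exact hsymmI _ (hN _ (Nat.le_add_right _ _) z hz)

lemma IsPreconnected.disjoint_of_isOpen_union {X : Type*} [TopologicalSpace X] [T2Space X]
    {F Q K : Set X} (hF : IsPreconnected F) (hFc : IsClosed F) (hFn : ¬ IsCompact F)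
    (hFQ : Disjoint F Q) (hK : IsCompact K) (hO : IsOpen (Q ∪ K)) : Disjoint K F := by
  by_contra hcon
  obtain ⟨x, hxK, hxF⟩ := Set.not_disjoint_iff.1 hcon
  have hcov : F ⊆ (Q ∪ K) ∪ Kᶜ := fun y _ => (em (y ∈ K)).imp Or.inr id
  refine hFn (hK.of_isClosed_subset hFc fun y hy => ?_)
  by_contra hyK
  obtain ⟨w, hwF, hw | hw, hwK⟩ := hF _ _ hO hK.isClosed.isOpen_compl hcov ⟨x, hxF, Or.inr hxK⟩
    ⟨y, hy, hyK⟩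
  · exact Set.disjoint_left.1 hFQ hwF hw
  · exact hwK hw

namespace IsTrap

variable {f : (ℝ × ℝ) ≃ₜ (ℝ × ℝ)} {B : Set (ℝ × ℝ)}

lemma nonempty (h : IsTrap f B) : B.Nonempty := by
  obtain ⟨N, hN⟩ := h.forward {0} isCompact_singleton
  exact ⟨_, hN N le_rfl 0 rfl⟩

lemma closure_ne_univ (h : IsTrap f B) : closure B ≠ univ := by
  obtain ⟨N, hN⟩ := h.backward {0} isCompact_singleton
  exact fun hB => hN N le_rfl 0 rfl (hB ▸ mem_univ _)

lemma iterate_mem (h : IsTrap f B) {x : ℝ × ℝ} (hx : x ∈ closure B) (n : ℕ) :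
    f^[n] x ∈ closure B := by
  induction n with
  | zero => exact hx
  | succ n ih =>
    rw [Function.iterate_succ_apply']
    exact subset_closure (h.mapsTo _ ih)

lemma iterate_succ_mem (h : IsTrap f B) {x : ℝ × ℝ} (hx : x ∈ closure B) (n : ℕ) :
    f^[n + 1] x ∈ B := by
  rw [Function.iterate_succ_apply']
  exact h.mapsTo _ (h.iterate_mem hx n)

lemma image_closure_subset (h : IsTrap f B) : f '' closure B ⊆ B := by
  rintro _ ⟨x, hx, rfl⟩
  exact h.mapsTo x hx

lemma not_isCompact_compl (h : IsTrap f B) : ¬ IsCompact Bᶜ := fun hK => by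
  obtain ⟨N, hN⟩ := h.forward _ hK
  obtain ⟨z, hz⟩ := (ne_univ_iff_exists_notMem _).1 h.closure_ne_univ
  have hzB : z ∉ B := fun hzB => hz (subset_closure hzB)
  have h1 : f^[N] (f.symm^[N] z) = z :=
    (Function.LeftInverse.iterate f.apply_symm_apply N) z
  have h2 : f.symm^[N] z ∈ Bᶜ := fun hw => hzB (by
    have := subset_closure hw
    cases N with
    | zero => exact hw
    | succ n => rw [← h1]; exact h.iterate_succ_mem this n)
  exact hzB (h1 ▸ hN N le_rfl _ h2)

lemma not_isCompact_image_closure (h : IsTrap f B) : ¬ IsCompact (f '' closure B) := fun hK => by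
  obtain ⟨N, hN⟩ := h.backward _ hK
  obtain ⟨z, hz⟩ := h.nonempty
  have hz' : f z ∈ f '' closure B := mem_image_of_mem f (subset_closure hz)
  have h1 : f.symm^[N] (f^[N] (f z)) = f z :=
    (Function.LeftInverse.iterate f.symm_apply_apply N) _
  have h2 : f^[N] (f z) ∈ f '' closure B := by
    rw [← Function.iterate_succ_apply, Function.iterate_succ_apply']
    exact mem_image_of_mem f (h.iterate_mem (subset_closure hz) N)
  exact hN N le_rfl _ h2 (h1.symm ▸ subset_closure (h.image_closure_subset hz'))

lemma isConnected_frontier (h : IsTrap f B) : IsConnected (closure B \ B) := by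
  rw [sdiff_eq]
  refine ⟨?_, isPreconnected_inter_of_union_eq_univ isClosed_closure h.isOpen.isClosed_compl
    h.isPreconnected.closure h.compl ?_⟩
  · by_contra hcon
    rw [not_nonempty_iff_eq_empty, ← sdiff_eq, sdiff_eq_empty] at hcon
    have hcl : IsClosed B := isClosed_of_closure_subset hcon
    rcases isClopen_iff.1 ⟨hcl, h.isOpen⟩ with h1 | h1
    · exact h.nonempty.ne_empty h1
    · exact h.closure_ne_univ (by rw [hcl.closure_eq, h1])
  · exact eq_univ_of_forall fun x => (em (x ∈ B)).imp (fun hx => subset_closure hx) id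

lemma isPreconnected_inter (h : IsTrap f B) : IsPreconnected (closure B ∩ f '' Bᶜ) := by
  refine isPreconnected_inter_of_union_eq_univ isClosed_closure
    (f.isClosedMap _ h.isOpen.isClosed_compl) h.isPreconnected.closure
    (h.compl.image _ f.continuous.continuousOn) (eq_univ_of_forall fun x => ?_)
  by_cases hx : f.symm x ∈ B
  · exact Or.inl (subset_closure (h.image_closure_subset ⟨_, subset_closure hx, by simp⟩))
  · exact Or.inr ⟨_, hx, by simp⟩

lemma sdiff_eq_union (h : IsTrap f B) :
    (closure B ∩ f '' Bᶜ) \ (B \ f '' closure B) = (closure B \ B) ∪ f '' (closure B \ B) := by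
  have hm : ∀ (S : Set (ℝ × ℝ)) y, y ∈ f '' S ↔ f.symm y ∈ S := fun S y => by
    rw [f.image_eq_preimage_symm]; rfl
  ext y
  have h1 : f.symm y ∈ closure B → y ∈ B := fun hy => by simpa using h.mapsTo _ hy
  have h2 : f.symm y ∈ B → f.symm y ∈ closure B := fun hy => subset_closure hy
  have h3 : y ∈ B → y ∈ closure B := fun hy => subset_closure hy
  simp only [mem_union, Set.mem_sdiff, mem_inter_iff, hm, mem_compl_iff]
  tauto

lemma isFlatAt (h : IsTrap f B) :
    ∀ x ∈ (closure B ∩ f '' Bᶜ) \ (B \ f '' closure B),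
      IsFlatAt (closure B ∩ f '' Bᶜ) (B \ f '' closure B) x := by
  rw [h.sdiff_eq_union]
  rintro y (hy | ⟨x, hx, rfl⟩)
  · refine (h.flat y hy).congr_of_mem_nhds (U := (f '' closure B)ᶜ)
      ((f.isClosedMap _ isClosed_closure).isOpen_compl.mem_nhds
        fun hy' => hy.2 (h.image_closure_subset hy')) (fun z hz => ?_) fun z hz => ?_
    · refine ⟨fun hzB => ⟨hzB, f.symm z, fun hz' => hz ⟨_, subset_closure hz', by simp⟩, by simp⟩,
        fun hzB => hzB.1⟩
    · exact ⟨fun hzB => ⟨hzB, hz⟩, fun hzB => hzB.1⟩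
  · refine ((h.flat_compl x hx).image f.isOpenEmbedding).congr_of_mem_nhds (U := B)
      (h.isOpen.mem_nhds (h.mapsTo x hx.1)) (fun z hz => ?_) fun z hz => ?_
    · exact ⟨fun hz' => ⟨subset_closure hz, hz'⟩, fun hz' => hz'.2⟩
    · rw [image_compl_eq f.bijective]
      exact ⟨fun hz' => ⟨hz, hz'⟩, fun hz' => hz'.2⟩

lemma isOpen_sdiff (h : IsTrap f B) : IsOpen (B \ f '' closure B) :=
  h.isOpen.sdiff (f.isClosedMap _ isClosed_closure)

lemma sdiff_subset_inter : B \ f '' closure B ⊆ closure B ∩ f '' Bᶜ := fun x hx =>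
  ⟨subset_closure hx.1, f.symm x, fun hx' => hx.2 ⟨_, subset_closure hx', by simp⟩, by simp⟩

lemma isConnected_sdiff (h : IsTrap f B) : IsConnected (B \ f '' closure B) := by
  refine ⟨?_, isPreconnected_of_isFlatAt h.isPreconnected_inter h.isOpen_sdiff
    sdiff_subset_inter h.isFlatAt⟩
  obtain ⟨x, hx⟩ := h.isConnected_frontier.nonempty
  obtain ⟨e, -, -, he⟩ := h.isFlatAt x (h.sdiff_eq_union.ge (Or.inl hx))
  exact ⟨e (0, 1), (he _).2.2 (by simp)⟩

lemma holeFree (h : IsTrap f B) : HoleFree (toCplx '' (B \ f '' closure B)) := by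
  intro X hX hd hO
  have hcomp : IsCompact (toCplx ⁻¹' X) :=
    toCplx.toHomeomorph.isCompact_preimage.2 hX
  have hO' : IsOpen ((B \ f '' closure B) ∪ toCplx ⁻¹' X) := by
    have := hO.preimage toCplx.continuous
    rwa [preimage_union, preimage_image_eq _ toCplx.injective] at this
  have h1 := h.compl.disjoint_of_isOpen_union h.isOpen.isClosed_compl h.not_isCompact_compl
    (Set.disjoint_left.2 fun x hx hx' => hx hx'.1) hcomp hO'
  have h2 := (h.isPreconnected.closure.image f f.continuous.continuousOn).disjoint_of_isOpen_union
    (f.isClosedMap _ isClosed_closure) h.not_isCompact_image_closure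
    (Set.disjoint_left.2 fun x hx hx' => hx'.2 hx) hcomp hO'
  refine eq_empty_of_forall_notMem fun w hw => ?_
  obtain ⟨z, rfl⟩ := toCplx.surjective w
  by_cases hzB : z ∈ B
  · by_cases hz : z ∈ f '' closure B
    · exact Set.disjoint_left.1 h2 hw hz
    · exact Set.disjoint_left.1 hd hw (mem_image_of_mem _ ⟨hzB, hz⟩)
  · exact Set.disjoint_left.1 h1 hw hzB

lemma zpow_mem (h : IsTrap f B) {x : ℝ × ℝ} (hx : x ∈ closure B) {k : ℤ} (hk : 1 ≤ k) :
    (f ^ k) x ∈ B := by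
  obtain ⟨n, rfl⟩ := Int.le.dest hk
  rw [show (1 : ℤ) + n = ((n + 1 : ℕ) : ℤ) by push_cast; ring, zpow_natCast,
    Homeomorph.coe_pow_eq_iterate]
  exact h.iterate_succ_mem hx n

lemma exists_zpow_bound (h : IsTrap f B) {K : Set (ℝ × ℝ)} (hK : IsCompact K) :
    ∃ N : ℕ, ∀ x ∈ K, ∀ k : ℤ, (N ≤ k → (f ^ k) x ∈ B) ∧ (k ≤ -N → (f ^ k) x ∉ closure B) := by
  obtain ⟨N₁, h₁⟩ := h.forward K hK
  obtain ⟨N₂, h₂⟩ := h.backward K hK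
  refine ⟨max N₁ N₂, fun x hx k => ⟨fun hk => ?_, fun hk => ?_⟩⟩
  · lift k to ℕ using (by omega)
    rw [zpow_natCast, Homeomorph.coe_pow_eq_iterate]
    exact h₁ k (by omega) x hx
  · obtain ⟨n, rfl⟩ : ∃ n : ℕ, k = -n := ⟨k.natAbs, by omega⟩
    rw [zpow_neg, zpow_natCast, ← inv_pow, Homeomorph.coe_pow_eq_iterate]
    exact h₂ n (by omega) x hx

lemma isFundDomain (h : IsTrap f B) : IsFundDomain f (closure B ∩ f '' Bᶜ) where
  isClosed := isClosed_closure.inter (f.isClosedMap _ h.isOpen.isClosed_compl)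
  exists_mem x := by
    obtain ⟨N, hN⟩ := h.exists_zpow_bound (isCompact_singleton (x := x))
    obtain ⟨k, hk, hmin⟩ := Int.exists_least_of_bdd (P := fun k => (f ^ k) x ∈ closure B)
      ⟨-N, fun k hk => by
        by_contra hcon
        exact (hN x rfl k).2 (by omega) hk⟩
      ⟨N, subset_closure ((hN x rfl N).1 le_rfl)⟩
    refine ⟨k, hk, (f ^ (k - 1)) x, fun hB => ?_, ?_⟩
    · have := hmin (k - 1) (subset_closure hB)
      omega
    · rw [← Homeomorph.mul_apply, ← zpow_one_add]
      congr 2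
      ring
  locallyFinite x := by
    obtain ⟨K, hK, hx⟩ := exists_compact_mem_nhds x
    obtain ⟨N, hN⟩ := h.exists_zpow_bound hK
    refine ⟨K, hx, (Set.finite_Icc (-N : ℤ) N).subset ?_⟩
    rintro k ⟨y, hy, hyK⟩
    by_contra hcon
    rw [mem_Icc, not_and_or, not_le, not_le] at hcon
    rcases hcon with hcon | hcon
    · exact (hN y hyK k).2 hcon.le hy.1
    · obtain ⟨z, hz, hzy⟩ := hy.2
      refine hz ?_
      have : z = (f ^ (k - 1)) y := by
        apply f.injective
        rw [hzy, ← Homeomorph.mul_apply, ← zpow_one_add]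
        congr 2
        ring
      rw [this]
      exact (hN y hyK _).1 (by omega)
  notMem x hx k hk hkx := by
    obtain ⟨z, hz, hzy⟩ := hkx.2
    refine hz ?_
    have : z = (f ^ (k - 1)) x := by
      apply f.injective
      rw [hzy, ← Homeomorph.mul_apply, ← zpow_one_add]
      congr 2
      ring
    rw [this]
    exact h.zpow_mem hx.1 (by omega)

lemma exists_conj (h : IsTrap f B) (hf : IsBrouwer f) :
    ∃ h : (ℝ × ℝ) ≃ₜ (ℝ × ℝ), ∀ z, h (f (h.symm z)) = planeTranslation z := by
  obtain ⟨ψ, g, hψ⟩ := exists_isDiscModel h.holeFree h.isOpen_sdiff h.isConnected_sdiff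
    sdiff_subset_inter h.isFlatAt
  have hcl : IsClosed (closure B \ B) := isClosed_closure.sdiff h.isOpen
  have hsub := (subset_union_left.trans h.sdiff_eq_union.ge : closure B \ B ⊆ _)
  have hsub' := (subset_union_right.trans h.sdiff_eq_union.ge : f '' (closure B \ B) ⊆ _)
  obtain ⟨Φ, Φ', hΦ, h0, h1⟩ := hψ.exists_strip h.sdiff_eq_union hcl (f.isClosedMap _ hcl)
    h.isConnected_frontier (h.isConnected_frontier.image f f.continuous.continuousOn)
    (Set.disjoint_left.2 fun x hx hx' =>
      hx.2 (h.image_closure_subset (image_mono sdiff_subset hx')))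
  refine hf.exists_conj_of_isFundDomain h.isFundDomain (hsub.trans sdiff_subset)
    (hsub'.trans sdiff_subset) (fun x hx hfx => ⟨hx.1, ?_⟩) hΦ h0 h1
  exact (f.injective.mem_set_image (s := Bᶜ)).1 hfx.2

end IsTrap

/-- a Brouwer homeomorphism has polynomial entropy `1` iff it is conjugate to
the translation `T(x,y) = (x+1, y)`. -/
theorem brouwer_polEntropy_eq_one_iff_conj_translation
    (f : (ℝ × ℝ) ≃ₜ (ℝ × ℝ)) (hf : IsBrouwer f) :
    polEntropy (onePointExtend ⇑f) = 1 ↔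
      ∃ h : (ℝ × ℝ) ≃ₜ (ℝ × ℝ), ∀ z, h (f (h.symm z)) = planeTranslation z := by
  refine ⟨fun h => ?_, fun ⟨h, hh⟩ => (isEventuallyDisplacing_of_conj hh).polEntropy_eq_one⟩
  obtain ⟨B, hB⟩ := (hf.isEventuallyDisplacing h.le).exists_isTrap
  exact hB.exists_conj hf
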